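/- arXiv:2410.23013 — 2 statements merged into one kernel-verified Lean document; each statement's English description precedes it below -/
import Mathlib

section
/- For critical Bernoulli bond percolation on Z² (edges independently open with probability 1/2), there exist constants c > 0 and M ≥ 1 such that for all integers r, R with 1 ≤ r and R ≥ M·r, one has μ[A_01(r,R)] ≤ (r/R)^c · μ[A_1(r,R)] · μ[A_0(r,R)]. -/
open MeasureTheory ENNReal

namespace FKArm

/-- Vertices of the square lattice `ℤ²`. -/
abbrev Vertex : Type := ℤ × ℤ

/-- Edges of `ℤ²`, parametrized by their lower-left endpoint and an orientation:
`(v, false)` is the horizontal edge from `v` to `v + (1,0)`,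
`(v, true)` is the vertical edge from `v` to `v + (0,1)`. -/
abbrev Edge : Type := Vertex × Bool

/-- Percolation configurations: an edge `e` is open iff `ω e = true`. -/
abbrev Config : Type := Edge → Bool

/-- The two endpoints of a (primal) edge. -/
def ends (e : Edge) : Vertex × Vertex :=
  (e.1, if e.2 then (e.1.1, e.1.2 + 1) else (e.1.1 + 1, e.1.2))

/-- The two endpoints of the dual edge crossing `e`. A dual vertex `u : ℤ × ℤ`
represents the point `u + (1/2, 1/2)` of the dual lattice. -/
def dualEnds (e : Edge) : Vertex × Vertex :=
  if e.2 then ((e.1.1 - 1, e.1.2), e.1) else ((e.1.1, e.1.2 - 1), e.1)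

/-- The `L∞` norm of a vertex of `ℤ²`. -/
def vnorm (x : Vertex) : ℤ := max |x.1| |x.2|

/-- Twice the `L∞` norm of the dual vertex `u + (1/2, 1/2)`. -/
def dnorm2 (u : Vertex) : ℤ := max |2 * u.1 + 1| |2 * u.2 + 1|

/-- `x` and `y` are joined by an open (primal) edge of `ω`. -/
def openAdj (ω : Config) (x y : Vertex) : Prop :=
  ∃ e : Edge, ω e = true ∧
    ((ends e).1 = x ∧ (ends e).2 = y ∨ (ends e).1 = y ∧ (ends e).2 = x)

/-- Dual vertices `u` and `v` are joined by an open dual edge of `ω`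
(the dual edge `e*` is open iff `e` is closed). -/
def dualAdj (ω : Config) (u v : Vertex) : Prop :=
  ∃ e : Edge, ω e = false ∧
    ((dualEnds e).1 = u ∧ (dualEnds e).2 = v ∨ (dualEnds e).1 = v ∧ (dualEnds e).2 = u)

/-- Connectivity by a path whose steps use the adjacency `adj` and all of whose
vertices lie in the set `S`. -/
def connIn (adj : Vertex → Vertex → Prop) (S : Set Vertex) (x y : Vertex) : Prop :=
  Relation.ReflTransGen (fun a b => adj a b ∧ a ∈ S ∧ b ∈ S) x y

/-- The one-arm (primal) event: a path of open edges, staying in the annulus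
`r ≤ ‖·‖∞ ≤ R`, joining a vertex of norm `r` to a vertex of norm `R`. -/
def A1 (r R : ℤ) : Set Config :=
  {ω | ∃ x y : Vertex, vnorm x = r ∧ vnorm y = R ∧
    connIn (openAdj ω) {z | r ≤ vnorm z ∧ vnorm z ≤ R} x y}

/-- The one-arm dual event: a path of open dual edges, staying in the annulus
`r - 1/2 ≤ ‖·‖∞ ≤ R + 1/2`, joining a dual vertex of norm `≤ r + 1/2` to a
dual vertex of norm `≥ R - 1/2`. (Norms of dual vertices are doubled.) -/
def A0 (r R : ℤ) : Set Config :=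
  {ω | ∃ u v : Vertex, dnorm2 u ≤ 2 * r + 1 ∧ 2 * R - 1 ≤ dnorm2 v ∧
    connIn (dualAdj ω) {w | 2 * r - 1 ≤ dnorm2 w ∧ dnorm2 w ≤ 2 * R + 1} u v}

/-- The alternating two-arm event. -/
def A01 (r R : ℤ) : Set Config := A0 r R ∩ A1 r R

/-- The critical/self-dual point `p_c(q) = √q / (1 + √q)`. -/
noncomputable def pc (q : ℝ) : ℝ := Real.sqrt q / (1 + Real.sqrt q)

/-- The configuration equal to `σ` on `F` and to `η` outside `F`. -/
def combine (F : Finset Edge) (σ : {e // e ∈ F} → Bool) (η : {e // e ∉ F} → Bool) : Config :=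
  fun e => if h : e ∈ F then σ ⟨e, h⟩ else η ⟨e, h⟩

/-- The restriction of a configuration to the complement of `F`. -/
def restrictOut (F : Finset Edge) (ω : Config) : {e // e ∉ F} → Bool := fun e => ω e.1

/-- The set of endpoints of edges of `F`. -/
def edgeVerts (F : Finset Edge) : Set Vertex := ⋃ e ∈ F, {(ends e).1, (ends e).2}

/-- Connectivity by a path of open edges of `ω` (anywhere in the lattice). -/
def conn (ω : Config) : Vertex → Vertex → Prop := Relation.ReflTransGen (openAdj ω)

/-- `k(σ,η)`: the number of equivalence classes of the endpoints of edges of `F`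
under the relation "joined by a path of open edges". Here applied to a full
configuration `ω`. -/
noncomputable def numClasses (F : Finset Edge) (ω : Config) : ℕ :=
  Set.ncard {C : Set Vertex | ∃ x ∈ edgeVerts F, C = {y ∈ edgeVerts F | conn ω x y}}

/-- `|σ|`: the number of open edges of `σ`. -/
noncomputable def numOpen (F : Finset Edge) (σ : {e // e ∈ F} → Bool) : ℕ :=
  Nat.card {e : {e // e ∈ F} // σ e = true}

/-- The weight `w(σ,η) = (p/(1-p))^{|σ|} · q^{k(σ,η)}` at `p = p_c(q)`. -/
noncomputable def w (q : ℝ) (F : Finset Edge) (σ : {e // e ∈ F} → Bool)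
    (η : {e // e ∉ F} → Bool) : ℝ :=
  (pc q / (1 - pc q)) ^ numOpen F σ * q ^ numClasses F (combine F σ η)

/-- A probability measure `φ` on configurations is a critical FK(q) Gibbs measure
if it satisfies the DLR equations with weights `w` for every finite set of edges. -/
def IsCriticalFK (q : ℝ) (φ : Measure Config) : Prop :=
  IsProbabilityMeasure φ ∧
  ∀ F : Finset Edge, ∀ f : Config → ℝ, Measurable f → (∃ M : ℝ, ∀ ω, |f ω| ≤ M) →
    ∫ ω, f ω ∂φ =
      ∫ ω, (∑ σ : {e // e ∈ F} → Bool,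
              w q F σ (restrictOut F ω) * f (combine F σ (restrictOut F ω))) /
            (∑ σ : {e // e ∈ F} → Bool, w q F σ (restrictOut F ω)) ∂φ

/-- `μ` is the law of i.i.d. Bernoulli(1/2) edge variables: critical Bernoulli
bond percolation on `ℤ²`. -/
def IsBernoulliHalf (μ : Measure Config) : Prop :=
  IsProbabilityMeasure μ ∧
  ∀ s : Finset Edge, ∀ b : Edge → Bool,
    μ {ω | ∀ e ∈ s, ω e = b e} = (1 / 2 : ℝ≥0∞) ^ s.card

end FKArm

namespace FKArm

/-- Average of `f` over the two states of the edge `e`. -/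
noncomputable def avg1 (e : Edge) (f : Config → ℝ) : Config → ℝ :=
  fun ω => (f (Function.update ω e true) + f (Function.update ω e false)) / 2

instance : LeftCommutative avg1 where
  left_comm e e' f := by
    by_cases h : e = e'
    · subst h; rfl
    · funext ω
      simp only [avg1, Function.update_comm h]
      ring

/-- Average of `f` over the states of all edges of `T`. -/
noncomputable def avg (T : Finset Edge) (f : Config → ℝ) : Config → ℝ :=
  T.val.foldr avg1 f

@[simp] lemma avg_empty (f : Config → ℝ) : avg ∅ f = f := by simp [avg]

lemma avg_insert {T : Finset Edge} {e : Edge} (h : e ∉ T) (f : Config → ℝ) :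
    avg (insert e T) f = avg1 e (avg T f) := by
  simp [avg, Finset.insert_val_of_notMem h]

lemma avg_union {S T : Finset Edge} (h : Disjoint S T) (f : Config → ℝ) :
    avg (S ∪ T) f = avg S (avg T f) := by
  induction S using Finset.induction_on with
  | empty => simp
  | insert e S he ih =>
    rw [Finset.disjoint_insert_left] at h
    rw [Finset.insert_union, avg_insert (by simp [he, h.1]), avg_insert he, ih h.2]

lemma avg_mono (T : Finset Edge) {f g : Config → ℝ} (h : ∀ ω, f ω ≤ g ω) (ω : Config) :
    avg T f ω ≤ avg T g ω := by
  induction T using Finset.induction_on generalizing ω with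
  | empty => simpa using h ω
  | insert e T he ih =>
    rw [avg_insert he, avg_insert he]
    simp only [avg1]
    linarith [ih (Function.update ω e true), ih (Function.update ω e false)]

lemma avg_add (T : Finset Edge) (f g : Config → ℝ) (ω : Config) :
    avg T (fun ω => f ω + g ω) ω = avg T f ω + avg T g ω := by
  induction T using Finset.induction_on generalizing ω with
  | empty => simp
  | insert e T he ih =>
    simp only [avg_insert he, avg1, ih]
    ring

lemma avg_sub (T : Finset Edge) (f g : Config → ℝ) (ω : Config) :
    avg T (fun ω => f ω - g ω) ω = avg T f ω - avg T g ω := by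
  induction T using Finset.induction_on generalizing ω with
  | empty => simp
  | insert e T he ih =>
    simp only [avg_insert he, avg1, ih]
    ring

lemma avg_const (T : Finset Edge) (c : ℝ) (ω : Config) : avg T (fun _ => c) ω = c := by
  induction T using Finset.induction_on generalizing ω with
  | empty => simp
  | insert e T he ih =>
    simp only [avg_insert he, avg1, ih]
    ring

/-- `f` does not depend on the edges of `T`. -/
def Indep {α : Type} (T : Finset Edge) (f : Config → α) : Prop :=
  ∀ ω ω' : Config, (∀ e, e ∉ T → ω e = ω' e) → f ω = f ω'

lemma Indep.update {T : Finset Edge} {f : Config → ℝ} (h : Indep T f) {e : Edge} (he : e ∈ T)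
    (ω : Config) (b : Bool) : f (Function.update ω e b) = f ω := by
  apply h
  intro e' he'
  rw [Function.update_of_ne]
  rintro rfl
  exact he' he

lemma Indep.subset {α : Type} {S T : Finset Edge} {f : Config → α} (h : Indep T f) (hST : S ⊆ T) :
    Indep S f := fun ω ω' hh => h ω ω' fun e he => hh e fun h' => he (hST h')

lemma avg_mul_left (T : Finset Edge) {g : Config → ℝ} (hg : Indep T g) (f : Config → ℝ)
    (ω : Config) : avg T (fun ω => g ω * f ω) ω = g ω * avg T f ω := by
  induction T using Finset.induction_on generalizing ω with
  | empty => simp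
  | insert e T he ih =>
    simp only [avg_insert he, avg1, ih (hg.subset (Finset.subset_insert _ _)),
      hg.update (Finset.mem_insert_self e T)]
    ring

lemma avg_mul_const (T : Finset Edge) (c : ℝ) (f : Config → ℝ)
    (ω : Config) : avg T (fun ω => c * f ω) ω = c * avg T f ω :=
  avg_mul_left T (g := fun _ => c) (fun _ _ _ => rfl) f ω

lemma avg_of_indep (T : Finset Edge) {g : Config → ℝ} (hg : Indep T g) : avg T g = g := by
  funext ω
  have := avg_mul_left T hg (fun _ => 1) ω
  rw [avg_const] at this
  simpa using this

/-- `f` depends only on the edges in `E`. -/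
def DepF (f : Config → ℝ) (E : Set Edge) : Prop :=
  ∀ ω ω' : Config, (∀ e ∈ E, ω e = ω' e) → f ω = f ω'

lemma DepF.mono {f : Config → ℝ} {E F : Set Edge} (h : DepF f E) (hEF : E ⊆ F) : DepF f F :=
  fun ω ω' hh => h ω ω' fun e he => hh e (hEF he)

lemma DepF.indep {f : Config → ℝ} {E : Set Edge} (h : DepF f E) {T : Finset Edge}
    (hT : ∀ e ∈ T, e ∉ E) : Indep T f :=
  fun ω ω' hh => h ω ω' fun e he => hh e fun h' => hT e h' he

lemma DepF.avg1 {f : Config → ℝ} {E : Set Edge} (h : DepF f E) (e : Edge) :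
    DepF (avg1 e f) (E \ {e}) := by
  intro ω ω' hh
  have key : ∀ b, f (Function.update ω e b) = f (Function.update ω' e b) := by
    intro b
    apply h
    intro e' he'
    by_cases h' : e' = e
    · subst h'; simp
    · simp [Function.update_of_ne h', hh e' ⟨he', h'⟩]
  simp only [FKArm.avg1, key]

lemma DepF.avg {f : Config → ℝ} {E : Set Edge} (h : DepF f E) (T : Finset Edge) :
    DepF (avg T f) (E \ T) := by
  induction T using Finset.induction_on with
  | empty => simpa using h
  | insert e T he ih =>
    rw [avg_insert he]
    refine (ih.avg1 e).mono ?_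
    rintro x ⟨⟨h1, h2⟩, h3⟩
    refine ⟨h1, ?_⟩
    simp only [Finset.coe_insert, Set.mem_insert_iff, not_or]
    exact ⟨h3, h2⟩

lemma avg_indep (T : Finset Edge) (f : Config → ℝ) : Indep T (avg T f) := by
  have h : DepF f Set.univ := fun ω ω' hh => by
    rw [show ω = ω' from funext fun e => hh e trivial]
  exact (h.avg T).indep fun e he hh => hh.2 he

/-- `f` increases when more edges of `T` take the value `b`. -/
def MonoF (b : Bool) (T : Finset Edge) (f : Config → ℝ) : Prop :=
  ∀ ω ω' : Config, (∀ e, e ∉ T → ω e = ω' e) → (∀ e, ω e = b → ω' e = b) → f ω ≤ f ω'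

lemma MonoF.avg {b : Bool} {U : Finset Edge} {f : Config → ℝ} (h : MonoF b U f)
    (T : Finset Edge) : MonoF b U (avg T f) := by
  induction T using Finset.induction_on with
  | empty => simpa using h
  | insert e T he ih =>
    rw [avg_insert he]
    intro ω ω' h1 h2
    have key : ∀ x, FKArm.avg T f (Function.update ω e x) ≤
        FKArm.avg T f (Function.update ω' e x) := by
      intro x
      apply ih
      · intro e' he'
        by_cases h' : e' = e
        · subst h'; simp
        · simp [Function.update_of_ne h', h1 e' he']
      · intro e'
        by_cases h' : e' = e
        · subst h'; simp
        · simpa [Function.update_of_ne h'] using h2 e'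
    simp only [avg1]
    linarith [key true, key false]

lemma MonoF.subset {b : Bool} {S T : Finset Edge} {f : Config → ℝ} (h : MonoF b T f)
    (hST : S ⊆ T) : MonoF b S f :=
  fun ω ω' h1 h2 => h ω ω' (fun e he => h1 e fun h' => he (hST h')) h2

lemma MonoF.not {b : Bool} {T : Finset Edge} {f : Config → ℝ} (h : MonoF (!b) T f) :
    MonoF b T (fun ω => - f ω) := by
  intro ω ω' h1 h2
  have := h ω' ω (fun e he => (h1 e he).symm) (fun e he => by
    have := h2 e
    revert this he
    cases b <;> cases ω e <;> cases ω' e <;> simp)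
  simpa using this

/-- Harris' inequality for conditional averages. -/
lemma avg_harris {b : Bool} (T : Finset Edge) {f g : Config → ℝ} (hf : MonoF b T f)
    (hg : MonoF b T g) (ω : Config) :
    avg T f ω * avg T g ω ≤ avg T (fun ω => f ω * g ω) ω := by
  induction T using Finset.induction_on generalizing ω with
  | empty => simp
  | insert e T he ih =>
    have hs := Finset.subset_insert e T
    have h1 := ih (hf.subset hs) (hg.subset hs)
    have key : ∀ k : Config → ℝ, MonoF b (insert e T) k →
        avg T k (Function.update ω e (!b)) ≤ avg T k (Function.update ω e b) := by
      intro k hk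
      apply hk.avg T
      · intro e' he'
        have : e' ≠ e := by rintro rfl; simp at he'
        simp [Function.update_of_ne this]
      · intro e'
        by_cases h' : e' = e
        · subst h'; simp
        · simp [Function.update_of_ne h']
    have a1 := key f hf
    have a2 := key g hg
    simp only [avg_insert he, avg1]
    have b1 := h1 (Function.update ω e true)
    have b2 := h1 (Function.update ω e false)
    cases b <;> simp only [Bool.not_true, Bool.not_false] at a1 a2 <;>
      nlinarith [mul_nonneg (sub_nonneg.2 a1) (sub_nonneg.2 a2)]

/-- Harris' inequality for an increasing and a decreasing function. -/
lemma avg_harris' {b : Bool} (T : Finset Edge) {f g : Config → ℝ} (hf : MonoF b T f)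
    (hg : MonoF (!b) T g) (ω : Config) :
    avg T (fun ω => f ω * g ω) ω ≤ avg T f ω * avg T g ω := by
  have := avg_harris T hf hg.not ω
  have e1 : avg T (fun ω => -g ω) ω = - avg T g ω := by
    have := avg_mul_const T (-1) g ω
    simpa using this
  have e2 : avg T (fun ω => f ω * -g ω) ω = - avg T (fun ω => f ω * g ω) ω := by
    have := avg_mul_const T (-1) (fun ω => f ω * g ω) ω
    simpa using this
  rw [e1, e2] at this
  linarith

/-! ### Events -/

/-- The event `A` depends only on the edges in `E`. -/
def Dep (A : Set Config) (E : Set Edge) : Prop :=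
  ∀ ω η : Config, (∀ e ∈ E, ω e = η e) → ω ∈ A → η ∈ A

/-- The event `A` is preserved when more edges take the value `b`. -/
def Mono (b : Bool) (A : Set Config) : Prop :=
  ∀ ω η : Config, (∀ e, ω e = b → η e = b) → ω ∈ A → η ∈ A

/-- Indicator function of an event. -/
noncomputable def ind (A : Set Config) : Config → ℝ := A.indicator fun _ => 1

lemma ind_of_mem {A : Set Config} {ω : Config} (h : ω ∈ A) : ind A ω = 1 := by simp [ind, h]
lemma ind_of_notMem {A : Set Config} {ω : Config} (h : ω ∉ A) : ind A ω = 0 := by simp [ind, h]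

lemma ind_nonneg (A : Set Config) (ω : Config) : 0 ≤ ind A ω := by
  by_cases h : ω ∈ A <;> simp [ind, h]

lemma ind_le_one (A : Set Config) (ω : Config) : ind A ω ≤ 1 := by
  by_cases h : ω ∈ A <;> simp [ind, h]

lemma ind_mono {A B : Set Config} {ω ω' : Config} (h : ω ∈ A → ω' ∈ B) : ind A ω ≤ ind B ω' := by
  by_cases h1 : ω ∈ A
  · rw [ind_of_mem h1, ind_of_mem (h h1)]
  · rw [ind_of_notMem h1]; exact ind_nonneg _ _

lemma ind_inter (A B : Set Config) : ind (A ∩ B) = fun ω => ind A ω * ind B ω := by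
  funext ω
  by_cases h1 : ω ∈ A <;> by_cases h2 : ω ∈ B <;> simp [ind, h1, h2]

lemma ind_compl (A : Set Config) : ind Aᶜ = fun ω => 1 - ind A ω := by
  funext ω
  by_cases h1 : ω ∈ A <;> simp [ind, h1]

lemma Dep.depF {A : Set Config} {E : Set Edge} (h : Dep A E) : DepF (ind A) E := by
  intro ω ω' hh
  exact le_antisymm (ind_mono (h _ _ hh)) (ind_mono (h _ _ fun e he => (hh e he).symm))

lemma Dep.mono {A : Set Config} {E F : Set Edge} (h : Dep A E) (hEF : E ⊆ F) : Dep A F :=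
  fun ω ω' hh => h ω ω' fun e he => hh e (hEF he)

lemma Dep.inter {A B : Set Config} {E F : Set Edge} (hA : Dep A E) (hB : Dep B F) :
    Dep (A ∩ B) (E ∪ F) := fun ω ω' hh h =>
  ⟨hA ω ω' (fun e he => hh e (.inl he)) h.1, hB ω ω' (fun e he => hh e (.inr he)) h.2⟩

lemma Dep.inter_same {A B : Set Config} {E : Set Edge} (hA : Dep A E) (hB : Dep B E) :
    Dep (A ∩ B) E := by simpa using hA.inter hB

lemma Dep.compl {A : Set Config} {E : Set Edge} (hA : Dep A E) : Dep Aᶜ E :=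
  fun ω ω' hh h h' => h (hA ω' ω (fun e he => (hh e he).symm) h')

lemma Mono.monoF {b : Bool} {A : Set Config} (h : Mono b A) (T : Finset Edge) :
    MonoF b T (ind A) := fun _ _ _ h2 => ind_mono (h _ _ h2)

lemma Mono.inter {b : Bool} {A B : Set Config} (hA : Mono b A) (hB : Mono b B) : Mono b (A ∩ B) :=
  fun ω ω' hh h => ⟨hA ω ω' hh h.1, hB ω ω' hh h.2⟩

lemma bool_imp_not {b x y : Bool} (h : x = b → y = b) : y = !b → x = !b := by
  revert h; cases b <;> cases x <;> cases y <;> simp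

lemma Mono.compl {b : Bool} {A : Set Config} (hA : Mono b A) : Mono (!b) Aᶜ := by
  intro ω ω' hh h h'
  refine h (hA ω' ω (fun e he => ?_) h')
  simpa using bool_imp_not (hh e) (by simpa using he)

end FKArm

namespace FKArm

/-- Cylinder sets with a prescribed value on finitely many edges, together with `∅`. -/
def cylSets : Set (Set Config) :=
  {A | A = ∅ ∨ ∃ (s : Finset Edge) (b : Edge → Bool), A = {ω | ∀ e ∈ s, ω e = b e}}

lemma isPiSystem_cylSets : IsPiSystem cylSets := by
  rintro A hA B hB ⟨ω, hωA, hωB⟩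
  rcases hA with rfl | ⟨s, b, rfl⟩
  · exact hωA.elim
  rcases hB with rfl | ⟨s', b', rfl⟩
  · exact hωB.elim
  refine Or.inr ⟨s ∪ s', ω, ?_⟩
  ext ω'
  simp only [Set.mem_inter_iff, Set.mem_ofPred_eq, Finset.mem_union] at *
  constructor
  · rintro ⟨h1, h2⟩ e (he | he)
    · rw [h1 e he, hωA e he]
    · rw [h2 e he, hωB e he]
  · intro h
    exact ⟨fun e he => by rw [h e (.inl he), hωA e he],
      fun e he => by rw [h e (.inr he), hωB e he]⟩

lemma measurableSet_cyl (s : Finset Edge) (b : Edge → Bool) :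
    MeasurableSet {ω : Config | ∀ e ∈ s, ω e = b e} := by
  have : {ω : Config | ∀ e ∈ s, ω e = b e} = ⋂ e ∈ s, (fun ω : Config => ω e) ⁻¹' {b e} := by
    ext ω; simp
  rw [this]
  exact Finset.measurableSet_biInter s fun e _ =>
    (measurable_pi_apply e) (MeasurableSet.singleton _)

lemma generateFrom_cylSets :
    (inferInstance : MeasurableSpace Config) = MeasurableSpace.generateFrom cylSets := by
  apply le_antisymm
  · refine iSup_le fun e => ?_
    rintro _ ⟨B, -, rfl⟩
    have key : ∀ x : Bool, MeasurableSet[MeasurableSpace.generateFrom cylSets]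
        ((fun ω : Config => ω e) ⁻¹' {x}) := by
      intro x
      apply MeasurableSpace.measurableSet_generateFrom
      refine Or.inr ⟨{e}, fun _ => x, ?_⟩
      ext ω; simp
    have : B = ⋃ x ∈ B, {x} := by simp
    rw [this, Set.preimage_iUnion₂]
    exact MeasurableSet.biUnion (Set.to_countable B) fun x _ => key x
  · apply MeasurableSpace.generateFrom_le
    rintro A (rfl | ⟨s, b, rfl⟩)
    · exact MeasurableSet.empty
    · exact measurableSet_cyl s b

lemma IsBernoulliHalf.unique {μ ν : Measure Config} (hμ : IsBernoulliHalf μ)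
    (hν : IsBernoulliHalf ν) : μ = ν := by
  have := hμ.1
  have := hν.1
  refine ext_of_generate_finite cylSets generateFrom_cylSets isPiSystem_cylSets ?_ ?_
  · rintro A (rfl | ⟨s, b, rfl⟩)
    · simp
    · rw [hμ.2, hν.2]
  · simp

/-- A fair coin. -/
noncomputable def coin : Measure Bool := ProbabilityTheory.uniformOn Set.univ

instance : IsProbabilityMeasure coin :=
  ProbabilityTheory.isProbabilityMeasure_uniformOn Set.finite_univ Set.univ_nonempty

lemma coin_singleton (x : Bool) : coin {x} = 1 / 2 := by
  rw [coin, ProbabilityTheory.uniformOn_univ]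
  simp

/-- The law of i.i.d. fair coins indexed by the edges. -/
noncomputable def P : Measure Config := Measure.infinitePi fun _ : Edge => coin

instance : IsProbabilityMeasure P := by unfold P; infer_instance

lemma P_isBernoulliHalf : IsBernoulliHalf P := by
  refine ⟨inferInstance, fun s b => ?_⟩
  have : {ω : Config | ∀ e ∈ s, ω e = b e} = Set.pi s fun e => {b e} := by
    ext ω; simp [Set.pi]
  rw [this, P, Measure.infinitePi_pi _ (fun _ _ => MeasurableSet.singleton _)]
  simp [coin_singleton]

/-- The action on configurations of a permutation of the edges combined with flips. -/
def act (π : Edge ≃ Edge) (β : Edge → Bool) (ω : Config) : Config := fun e => xor (β e) (ω (π e))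

lemma measurable_act (π : Edge ≃ Edge) (β : Edge → Bool) : Measurable (act π β) := by
  apply measurable_pi_lambda
  intro e
  exact (measurable_of_countable (fun x : Bool => xor (β e) x)).comp (measurable_pi_apply (π e))

lemma map_act (π : Edge ≃ Edge) (β : Edge → Bool) : P.map (act π β) = P := by
  refine IsBernoulliHalf.unique ⟨Measure.isProbabilityMeasure_map
    (measurable_act π β).aemeasurable, fun s b => ?_⟩ P_isBernoulliHalf
  rw [Measure.map_apply (measurable_act π β)]
  · have : act π β ⁻¹' {ω | ∀ e ∈ s, ω e = b e} =
        {ω | ∀ e ∈ s.map π.toEmbedding, ω e = xor (β (π.symm e)) (b (π.symm e))} := by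
      ext ω
      simp only [act, Set.mem_preimage, Set.mem_ofPred_eq, Finset.mem_map_equiv]
      constructor
      · intro h e he
        rw [← h _ he]
        simp
      · intro h e he
        have := h (π e) (by simpa using he)
        simp [this]
    rw [this, P_isBernoulliHalf.2, Finset.card_map]
  · exact measurableSet_cyl s b

lemma DepF.measurable {f : Config → ℝ} {T : Finset Edge} (h : DepF f T) : Measurable f := by
  classical
  let r : Config → (T → Bool) := fun ω e => ω e.1
  have hr : Measurable r := measurable_pi_lambda _ fun e => measurable_pi_apply e.1
  let g : (T → Bool) → ℝ := fun σ => f fun e => if he : e ∈ T then σ ⟨e, he⟩ else false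
  have : f = g ∘ r := by
    funext ω
    apply h
    intro e he
    simp [r, Finset.mem_coe.1 he]
  rw [this]
  exact (measurable_of_countable g).comp hr

lemma Dep.measurableSet {A : Set Config} {T : Finset Edge} (h : Dep A T) : MeasurableSet A := by
  have h1 : Measurable (ind A) := h.depF.measurable
  have : A = ind A ⁻¹' {1} := by
    ext ω
    by_cases hω : ω ∈ A <;> simp [ind, hω]
  rw [this]
  exact h1 (MeasurableSet.singleton _)

/-- Probability of an event for critical percolation. -/
noncomputable def pr (A : Set Config) : ℝ := P.real A

lemma pr_act (π : Edge ≃ Edge) (β : Edge → Bool) {A : Set Config} (hA : MeasurableSet A) :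
    pr (act π β ⁻¹' A) = pr A := by
  rw [pr, pr, measureReal_def, measureReal_def, ← Measure.map_apply (measurable_act π β) hA,
    map_act]

lemma integral_avg1 (e : Edge) {f : Config → ℝ} (hf : Measurable f)
    (hb : ∀ ω, |f ω| ≤ 1) : ∫ ω, avg1 e f ω ∂P = ∫ ω, f ω ∂P := by
  let F := act (Equiv.refl _) (fun e' => decide (e' = e))
  have hF : ∀ ω, F ω = Function.update ω e (!ω e) := by
    intro ω
    funext e'
    by_cases h : e' = e
    · subst h; simp [F, act]
    · simp [F, act, h]
  have h1 : ∀ ω, avg1 e f ω = (f ω + f (F ω)) / 2 := by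
    intro ω
    rw [hF, avg1]
    have := Function.update_eq_self e ω
    cases h : ω e <;> rw [h] at this <;> simp only [Bool.not_true, Bool.not_false, this]
    ring
  have hint : Integrable f P :=
    Integrable.of_bound hf.aestronglyMeasurable 1 (ae_of_all _ hb)
  have hFm : Measurable F := measurable_act _ _
  have hint' : Integrable (fun ω => f (F ω)) P :=
    Integrable.of_bound (hf.comp hFm).aestronglyMeasurable 1 (ae_of_all _ fun ω => hb _)
  simp_rw [h1]
  rw [integral_div, integral_add hint hint']
  have h2 : ∫ ω, f (F ω) ∂P = ∫ ω, f ω ∂P := by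
    conv_rhs => rw [← map_act (Equiv.refl _) (fun e' => decide (e' = e))]
    rw [integral_map (measurable_act _ _).aemeasurable hf.aestronglyMeasurable]
  rw [h2]
  ring

lemma pr_eq_avg {A : Set Config} {T : Finset Edge} (hA : Dep A T) (ω : Config) :
    pr A = avg T (ind A) ω := by
  have hbd : ∀ S : Finset Edge, ∀ ω, |avg S (ind A) ω| ≤ 1 := by
    intro S ω
    rw [abs_le]
    constructor
    · have := avg_mono S (ind_nonneg A) ω
      rw [avg_const] at this
      linarith
    · have := avg_mono S (ind_le_one A) ω
      rwa [avg_const] at this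
  have key : ∀ S : Finset Edge, ∫ ω, avg S (ind A) ω ∂P = ∫ ω, ind A ω ∂P := by
    intro S
    induction S using Finset.induction_on with
    | empty => simp
    | insert e S he ih =>
      rw [avg_insert he, integral_avg1 e _ (hbd S), ih]
      exact DepF.measurable (T := T) ((hA.depF.avg S).mono Set.sdiff_subset)
  have hc : ∀ ω', avg T (ind A) ω' = avg T (ind A) ω := by
    intro ω'
    apply hA.depF.avg T
    simp
  have h1 : ∫ ω, ind A ω ∂P = pr A := by
    unfold ind pr
    rw [integral_indicator_const _ hA.measurableSet]
    simp
  rw [← h1, ← key T]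
  simp_rw [hc]
  simp

lemma pr_nonneg (A : Set Config) : 0 ≤ pr A := measureReal_nonneg
lemma pr_le_one (A : Set Config) : pr A ≤ 1 := measureReal_le_one
lemma pr_mono {A B : Set Config} (h : A ⊆ B) : pr A ≤ pr B := measureReal_mono h
lemma pr_union_le (A B : Set Config) : pr (A ∪ B) ≤ pr A + pr B := measureReal_union_le A B

lemma pr_compl {A : Set Config} {T : Finset Edge} (hA : Dep A T) : pr Aᶜ = 1 - pr A := by
  rw [pr, probReal_compl_eq_one_sub hA.measurableSet, pr]

lemma pr_harris {b : Bool} {A B : Set Config} {T : Finset Edge} (hA : Dep A T) (hB : Dep B T)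
    (mA : Mono b A) (mB : Mono b B) : pr A * pr B ≤ pr (A ∩ B) := by
  have ω : Config := fun _ => true
  rw [pr_eq_avg hA ω, pr_eq_avg hB ω, pr_eq_avg (hA.inter_same hB) ω, ind_inter]
  exact avg_harris T (mA.monoF T) (mB.monoF T) ω

lemma pr_inter_of_disjoint {A B : Set Config} {S T : Finset Edge} (hA : Dep A S) (hB : Dep B T)
    (h : Disjoint S T) : pr (A ∩ B) = pr A * pr B := by
  classical
  have ω : Config := fun _ => true
  have h1 : Dep (A ∩ B) (S ∪ T : Finset Edge) := by simpa using hA.inter hB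
  rw [pr_eq_avg h1 ω, avg_union h, ind_inter]
  have iA : Indep T (ind A) := hA.depF.indep fun e he he' => Finset.disjoint_left.1 h he' he
  have e1 : avg T (fun ω => ind A ω * ind B ω) = fun ω' => pr B * ind A ω' := by
    funext ω'
    rw [avg_mul_left T iA, ← pr_eq_avg hB, mul_comm]
  rw [e1, avg_mul_const, ← pr_eq_avg hA, mul_comm]

end FKArm

namespace FKArm

/-! ### Paths -/

section Paths
variable {adj adj' : Vertex → Vertex → Prop} {S S' : Set Vertex} {x y z : Vertex}

lemma connIn.trans (h : connIn adj S x y) (h' : connIn adj S y z) : connIn adj S x z :=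
  Relation.ReflTransGen.trans h h'

lemma connIn.map {φ : Vertex → Vertex} (hadj : ∀ a b, adj a b → adj' (φ a) (φ b))
    (hS : ∀ a ∈ S, φ a ∈ S') (h : connIn adj S x y) : connIn adj' S' (φ x) (φ y) :=
  Relation.ReflTransGen.lift φ (fun a b h => ⟨hadj a b h.1, hS a h.2.1, hS b h.2.2⟩) _ _ h

lemma connIn.mono (hadj : ∀ a b, adj a b → adj' a b)
    (hS : S ⊆ S') (h : connIn adj S x y) : connIn adj' S' x y :=
  h.map (φ := id) hadj hS

lemma connIn.mono_set (hS : S ⊆ S') (h : connIn adj S x y) : connIn adj S' x y :=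
  h.mono (fun _ _ => id) hS

lemma connIn.symm (hadj : ∀ a b, adj a b → adj b a) (h : connIn adj S x y) :
    connIn adj S y x := by
  refine Relation.ReflTransGen.mono ?_ _ _ (Relation.ReflTransGen.swap _ _ h)
  exact fun a b h => ⟨hadj _ _ h.1, h.2.2, h.2.1⟩

lemma connIn.mem (h : connIn adj S x y) (hx : x ∈ S) : y ∈ S := by
  induction h with
  | refl => exact hx
  | tail _ h _ => exact h.2.2

/-- A path stays in the set of points it can reach. -/
lemma connIn.reach (h : connIn adj S x y) : connIn adj {z | connIn adj S x z} x y := by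
  induction h with
  | refl => exact .refl
  | tail h1 h2 ih => exact ih.tail ⟨h2.1, h1, Relation.ReflTransGen.tail h1 h2⟩

/-- A set that is closed under the allowed steps contains the endpoint. -/
lemma connIn.closed {C : Set Vertex} (h : connIn adj S x y) (hx : x ∈ C)
    (hC : ∀ a b, a ∈ C → adj a b → a ∈ S → b ∈ S → b ∈ C) : y ∈ C := by
  induction h with
  | refl => exact hx
  | tail _ h ih => exact hC _ _ ih h.1 h.2.1 h.2.2

/-- First hitting of the level `b` by a path. -/
lemma connIn.first_hit (φ : Vertex → ℤ) (hφ : ∀ u v, adj u v → φ v ≤ φ u + 1) {b : ℤ}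
    (h : connIn adj S x y) (hxS : x ∈ S) (hx : φ x ≤ b) (hy : b ≤ φ y) :
    ∃ z ∈ S, φ z = b ∧ connIn adj {v ∈ S | φ v ≤ b} x z ∧ connIn adj S z y := by
  induction h using Relation.ReflTransGen.head_induction_on with
  | refl => exact ⟨y, hxS, le_antisymm hx hy, .refl, .refl⟩
  | head h1 h2 ih =>
    rename_i u v
    by_cases hu : φ u = b
    · exact ⟨u, hxS, hu, .refl, Relation.ReflTransGen.head h1 h2⟩
    · have := hφ u v h1.1
      obtain ⟨z, hzS, hz, h3, h4⟩ := ih h1.2.2 (by omega)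
      exact ⟨z, hzS, hz, Relation.ReflTransGen.head
        ⟨h1.1, ⟨hxS, hx⟩, ⟨h1.2.2, by omega⟩⟩ h3, h4⟩

/-- Last exit from the level `a` by a path. -/
lemma connIn.last_exit (φ : Vertex → ℤ) (hφ : ∀ u v, adj u v → φ v ≤ φ u + 1) {a : ℤ}
    (h : connIn adj S x y) (hxS : x ∈ S) (hx : φ x ≤ a) (hy : a ≤ φ y) :
    ∃ z ∈ S, φ z = a ∧ connIn adj {v ∈ S | a ≤ φ v} z y ∧ connIn adj S x z := by
  induction h with
  | refl => exact ⟨x, hxS, le_antisymm hx hy, .refl, .refl⟩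
  | tail h1 h2 ih =>
    rename_i u v
    by_cases hu : φ v = a
    · exact ⟨v, h2.2.2, hu, .refl, Relation.ReflTransGen.tail h1 h2⟩
    · have := hφ u v h2.1
      obtain ⟨z, hzS, hz, h3, h4⟩ := ih (by omega)
      exact ⟨z, hzS, hz, Relation.ReflTransGen.tail h3
        ⟨h2.1, ⟨h2.2.1, by omega⟩, ⟨h2.2.2, by omega⟩⟩, h4⟩

/-- A path contains a crossing of every strip between its endpoints. -/
lemma connIn.extract (φ : Vertex → ℤ) (hφ : ∀ u v, adj u v → φ v ≤ φ u + 1) {a b : ℤ}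
    (hab : a ≤ b) (h : connIn adj S x y) (hxS : x ∈ S) (hx : φ x ≤ a) (hy : b ≤ φ y) :
    ∃ x' y', x' ∈ S ∧ y' ∈ S ∧ φ x' = a ∧ φ y' = b ∧
      connIn adj {v ∈ S | a ≤ φ v ∧ φ v ≤ b} x' y' ∧ connIn adj S x x' ∧ connIn adj S y' y := by
  obtain ⟨z, hzS, hz, h1, h2⟩ := h.first_hit φ hφ hxS (hx.trans hab) hy
  obtain ⟨u, huS, hu, h3, h4⟩ := h1.last_exit φ hφ ⟨hxS, hx.trans hab⟩ hx (hz ▸ hab)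
  refine ⟨u, z, huS.1, hzS, hu, hz, h3.mono_set ?_, h4.mono_set fun v hv => hv.1, h2⟩
  exact fun v hv => ⟨hv.1.1, hv.2, hv.1.2⟩

end Paths

/-- Nearest neighbours in `ℤ²`. -/
def nn (x y : Vertex) : Prop :=
  (y.1 = x.1 ∧ (y.2 = x.2 + 1 ∨ x.2 = y.2 + 1)) ∨ (y.2 = x.2 ∧ (y.1 = x.1 + 1 ∨ x.1 = y.1 + 1))

lemma nn.symm {x y : Vertex} (h : nn x y) : nn y x := by
  unfold nn at *; omega

lemma openAdj_symm (ω : Config) (x y : Vertex) (h : openAdj ω x y) : openAdj ω y x := by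
  obtain ⟨e, he, h⟩ := h
  exact ⟨e, he, h.symm⟩

lemma openAdj_h {ω : Config} {x y : ℤ} (h : ω ((x, y), false) = true) :
    openAdj ω (x, y) (x + 1, y) := ⟨_, h, by simp [ends]⟩

lemma openAdj_v {ω : Config} {x y : ℤ} (h : ω ((x, y), true) = true) :
    openAdj ω (x, y) (x, y + 1) := ⟨_, h, by simp [ends]⟩

lemma openAdj_elim {ω : Config} {u v : Vertex} (h : openAdj ω u v) :
    (v = (u.1 + 1, u.2) ∧ ω (u, false) = true) ∨ (v = (u.1, u.2 + 1) ∧ ω (u, true) = true) ∨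
    (u = (v.1 + 1, v.2) ∧ ω (v, false) = true) ∨ (u = (v.1, v.2 + 1) ∧ ω (v, true) = true) := by
  obtain ⟨⟨w, o⟩, he, h⟩ := h
  rcases h with ⟨h1, h2⟩ | ⟨h1, h2⟩ <;> cases o <;> simp only [ends] at h1 h2 <;> subst h1 <;>
    simp_all

/-- Criterion for monotone dependence of adjacency. -/
lemma openAdj_map {ω ω' : Config} {φ : Vertex → Vertex}
    (h1 : ∀ x y, ω ((x, y), false) = true → openAdj ω' (φ (x, y)) (φ (x + 1, y)))
    (h2 : ∀ x y, ω ((x, y), true) = true → openAdj ω' (φ (x, y)) (φ (x, y + 1)))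
    (u v : Vertex) (h : openAdj ω u v) : openAdj ω' (φ u) (φ v) := by
  rcases openAdj_elim h with ⟨h, h'⟩ | ⟨h, h'⟩ | ⟨h, h'⟩ | ⟨h, h'⟩
  · subst h; exact h1 _ _ h'
  · subst h; exact h2 _ _ h'
  · subst h; exact openAdj_symm _ _ _ (h1 _ _ h')
  · subst h; exact openAdj_symm _ _ _ (h2 _ _ h')

lemma openAdj.nn {ω : Config} {u v : Vertex} (h : openAdj ω u v) : nn u v := by
  rcases openAdj_elim h with ⟨h, -⟩ | ⟨h, -⟩ | ⟨h, -⟩ | ⟨h, -⟩ <;> subst h <;> simp [FKArm.nn]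

lemma openAdj.fst_le {ω : Config} (u v : Vertex) (h : openAdj ω u v) : v.1 ≤ u.1 + 1 := by
  have := h.nn; unfold FKArm.nn at this; omega

lemma openAdj.snd_le {ω : Config} (u v : Vertex) (h : openAdj ω u v) : v.2 ≤ u.2 + 1 := by
  have := h.nn; unfold FKArm.nn at this; omega

/-- Open connection inside a set. -/
abbrev Cn (ω : Config) (S : Set Vertex) (x y : Vertex) : Prop := connIn (openAdj ω) S x y

lemma Cn.symm {ω : Config} {S : Set Vertex} {x y : Vertex} (h : Cn ω S x y) : Cn ω S y x :=
  connIn.symm (openAdj_symm ω) h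

/-- Edges with both endpoints in `S`. -/
def inside (S : Set Vertex) : Set Edge := {e | (ends e).1 ∈ S ∧ (ends e).2 ∈ S}

lemma inside_mono {S S' : Set Vertex} (h : S ⊆ S') : inside S ⊆ inside S' :=
  fun _ he => ⟨h he.1, h he.2⟩

lemma Cn.congr {ω ω' : Config} {S : Set Vertex} {x y : Vertex} (h : Cn ω S x y)
    (hω : ∀ e ∈ inside S, ω e = true → ω' e = true) : Cn ω' S x y := by
  refine Relation.ReflTransGen.mono ?_ _ _ h
  rintro a b ⟨⟨e, he, h⟩, ha, hb⟩
  refine ⟨⟨e, hω e ?_ he, h⟩, ha, hb⟩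
  rcases h with ⟨h1, h2⟩ | ⟨h1, h2⟩
  · exact ⟨h1 ▸ ha, h2 ▸ hb⟩
  · exact ⟨h1 ▸ hb, h2 ▸ ha⟩

/-- The rectangle `[a,b] × [c,d]`. -/
def rect (a b c d : ℤ) : Set Vertex := {v | (a ≤ v.1 ∧ v.1 ≤ b) ∧ c ≤ v.2 ∧ v.2 ≤ d}

lemma mem_rect {a b c d : ℤ} {v : Vertex} :
    v ∈ rect a b c d ↔ (a ≤ v.1 ∧ v.1 ≤ b) ∧ c ≤ v.2 ∧ v.2 ≤ d := Iff.rfl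

lemma rect_subset {a b c d a' b' c' d' : ℤ} (h1 : a' ≤ a) (h2 : b ≤ b') (h3 : c' ≤ c)
    (h4 : d ≤ d') : rect a b c d ⊆ rect a' b' c' d' := by
  rintro v ⟨⟨h5, h6⟩, h7, h8⟩
  exact ⟨⟨by omega, by omega⟩, by omega, by omega⟩

open Classical in
/-- Edges inside the rectangle `[a,b] × [c,d]`. -/
noncomputable def rectE (a b c d : ℤ) : Finset Edge :=
  (((Finset.Icc a b) ×ˢ (Finset.Icc c d)) ×ˢ Finset.univ).filter fun e => e ∈ inside (rect a b c d)

lemma coe_rectE (a b c d : ℤ) : (rectE a b c d : Set Edge) = inside (rect a b c d) := by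
  ext e
  simp only [rectE, Finset.coe_filter, Finset.mem_product, Finset.mem_Icc, Finset.mem_univ,
    and_true, Set.mem_ofPred_eq, and_iff_right_iff_imp]
  intro h
  have := h.1
  simp only [ends, mem_rect] at this
  omega

lemma mem_rectE {a b c d : ℤ} {e : Edge} : e ∈ rectE a b c d ↔ e ∈ inside (rect a b c d) := by
  rw [← coe_rectE, Finset.mem_coe]

/-- Open left-right crossing of a rectangle. -/
def H (a b c d : ℤ) : Set Config :=
  {ω | ∃ x y : Vertex, x.1 = a ∧ y.1 = b ∧ x ∈ rect a b c d ∧ y ∈ rect a b c d ∧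
    Cn ω (rect a b c d) x y}

/-- Open bottom-top crossing of a rectangle. -/
def V (a b c d : ℤ) : Set Config :=
  {ω | ∃ x y : Vertex, x.2 = c ∧ y.2 = d ∧ x ∈ rect a b c d ∧ y ∈ rect a b c d ∧
    Cn ω (rect a b c d) x y}

lemma H_dep (a b c d : ℤ) : Dep (H a b c d) (inside (rect a b c d)) := by
  rintro ω ω' h ⟨x, y, h1, h2, h3, h4, h5⟩
  exact ⟨x, y, h1, h2, h3, h4, h5.congr fun e he => h e he ▸ id⟩

lemma V_dep (a b c d : ℤ) : Dep (V a b c d) (inside (rect a b c d)) := by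
  rintro ω ω' h ⟨x, y, h1, h2, h3, h4, h5⟩
  exact ⟨x, y, h1, h2, h3, h4, h5.congr fun e he => h e he ▸ id⟩

lemma H_mono (a b c d : ℤ) : Mono true (H a b c d) := by
  rintro ω ω' h ⟨x, y, h1, h2, h3, h4, h5⟩
  exact ⟨x, y, h1, h2, h3, h4, h5.congr fun e _ => h e⟩

lemma V_mono (a b c d : ℤ) : Mono true (V a b c d) := by
  rintro ω ω' h ⟨x, y, h1, h2, h3, h4, h5⟩
  exact ⟨x, y, h1, h2, h3, h4, h5.congr fun e _ => h e⟩

lemma H_depE (a b c d : ℤ) : Dep (H a b c d) (rectE a b c d) := by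
  rw [coe_rectE]; exact H_dep a b c d

lemma V_depE (a b c d : ℤ) : Dep (V a b c d) (rectE a b c d) := by
  rw [coe_rectE]; exact V_dep a b c d

/-- A path joining the left of a rectangle to the right inside a horizontal strip gives a
crossing. -/
lemma H_of_conn {ω : Config} {a b c d : ℤ} (hab : a ≤ b) {S : Set Vertex}
    (hS : ∀ v ∈ S, a ≤ v.1 → v.1 ≤ b → c ≤ v.2 ∧ v.2 ≤ d) {x y : Vertex} (hx : x ∈ S)
    (h : Cn ω S x y) (hxa : x.1 ≤ a) (hyb : b ≤ y.1) : ω ∈ H a b c d := by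
  obtain ⟨x', y', hx', hy', h1, h2, h3, -, -⟩ :=
    h.extract (fun v => v.1) openAdj.fst_le hab hx hxa hyb
  have key : ∀ v ∈ S, a ≤ v.1 → v.1 ≤ b → v ∈ rect a b c d :=
    fun v hv h4 h5 => ⟨⟨h4, h5⟩, hS v hv h4 h5⟩
  exact ⟨x', y', h1, h2, key _ hx' h1.ge (by omega), key _ hy' (by omega) h2.le,
    h3.mono_set fun v hv => key v hv.1 hv.2.1 hv.2.2⟩

lemma V_of_conn {ω : Config} {a b c d : ℤ} (hcd : c ≤ d) {S : Set Vertex}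
    (hS : ∀ v ∈ S, c ≤ v.2 → v.2 ≤ d → a ≤ v.1 ∧ v.1 ≤ b) {x y : Vertex} (hx : x ∈ S)
    (h : Cn ω S x y) (hxa : x.2 ≤ c) (hyb : d ≤ y.2) : ω ∈ V a b c d := by
  obtain ⟨x', y', hx', hy', h1, h2, h3, -, -⟩ :=
    h.extract (fun v => v.2) openAdj.snd_le hcd hx hxa hyb
  have key : ∀ v ∈ S, c ≤ v.2 → v.2 ≤ d → v ∈ rect a b c d :=
    fun v hv h4 h5 => ⟨hS v hv h4 h5, ⟨h4, h5⟩⟩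
  exact ⟨x', y', h1, h2, key _ hx' h1.ge (by omega), key _ hy' (by omega) h2.le,
    h3.mono_set fun v hv => key v hv.1 hv.2.1 hv.2.2⟩

/-- Crossing a longer and thinner rectangle is harder. -/
lemma H_subset {a b c d a' b' c' d' : ℤ} (h1 : a' ≤ a) (h2 : b ≤ b') (h3 : c ≤ c')
    (h4 : d' ≤ d) (hab : a ≤ b) : H a' b' c' d' ⊆ H a b c d := by
  rintro ω ⟨x, y, hx, hy, hx', -, h⟩
  exact H_of_conn hab (fun v hv _ _ => ⟨by have := hv.2; omega, by have := hv.2; omega⟩) hx' h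
    (by omega) (by omega)

lemma V_subset {a b c d a' b' c' d' : ℤ} (h1 : a ≤ a') (h2 : b' ≤ b) (h3 : c' ≤ c)
    (h4 : d ≤ d') (hcd : c ≤ d) : V a' b' c' d' ⊆ V a b c d := by
  rintro ω ⟨x, y, hx, hy, hx', -, h⟩
  exact V_of_conn hcd (fun v hv _ _ => ⟨by have := hv.1; omega, by have := hv.1; omega⟩) hx' h
    (by omega) (by omega)

/-! ### Symmetries -/

/-- Reflection in the diagonal. -/
def swapE : Edge ≃ Edge where
  toFun e := ((e.1.2, e.1.1), !e.2)
  invFun e := ((e.1.2, e.1.1), !e.2)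
  left_inv e := by simp
  right_inv e := by simp

/-- Configuration reflected in the diagonal. -/
def swapC (ω : Config) : Config := fun e => ω (swapE e)

lemma act_false (π : Edge ≃ Edge) (ω : Config) :
    act π (fun _ => false) ω = fun e => ω (π e) := by
  funext e; simp [act]

lemma swapC_swapC (ω : Config) : swapC (swapC ω) = ω := by
  funext e; simp [swapC, swapE]

lemma swapC_adj (ω : Config) (u v : Vertex) (h : openAdj (swapC ω) u v) :
    openAdj ω u.swap v.swap :=
  openAdj_map (φ := Prod.swap) (fun _ _ h => openAdj_v h) (fun _ _ h => openAdj_h h) u v h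

lemma swapC_mem_H {ω : Config} {a b c d : ℤ} : swapC ω ∈ H c d a b ↔ ω ∈ V a b c d := by
  constructor
  · rintro ⟨x, y, h1, h2, h3, h4, h5⟩
    exact ⟨x.swap, y.swap, h1, h2, ⟨h3.2, h3.1⟩, ⟨h4.2, h4.1⟩,
      h5.map (swapC_adj ω) fun v hv => ⟨hv.2, hv.1⟩⟩
  · rintro ⟨x, y, h1, h2, h3, h4, h5⟩
    refine ⟨x.swap, y.swap, h1, h2, ⟨h3.2, h3.1⟩, ⟨h4.2, h4.1⟩,
      connIn.map (fun u v h => swapC_adj (swapC ω) u v ?_) (fun v hv => ⟨hv.2, hv.1⟩) h5⟩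
    rwa [swapC_swapC]

lemma swapC_mem_V {ω : Config} {a b c d : ℤ} : swapC ω ∈ V c d a b ↔ ω ∈ H a b c d := by
  rw [← swapC_mem_H, swapC_swapC]

lemma pr_V (a b c d : ℤ) : pr (V a b c d) = pr (H c d a b) := by
  rw [← pr_act swapE (fun _ => false) (H_depE c d a b).measurableSet]
  congr 1
  ext ω
  rw [← swapC_mem_H, Set.mem_preimage, act_false]
  rfl

/-- Translation of edges. -/
def shiftE (k l : ℤ) : Edge ≃ Edge where
  toFun e := ((e.1.1 + k, e.1.2 + l), e.2)
  invFun e := ((e.1.1 - k, e.1.2 - l), e.2)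
  left_inv e := by simp
  right_inv e := by simp

lemma shift_mem_H {ω : Config} {k l a b c d : ℤ} (h : (fun e => ω (shiftE k l e)) ∈ H a b c d) :
    ω ∈ H (a + k) (b + k) (c + l) (d + l) := by
  obtain ⟨x, y, h1, h2, h3, h4, h5⟩ := h
  have hm : ∀ v ∈ rect a b c d,
      ((v.1 + k, v.2 + l) : Vertex) ∈ rect (a + k) (b + k) (c + l) (d + l) := by
    intro v hv
    simp only [mem_rect] at *
    omega
  refine ⟨(x.1 + k, x.2 + l), (y.1 + k, y.2 + l), by simp [h1], by simp [h2], hm _ h3, hm _ h4,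
    h5.map (φ := fun v => (v.1 + k, v.2 + l)) ?_ hm⟩
  refine openAdj_map ?_ ?_
  · intro x y h
    have := openAdj_h h
    rwa [show x + k + 1 = x + 1 + k by ring] at this
  · intro x y h
    have := openAdj_v h
    rwa [show y + l + 1 = y + 1 + l by ring] at this

lemma pr_H_shift (k l a b c d : ℤ) :
    pr (H (a + k) (b + k) (c + l) (d + l)) = pr (H a b c d) := by
  have key : ∀ k l a b c d : ℤ, pr (H a b c d) ≤ pr (H (a + k) (b + k) (c + l) (d + l)) := by
    intro k l a b c d
    rw [← pr_act (shiftE k l) (fun _ => false) (H_depE a b c d).measurableSet]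
    refine pr_mono fun ω hω => shift_mem_H ?_
    rwa [← act_false]
  refine le_antisymm ?_ (key k l a b c d)
  have := key (-k) (-l) (a + k) (b + k) (c + l) (d + l)
  simpa using this

/-- The duality map: `openAdj (dualC ω)` is the dual adjacency of `ω`. -/
def dualE : Edge ≃ Edge where
  toFun e := if e.2 then ((e.1.1, e.1.2 + 1), false) else ((e.1.1 + 1, e.1.2), true)
  invFun e := if e.2 then ((e.1.1 - 1, e.1.2), false) else ((e.1.1, e.1.2 - 1), true)
  left_inv e := by rcases e with ⟨⟨x, y⟩, _ | _⟩ <;> simp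
  right_inv e := by rcases e with ⟨⟨x, y⟩, _ | _⟩ <;> simp

/-- The dual configuration. -/
def dualC (ω : Config) : Config := fun e => !ω (dualE e)

lemma act_dualE (ω : Config) : act dualE (fun _ => true) ω = dualC ω := by
  funext e; simp [act, dualC]

lemma dualC_h (ω : Config) (x y : ℤ) : dualC ω ((x, y), false) = !ω ((x + 1, y), true) := rfl
lemma dualC_v (ω : Config) (x y : ℤ) : dualC ω ((x, y), true) = !ω ((x, y + 1), false) := rfl

lemma dualAdj_iff (ω : Config) (u v : Vertex) : dualAdj ω u v ↔ openAdj (dualC ω) u v := by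
  have key : ∀ e, dualEnds (dualE e) = ends e := by
    rintro ⟨⟨x, y⟩, _ | _⟩ <;> simp [dualEnds, dualE, ends]
  constructor
  · rintro ⟨e, he, h⟩
    refine ⟨dualE.symm e, by simp [dualC, he], ?_⟩
    rw [← key]
    simpa using h
  · rintro ⟨e, he, h⟩
    refine ⟨dualE e, by simpa [dualC] using he, ?_⟩
    rwa [key]

end FKArm

namespace FKArm

/-- Signed count of the steps of a path across the line `p + 1/2`, above height `q`. -/
lemma exists_flow {C : Set Vertex} {c d : ℤ} (hC : ∀ z ∈ C, c ≤ z.2 ∧ z.2 ≤ d) {x y : Vertex}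
    (h : connIn nn C x y) : ∃ F : ℤ → ℤ → ℤ,
      (∀ p q, (p, q) ∉ C → F p (q - 1) = F p q) ∧
      (∀ p q, (p, q) ∉ C → F (p - 1) q - F p q =
        (if y.1 = p ∧ y.2 > q then 1 else 0) - (if x.1 = p ∧ x.2 > q then 1 else 0)) ∧
      (∀ p q, d ≤ q → F p q = 0) ∧
      (∀ p q, q < c → F p q = (if y.1 > p then 1 else 0) - (if x.1 > p then 1 else 0)) := by
  induction h with
  | refl => exact ⟨fun _ _ => 0, by simp, by simp, by simp, by simp⟩
  | tail h1 h2 ih =>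
    rename_i y z
    obtain ⟨F, i1, i2, i3, i4⟩ := ih
    obtain ⟨hn, hy, hz⟩ := h2
    have hyC := hC y hy
    have hzC := hC z hz
    have ny : ∀ p q, (p, q) ∉ C → ¬ (y.1 = p ∧ y.2 = q) := by
      rintro p q hpq ⟨rfl, rfl⟩; exact hpq hy
    have nz : ∀ p q, (p, q) ∉ C → ¬ (z.1 = p ∧ z.2 = q) := by
      rintro p q hpq ⟨rfl, rfl⟩; exact hpq hz
    rcases hn with ⟨e1, e2⟩ | ⟨e1, e2 | e2⟩
    · refine ⟨F, i1, ?_, i3, ?_⟩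
      · intro p q hpq
        rw [i2 p q hpq]
        have := ny p q hpq
        have := nz p q hpq
        congr 1
        split_ifs <;> omega
      · intro p q hpq
        rw [i4 p q hpq, e1]
    · refine ⟨fun p q => F p q + if p = y.1 ∧ y.2 > q then 1 else 0, ?_, ?_, ?_, ?_⟩
      · intro p q hpq
        have h1 := i1 p q hpq
        have := ny p q hpq
        have := nz p q hpq
        simp only [h1]
        split_ifs <;> omega
      · intro p q hpq
        have h1 := i2 p q hpq
        have := ny p q hpq
        have := nz p q hpq
        revert h1
        dsimp only
        split_ifs <;> omega
      · intro p q hpq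
        have h1 := i3 p q hpq
        simp only [h1]
        split_ifs <;> omega
      · intro p q hpq
        have h1 := i4 p q hpq
        revert h1
        dsimp only
        split_ifs <;> omega
    · refine ⟨fun p q => F p q - if p = z.1 ∧ z.2 > q then 1 else 0, ?_, ?_, ?_, ?_⟩
      · intro p q hpq
        have h1 := i1 p q hpq
        have := ny p q hpq
        have := nz p q hpq
        simp only [h1]
        split_ifs <;> omega
      · intro p q hpq
        have h1 := i2 p q hpq
        have := ny p q hpq
        have := nz p q hpq
        revert h1
        dsimp only
        split_ifs <;> omega
      · intro p q hpq
        have h1 := i3 p q hpq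
        simp only [h1]
        split_ifs <;> omega
      · intro p q hpq
        have h1 := i4 p q hpq
        revert h1
        dsimp only
        split_ifs <;> omega

/-- Two lattice paths crossing a rectangle in the two directions meet. -/
lemma paths_cross {C D : Set Vertex} {a b c d : ℤ} (hC : ∀ z ∈ C, c ≤ z.2 ∧ z.2 ≤ d)
    (hD : ∀ z ∈ D, a ≤ z.1 ∧ z.1 ≤ b) {x y u v : Vertex} (h : connIn nn C x y) (hxC : x ∈ C)
    (hx : x.1 ≤ a) (hy : b ≤ y.1) (h' : connIn nn D u v) (huD : u ∈ D) (hu : u.2 ≤ c)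
    (hv : d ≤ v.2) : ∃ z, z ∈ C ∧ z ∈ D := by
  by_contra! hdis
  have hyC := h.mem hxC
  let C' : Set Vertex := C ∪ {(x.1 - 1, x.2)} ∪ {(y.1 + 1, y.2)}
  have hCC : C ⊆ C' := fun z hz => .inl (.inl hz)
  have hl : ((x.1 - 1, x.2) : Vertex) ∈ C' := .inl (.inr rfl)
  have hr : ((y.1 + 1, y.2) : Vertex) ∈ C' := .inr rfl
  have hC' : ∀ z ∈ C', c ≤ z.2 ∧ z.2 ≤ d := by
    rintro z ((hz | rfl) | rfl)
    · exact hC z hz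
    · exact hC x hxC
    · exact hC y hyC
  have hp : connIn nn C' (x.1 - 1, x.2) (y.1 + 1, y.2) := by
    refine Relation.ReflTransGen.head (b := x) ⟨?_, hl, hCC hxC⟩ ?_
    · simp [nn]
    refine Relation.ReflTransGen.tail (b := y) (h.mono_set hCC) ⟨?_, hCC hyC, hr⟩
    simp [nn]
  obtain ⟨F, i1, i2, i3, i4⟩ := exists_flow hC' hp
  have hn : ∀ z ∈ D, (z.1, z.2) ∉ C' := by
    rintro z hz ((hz' | hz') | hz')
    · exact hdis z hz' hz
    · have := congrArg Prod.fst hz'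
      have := hD z hz
      simp_all; omega
    · have := congrArg Prod.fst hz'
      have := hD z hz
      simp_all; omega
  have key : v ∈ D ∧ F v.1 v.2 = 1 := by
    refine connIn.closed (C := {z | z ∈ D ∧ F z.1 z.2 = 1}) h' ⟨huD, ?_⟩ ?_
    · rw [← i1 _ _ (hn u huD), i4 _ _ (by omega)]
      have := hD u huD
      dsimp only
      split_ifs <;> omega
    · rintro p q ⟨hpD, hp⟩ hpq - hqD
      refine ⟨hqD, ?_⟩
      have b1 := hD p hpD
      have b2 := hD q hqD
      have n1 := hn p hpD
      have n2 := hn q hqD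
      rcases hpq with ⟨e1, e2 | e2⟩ | ⟨e1, e2 | e2⟩
      · have := i1 _ _ n2
        rw [e2, e1, show p.2 + 1 - 1 = p.2 by ring] at this
        rw [e2, e1, ← this, hp]
      · have := i1 _ _ n1
        rw [e2, show q.2 + 1 - 1 = q.2 by ring, ← e1] at this
        rw [this, e1, ← e2, hp]
      · have := i2 _ _ n2
        rw [e2, e1, show p.1 + 1 - 1 = p.1 by ring] at this
        rw [e2, e1]
        dsimp only at this
        split_ifs at this <;> omega
      · have := i2 _ _ n1
        rw [e2, show q.1 + 1 - 1 = q.1 by ring, ← e1] at this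
        rw [e2, ← e1] at hp
        dsimp only at this
        split_ifs at this <;> omega
  have := i3 v.1 v.2 hv
  omega

/-- Crossing open paths are connected. -/
lemma Cn.cross {ω : Config} {S T : Set Vertex} {a b c d : ℤ} (hS : ∀ z ∈ S, c ≤ z.2 ∧ z.2 ≤ d)
    (hT : ∀ z ∈ T, a ≤ z.1 ∧ z.1 ≤ b) {x y u v : Vertex} (h : Cn ω S x y) (hxS : x ∈ S)
    (hx : x.1 ≤ a) (hy : b ≤ y.1) (h' : Cn ω T u v) (huT : u ∈ T) (hu : u.2 ≤ c)
    (hv : d ≤ v.2) : ∃ z ∈ S, z ∈ T ∧ Cn ω S x z ∧ Cn ω T u z := by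
  obtain ⟨z, h1, h2⟩ := paths_cross (C := {z ∈ S | Cn ω S x z}) (D := {z ∈ T | Cn ω T u z})
    (fun z hz => hS z hz.1) (fun z hz => hT z hz.1) (x := x) (y := y) (u := u) (v := v)
    (h.reach.map (φ := id) (fun _ _ h => openAdj.nn h)
      fun z hz => ⟨connIn.mem hz hxS, hz⟩) ⟨hxS, .refl⟩ hx hy
      (h'.reach.map (φ := id) (fun _ _ h => openAdj.nn h)
      fun z hz => ⟨connIn.mem hz huT, hz⟩)
    ⟨huT, .refl⟩ hu hv
  · exact ⟨z, h1.1, h2.1, h1.2, h2.2⟩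

end FKArm

namespace FKArm

lemma dualC_swapC (ω : Config) : dualC (swapC ω) = swapC (dualC ω) := by
  funext ⟨⟨x, y⟩, o⟩
  cases o <;> rfl

/-! ### The refined lattice -/

/-- Midpoint of an edge, in the lattice refined by a factor two. -/
def mid (e : Edge) : Vertex :=
  if e.2 then (2 * e.1.1, 2 * e.1.2 + 1) else (2 * e.1.1 + 1, 2 * e.1.2)

lemma mid_inj {e e' : Edge} (h : mid e = mid e') : e = e' := by
  rcases e with ⟨⟨x, y⟩, _ | _⟩ <;> rcases e' with ⟨⟨x', y'⟩, _ | _⟩ <;>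
    simp [mid] at h ⊢ <;> omega

/-- Primal points of the refined lattice used by open paths in `S`. -/
def refP (ω : Config) (S : Set Vertex) : Set Vertex :=
  {z | (∃ v ∈ S, z = (2 * v.1, 2 * v.2)) ∨ ∃ e ∈ inside S, ω e = true ∧ z = mid e}

/-- Dual points of the refined lattice used by dual-open paths in `S`. -/
def refD (ω : Config) (S : Set Vertex) : Set Vertex :=
  {z | (∃ v ∈ S, z = (2 * v.1 + 1, 2 * v.2 + 1)) ∨
    ∃ e ∈ inside S, ω (dualE e) = false ∧ z = mid (dualE e)}

lemma Cn.refP {ω : Config} {S : Set Vertex} {x y : Vertex} (h : Cn ω S x y) :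
    connIn nn (refP ω S) (2 * x.1, 2 * x.2) (2 * y.1, 2 * y.2) := by
  induction h with
  | refl => exact .refl
  | tail h1 h2 ih =>
    rename_i u v
    obtain ⟨⟨e, he, hh⟩, hu, hv⟩ := h2
    have hu' : ((2 * u.1, 2 * u.2) : Vertex) ∈ FKArm.refP ω S := .inl ⟨u, hu, rfl⟩
    have hv' : ((2 * v.1, 2 * v.2) : Vertex) ∈ FKArm.refP ω S := .inl ⟨v, hv, rfl⟩
    have hi : e ∈ inside S := by
      rcases hh with ⟨h1, h2⟩ | ⟨h1, h2⟩
      · exact ⟨h1 ▸ hu, h2 ▸ hv⟩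
      · exact ⟨h1 ▸ hv, h2 ▸ hu⟩
    have hm : mid e ∈ FKArm.refP ω S := .inr ⟨e, hi, he, rfl⟩
    refine Relation.ReflTransGen.tail (b := mid e) (Relation.ReflTransGen.tail ih ⟨?_, hu', hm⟩)
      ⟨?_, hm, hv'⟩
    · rcases e with ⟨⟨x, y⟩, _ | _⟩ <;> rcases hh with ⟨h1, h2⟩ | ⟨h1, h2⟩ <;> subst h1 <;>
        subst h2 <;> simp [nn, mid, ends] <;> omega
    · rcases e with ⟨⟨x, y⟩, _ | _⟩ <;> rcases hh with ⟨h1, h2⟩ | ⟨h1, h2⟩ <;> subst h1 <;>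
        subst h2 <;> simp [nn, mid, ends] <;> omega

lemma Cn.refD {ω : Config} {S : Set Vertex} {x y : Vertex} (h : Cn (dualC ω) S x y) :
    connIn nn (refD ω S) (2 * x.1 + 1, 2 * x.2 + 1) (2 * y.1 + 1, 2 * y.2 + 1) := by
  refine h.refP.map (φ := fun z => (z.1 + 1, z.2 + 1)) ?_ ?_
  · intro u v h
    simp only [nn] at *
    omega
  · rintro z (⟨v, hv, rfl⟩ | ⟨e, he, he', rfl⟩)
    · exact .inl ⟨v, hv, rfl⟩
    · refine .inr ⟨e, he, by simpa [dualC] using he', ?_⟩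
      rcases e with ⟨⟨x, y⟩, _ | _⟩ <;> simp [mid, dualE] <;> ring

lemma refP_refD_disjoint {ω : Config} {S T : Set Vertex} {z : Vertex} (h : z ∈ refP ω S)
    (h' : z ∈ refD ω T) : False := by
  rcases h with ⟨v, -, rfl⟩ | ⟨e, -, he, rfl⟩ <;> rcases h' with ⟨v', -, hv⟩ | ⟨e', -, he', hv⟩
  · simp at hv; omega
  · generalize dualE e' = f at hv
    rcases f with ⟨⟨x, y⟩, _ | _⟩ <;> simp [mid] at hv <;> omega
  · rcases e with ⟨⟨x, y⟩, _ | _⟩ <;> simp [mid] at hv <;> omega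
  · rw [mid_inj hv] at he
    simp [he] at he'

lemma refP_rect {ω : Config} {a b c d : ℤ} {z : Vertex} (hz : z ∈ refP ω (rect a b c d)) :
    z ∈ rect (2 * a) (2 * b) (2 * c) (2 * d) := by
  rcases hz with ⟨v, hv, rfl⟩ | ⟨⟨⟨x, y⟩, o⟩, he, -, rfl⟩
  · simp only [mem_rect] at *; omega
  · cases o <;> simp [inside, ends, mid, mem_rect] at * <;> omega

lemma refD_rect {ω : Config} {a b c d : ℤ} {z : Vertex} (hz : z ∈ refD ω (rect a b c d)) :
    z ∈ rect (2 * a + 1) (2 * b + 1) (2 * c + 1) (2 * d + 1) := by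
  rcases hz with ⟨v, hv, rfl⟩ | ⟨⟨⟨x, y⟩, o⟩, he, -, rfl⟩
  · simp only [mem_rect] at *; omega
  · cases o <;> simp [inside, ends, mid, mem_rect, dualE] at * <;> omega

/-- An open left-right crossing excludes a dual-open bottom-top crossing. -/
lemma not_H_of_dual_V {ω : Config} {a b c d : ℤ} (h : dualC ω ∈ V a (b - 1) (c - 1) d) :
    ω ∉ H a b c d := by
  rintro ⟨x, y, hx, hy, hxm, hym, hp⟩
  obtain ⟨u, v, hu, hv, hum, hvm, hp'⟩ := h
  obtain ⟨z, h1, h2⟩ := paths_cross (a := 2 * a + 1) (b := 2 * b - 1) (c := 2 * c) (d := 2 * d)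
    (fun z hz => (refP_rect hz).2) (fun z hz => by have := (refD_rect hz).1; omega)
    hp.refP (.inl ⟨x, hxm, rfl⟩)
    (by dsimp only; omega) (by dsimp only; omega) hp'.refD (.inl ⟨u, hum, rfl⟩)
    (by dsimp only; omega) (by dsimp only; omega)
  exact refP_refD_disjoint h1 h2

/-- An open bottom-top crossing excludes a dual-open left-right crossing. -/
lemma not_V_of_dual_H {ω : Config} {a b c d : ℤ} (h : dualC ω ∈ H (a - 1) b c (d - 1)) :
    ω ∉ V a b c d := by
  rw [← swapC_mem_H]
  apply not_H_of_dual_V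
  rwa [dualC_swapC, swapC_mem_V]

lemma zmod2_telescope (g : ℕ → ZMod 2) (n : ℕ) :
    ∑ i ∈ Finset.range n, (g i + g (i + 1)) = g 0 + g n := by
  induction n with
  | zero => simp [CharTwo.add_self_eq_zero]
  | succ n ih =>
    rw [Finset.sum_range_succ, ih]
    linear_combination CharTwo.add_self_eq_zero (g n)

open Classical in
/-- If there is no open left-right crossing then there is a dual-open bottom-top crossing. -/
lemma dual_V_of_not_H {ω : Config} {a b c d : ℤ} (hab : a < b) (hcd : c ≤ d)
    (h : ω ∉ H a b c d) : dualC ω ∈ V a (b - 1) (c - 1) d := by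
  by_contra hV
  let R := rect a b c d
  let DR := rect a (b - 1) (c - 1) d
  let W : Set Vertex := {v | v ∈ R ∧ ∃ x ∈ R, x.1 = a ∧ Cn ω R x v}
  let K : Set Vertex := {u | u ∈ DR ∧ ∃ x ∈ DR, x.2 = c - 1 ∧ Cn (dualC ω) DR x u}
  let χ : Vertex → ZMod 2 := fun v => if v ∈ W then 1 else 0
  let κ : Vertex → ZMod 2 := fun v => if v ∈ K then 1 else 0
  have χa : ∀ y, c ≤ y → y ≤ d → χ (a, y) = 1 := by
    intro y h1 h2
    have hm : ((a, y) : Vertex) ∈ R := ⟨⟨le_rfl, hab.le⟩, h1, h2⟩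
    exact if_pos ⟨hm, _, hm, rfl, .refl⟩
  have χb : ∀ y, χ (b, y) = 0 := by
    intro y
    refine if_neg ?_
    rintro ⟨h1, x, h2, h3, h4⟩
    exact h ⟨x, _, h3, rfl, h2, h1, h4⟩
  have κc : ∀ p, a ≤ p → p ≤ b - 1 → κ (p, c - 1) = 1 := by
    intro p h1 h2
    have hm : ((p, c - 1) : Vertex) ∈ DR := ⟨⟨h1, h2⟩, le_rfl, by dsimp only; omega⟩
    exact if_pos ⟨hm, _, hm, rfl, .refl⟩
  have κd : ∀ p, κ (p, d) = 0 := by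
    intro p
    refine if_neg ?_
    rintro ⟨h1, x, h2, h3, h4⟩
    exact hV ⟨x, _, h3, rfl, h2, h1, h4⟩
  have hW : ∀ u v, u ∈ R → v ∈ R → openAdj ω u v → (u ∈ W ↔ v ∈ W) := by
    have : ∀ u v, u ∈ R → v ∈ R → openAdj ω u v → u ∈ W → v ∈ W := by
      rintro u v hu hv huv ⟨-, x, h2, h3, h4⟩
      exact ⟨hv, x, h2, h3, Relation.ReflTransGen.tail h4 ⟨huv, hu, hv⟩⟩
    exact fun u v hu hv huv =>
      ⟨this u v hu hv huv, this v u hv hu (openAdj_symm _ _ _ huv)⟩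
  have hK : ∀ u v, u ∈ DR → v ∈ DR → openAdj (dualC ω) u v → κ u = κ v := by
    have : ∀ u v, u ∈ DR → v ∈ DR → openAdj (dualC ω) u v → u ∈ K → v ∈ K := by
      rintro u v hu hv huv ⟨-, x, h2, h3, h4⟩
      exact ⟨hv, x, h2, h3, Relation.ReflTransGen.tail h4 ⟨huv, hu, hv⟩⟩
    intro u v hu hv huv
    have : u ∈ K ↔ v ∈ K := ⟨this u v hu hv huv, this v u hv hu (openAdj_symm _ _ _ huv)⟩
    simp only [κ, this]
  -- closed horizontal edges
  have hor : ∀ p y, a ≤ p → p ≤ b - 1 → c ≤ y → y ≤ d →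
      (χ (p, y) + χ (p + 1, y)) * κ (p, y - 1) = (χ (p, y) + χ (p + 1, y)) * κ (p, y) := by
    intro p y h1 h2 h3 h4
    by_cases ho : ω ((p, y), false) = true
    · have := hW (p, y) (p + 1, y) ⟨⟨h1, by dsimp only; omega⟩, h3, h4⟩
        ⟨⟨by dsimp only; omega, by dsimp only; omega⟩, h3, h4⟩ (openAdj_h ho)
      simp only [χ, this, CharTwo.add_self_eq_zero, zero_mul]
    · have hh : dualC ω ((p, y - 1), true) = true := by simp [dualC_v, ho]
      have := openAdj_v hh
      rw [sub_add_cancel] at this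
      rw [hK _ _ ⟨⟨h1, h2⟩, by dsimp only; omega, by dsimp only; omega⟩
        ⟨⟨h1, h2⟩, by dsimp only; omega, h4⟩ this]
  have ver : ∀ p y, a ≤ p → p ≤ b - 1 → c ≤ y → y ≤ d - 1 →
      (χ (p + 1, y) + χ (p + 1, y + 1)) * κ (p, y) =
        (χ (p + 1, y) + χ (p + 1, y + 1)) * κ (p + 1, y) := by
    intro p y h1 h2 h3 h4
    by_cases hp : p = b - 1
    · subst hp
      simp [χb]
    by_cases ho : ω ((p + 1, y), true) = true
    · have := hW (p + 1, y) (p + 1, y + 1)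
        ⟨⟨by dsimp only; omega, by dsimp only; omega⟩, h3, by dsimp only; omega⟩
        ⟨⟨by dsimp only; omega, by dsimp only; omega⟩, by dsimp only; omega, by dsimp only; omega⟩
        (openAdj_v ho)
      simp only [χ, this, CharTwo.add_self_eq_zero, zero_mul]
    · have hh : dualC ω ((p, y), false) = true := by simp [dualC_h, ho]
      rw [hK _ _ ⟨⟨h1, h2⟩, by dsimp only; omega, by dsimp only; omega⟩
        ⟨⟨by dsimp only; omega, by dsimp only; omega⟩, by dsimp only; omega, by dsimp only; omega⟩
        (openAdj_h hh)]
  obtain ⟨n, hn⟩ : ∃ n : ℕ, b = a + n := ⟨(b - a).toNat, by omega⟩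
  let Ψ : ℤ → ZMod 2 := fun y => ∑ i ∈ Finset.range n,
    (χ (a + i, y) + χ (a + i + 1, y)) * κ (a + i, y)
  have Ψ' : ∀ y, c ≤ y → y ≤ d → Ψ y = ∑ i ∈ Finset.range n,
      (χ (a + i, y) + χ (a + i + 1, y)) * κ (a + i, y - 1) := by
    intro y h1 h2
    refine Finset.sum_congr rfl fun i hi => (hor _ _ ?_ ?_ h1 h2).symm <;>
      have := Finset.mem_range.1 hi <;> omega
  have Ψc : Ψ c = 1 := by
    rw [Ψ' c le_rfl hcd]
    have := zmod2_telescope (fun i => χ (a + i, c)) n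
    simp only [Nat.cast_add, Nat.cast_one, Nat.cast_zero, add_zero, ← hn, χb,
      χa c le_rfl hcd] at this
    rw [← this]
    refine Finset.sum_congr rfl fun i hi => ?_
    have := Finset.mem_range.1 hi
    rw [κc _ (by omega) (by omega), mul_one, add_assoc a]
  have Ψd : Ψ d = 0 := Finset.sum_eq_zero fun i _ => by rw [κd, mul_zero]
  have step : ∀ y, c ≤ y → y ≤ d - 1 → Ψ y = Ψ (y + 1) := by
    intro y h1 h2
    have := zmod2_telescope (fun i => (χ (a + i, y) + χ (a + i, y + 1)) * κ (a + i, y)) n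
    simp only [Nat.cast_add, Nat.cast_one, Nat.cast_zero, add_zero, ← hn, χb,
      χa y h1 (by omega), χa (y + 1) (by omega) (by omega), CharTwo.add_self_eq_zero,
      zero_mul] at this
    have e : Ψ y + Ψ (y + 1) = 0 := by
      rw [Ψ' (y + 1) (by omega) (by omega), ← Finset.sum_add_distrib, ← this]
      refine Finset.sum_congr rfl fun i hi => ?_
      have hi := Finset.mem_range.1 hi
      rw [add_sub_cancel_right, ← add_assoc a, ← ver (a + i) y (by omega) (by omega) h1 h2]
      ring
    rwa [CharTwo.add_eq_zero] at e
  have all : ∀ k : ℕ, c + k ≤ d → Ψ (c + k) = 1 := by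
    intro k
    induction k with
    | zero => intro _; simpa using Ψc
    | succ k ih =>
      intro hk
      push_cast at hk ⊢
      rw [← add_assoc, ← step _ (by omega) (by omega)]
      exact ih (by omega)
  have := all (d - c).toNat (by omega)
  rw [show c + ((d - c).toNat : ℤ) = d by omega, Ψd] at this
  exact zero_ne_one this

/-- If there is no open bottom-top crossing then there is a dual-open left-right crossing. -/
lemma dual_H_of_not_V {ω : Config} {a b c d : ℤ} (hab : a ≤ b) (hcd : c < d)
    (h : ω ∉ V a b c d) : dualC ω ∈ H (a - 1) b c (d - 1) := by
  rw [← swapC_mem_V, ← dualC_swapC]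
  exact dual_V_of_not_H hcd hab (by rwa [swapC_mem_H])

end FKArm

namespace FKArm

lemma Dep.act {A : Set Config} {T : Finset Edge} (h : Dep A T) (π : Edge ≃ Edge)
    (β : Edge → Bool) : Dep (act π β ⁻¹' A) (T.map π.toEmbedding : Finset Edge) := by
  intro ω ω' hh hA
  refine h _ _ (fun e he => ?_) hA
  simp only [FKArm.act]
  rw [hh]
  simpa using he

lemma Mono.act {A : Set Config} (h : Mono true A) (π : Edge ≃ Edge) :
    Mono true (act π (fun _ => false) ⁻¹' A) := by
  intro ω ω' hh hA
  refine h _ _ (fun e he => ?_) hA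
  rw [act_false] at *
  exact hh _ he

lemma pr_harris_up {b : Bool} {A B : Set Config} {S T : Finset Edge} (hA : Dep A S) (hB : Dep B T)
    (mA : Mono b A) (mB : Mono b B) : pr A * pr B ≤ pr (A ∩ B) := by
  classical
  exact pr_harris (T := S ∪ T) (hA.mono (by simp)) (hB.mono (by simp)) mA mB

lemma pr_dual {A : Set Config} {T : Finset Edge} (hA : Dep A T) :
    pr {ω | dualC ω ∈ A} = pr A := by
  rw [← pr_act dualE (fun _ => true) hA.measurableSet]
  congr 1
  ext ω
  rw [Set.mem_preimage, act_dualE]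
  rfl

lemma pr_H_near_square {n : ℤ} (hn : 0 ≤ n) : 1 / 2 ≤ pr (H 0 (n + 1) 0 n) := by
  have h1 : (H 0 (n + 1) 0 n)ᶜ ⊆ {ω | dualC ω ∈ V 0 n (-1) n} := by
    intro ω hω
    have := dual_V_of_not_H (by omega) hn hω
    simpa using this
  have h2 := pr_mono h1
  rw [pr_dual (V_depE _ _ _ _), pr_compl (H_depE _ _ _ _), pr_V] at h2
  have h3 := pr_H_shift 1 0 (-1) n 0 n
  simp only [neg_add_cancel, add_zero] at h3
  linarith

lemma pr_H_square {n : ℤ} (hn : 0 ≤ n) : 1 / 2 ≤ pr (H 0 n 0 n) :=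
  (pr_H_near_square hn).trans (pr_mono (H_subset le_rfl (by omega) le_rfl le_rfl hn))

/-- Reflection of edges in a horizontal line. -/
def reflE (m : ℤ) : Edge ≃ Edge where
  toFun e := if e.2 then ((e.1.1, m - 1 - e.1.2), true) else ((e.1.1, m - e.1.2), false)
  invFun e := if e.2 then ((e.1.1, m - 1 - e.1.2), true) else ((e.1.1, m - e.1.2), false)
  left_inv e := by rcases e with ⟨⟨x, y⟩, _ | _⟩ <;> simp
  right_inv e := by rcases e with ⟨⟨x, y⟩, _ | _⟩ <;> simp

/-- Reflection of vertices in a horizontal line. -/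
def reflV (m : ℤ) (v : Vertex) : Vertex := (v.1, m - v.2)

@[simp] lemma reflV_reflV (m : ℤ) (v : Vertex) : reflV m (reflV m v) = v := by simp [reflV]

/-- Reflected configuration. -/
def reflC (m : ℤ) (ω : Config) : Config := fun e => ω (reflE m e)

lemma reflC_reflC (m : ℤ) (ω : Config) : reflC m (reflC m ω) = ω := by
  funext ⟨⟨x, y⟩, o⟩
  cases o <;> simp [reflC, reflE]

lemma reflC_adj {m : ℤ} {ω : Config} (u v : Vertex) (h : openAdj (reflC m ω) u v) :
    openAdj ω (reflV m u) (reflV m v) := by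
  refine openAdj_map (φ := reflV m) (fun x y h => openAdj_h h) (fun x y h => ?_) u v h
  have := openAdj_symm _ _ _ (openAdj_v (ω := ω) (x := x) (y := m - 1 - y) h)
  rwa [show m - 1 - y + 1 = m - y by ring, show m - 1 - y = m - (y + 1) by ring] at this

lemma Cn.refl_map {m : ℤ} {ω : Config} {S S' : Set Vertex} {x y : Vertex}
    (hS : ∀ v ∈ S, reflV m v ∈ S') (h : Cn ω S x y) :
    Cn (reflC m ω) S' (reflV m x) (reflV m y) := by
  refine connIn.map (fun u v h => reflC_adj u v ?_) hS h
  rwa [reflC_reflC]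

lemma refP_disjoint {ω ω' : Config} {S T : Set Vertex} (hST : ∀ v ∈ S, v ∉ T) {z : Vertex}
    (h : z ∈ refP ω S) (h' : z ∈ refP ω' T) : False := by
  rcases h with ⟨v, hv, rfl⟩ | ⟨e, he, -, rfl⟩ <;> rcases h' with ⟨v', hv', h⟩ | ⟨e', he', -, h⟩
  · simp only [Prod.mk.injEq, mul_eq_mul_left_iff, OfNat.ofNat_ne_zero, or_false] at h
    rw [← Prod.ext_iff] at h
    exact hST v hv (h ▸ hv')
  · rcases e' with ⟨⟨x, y⟩, _ | _⟩ <;> simp [mid] at h <;> omega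
  · rcases e with ⟨⟨x, y⟩, _ | _⟩ <;> simp [mid] at h <;> omega
  · rw [mid_inj h] at he
    exact hST _ he.1 he'.1

/-- Decomposition of a path at its last visit to a set. -/
lemma connIn.last_visit {adj : Vertex → Vertex → Prop} {S C : Set Vertex} {x y : Vertex}
    (h : connIn adj S x y) (hx : x ∈ C) : ∃ z ∈ C, (z = y ∨ ∃ z', adj z z' ∧ z ∈ S ∧
      z' ∈ S \ C ∧ connIn adj (S \ C) z' y) := by
  induction h with
  | refl => exact ⟨x, hx, .inl rfl⟩
  | tail h1 h2 ih =>
    rename_i u v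
    by_cases hv : v ∈ C
    · exact ⟨v, hv, .inl rfl⟩
    obtain ⟨z, hz, rfl | ⟨z', h3, h4, h5, h6⟩⟩ := ih
    · exact ⟨z, hz, .inr ⟨v, h2.1, h2.2.1, ⟨h2.2.2, hv⟩, .refl⟩⟩
    · exact ⟨z, hz, .inr ⟨z', h3, h4, h5, Relation.ReflTransGen.tail h6
        ⟨h2.1, h6.mem h5, h2.2.2, hv⟩⟩⟩

/-! ### Exploration of the leftmost crossing -/

section Exploration
variable (n : ℤ)

/-- Dual vertices explored from the left. -/
def expl (ω : Config) : Set Vertex :=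
  {u | ∃ x ∈ rect (-1) n 0 (n - 1), x.1 = -1 ∧ Cn (dualC ω) (rect (-1) n 0 (n - 1)) x u}

variable {n}

lemma expl_subset {ω : Config} : expl n ω ⊆ rect (-1) n 0 (n - 1) :=
  fun _ ⟨_, h1, _, h2⟩ => h2.mem h1

lemma expl_reach {ω : Config} {u : Vertex} (h : u ∈ expl n ω) :
    ∃ x ∈ expl n ω, x.1 = -1 ∧ Cn (dualC ω) (expl n ω) x u := by
  obtain ⟨x, h1, h2, h3⟩ := h
  refine ⟨x, ⟨x, h1, h2, .refl⟩, h2, h3.reach.mono_set fun v hv => ⟨x, h1, h2, hv⟩⟩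

variable (n)

open Classical in
/-- Edges revealed by the exploration when the explored set is `w`. -/
noncomputable def explE (w : Set Vertex) : Finset Edge :=
  ((rectE (-1) n 0 (n - 1)).filter fun e => (ends e).1 ∈ w ∨ (ends e).2 ∈ w).map dualE.toEmbedding

variable {n}

lemma mem_explE {w : Set Vertex} {e : Edge} : dualE e ∈ explE n w ↔
    e ∈ inside (rect (-1) n 0 (n - 1)) ∧ ((ends e).1 ∈ w ∨ (ends e).2 ∈ w) := by
  simp [explE, mem_rectE]

lemma expl_dep (w : Set Vertex) : Dep {ω | expl n ω = w} (explE n w) := by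
  rintro ω ω' h rfl
  have hag : ∀ e, e ∈ inside (rect (-1) n 0 (n - 1)) →
      ((ends e).1 ∈ expl n ω ∨ (ends e).2 ∈ expl n ω) → dualC ω e = dualC ω' e := by
    intro e h1 h2
    simp only [dualC]
    rw [h _ (mem_explE.2 ⟨h1, h2⟩)]
  apply Set.Subset.antisymm
  · rintro u ⟨x, h1, h2, h3⟩
    refine h3.closed (C := expl n ω) ⟨x, h1, h2, .refl⟩ ?_
    rintro a b ⟨y, hy1, hy2, hy3⟩ ⟨e, he, hab⟩ ha hb
    refine ⟨y, hy1, hy2, Relation.ReflTransGen.tail hy3 ⟨⟨e, ?_, hab⟩, ha, hb⟩⟩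
    have hm : a ∈ expl n ω := ⟨y, hy1, hy2, hy3⟩
    rw [hag, he]
    · rcases hab with ⟨h1, h2⟩ | ⟨h1, h2⟩
      · exact ⟨h1 ▸ ha, h2 ▸ hb⟩
      · exact ⟨h1 ▸ hb, h2 ▸ ha⟩
    · rcases hab with ⟨h1, h2⟩ | ⟨h1, h2⟩
      · exact .inl (h1 ▸ hm)
      · exact .inr (h2 ▸ hm)
  · intro u hu
    obtain ⟨x, h1, h2, h3⟩ := expl_reach hu
    refine ⟨x, expl_subset h1, h2, ?_⟩
    refine (h3.congr fun e he => ?_).mono_set expl_subset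
    rw [hag e (inside_mono expl_subset he) (.inl he.1)]
    exact id

open Classical in
/-- The deterministic configuration of edges on the boundary of the explored set. -/
noncomputable def bdry (n : ℤ) (w : Set Vertex) : Config := fun e =>
  decide (dualE.symm e ∈ inside (rect (-1) n 0 (n - 1)) ∧
    ¬ ((ends (dualE.symm e)).1 ∈ w ↔ (ends (dualE.symm e)).2 ∈ w))

lemma bdry_dualE {w : Set Vertex} {e : Edge} : bdry n w (dualE e) = true ↔
    e ∈ inside (rect (-1) n 0 (n - 1)) ∧ ¬ ((ends e).1 ∈ w ↔ (ends e).2 ∈ w) := by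
  simp [bdry]

lemma bdry_le {ω : Config} {e : Edge} (h : bdry n (expl n ω) e = true) : ω e = true := by
  obtain ⟨e, rfl⟩ := dualE.surjective e
  rw [bdry_dualE] at h
  obtain ⟨hi, h⟩ := h
  by_contra hω
  have ho : dualC ω e = true := by simpa [dualC] using hω
  apply h
  constructor
  · rintro ⟨x, h1, h2, h3⟩
    exact ⟨x, h1, h2, Relation.ReflTransGen.tail h3 ⟨⟨e, ho, .inl ⟨rfl, rfl⟩⟩, hi⟩⟩
  · rintro ⟨x, h1, h2, h3⟩
    exact ⟨x, h1, h2, Relation.ReflTransGen.tail h3 ⟨⟨e, ho, .inr ⟨rfl, rfl⟩⟩, hi.2, hi.1⟩⟩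

lemma bdry_crossing {ω : Config} (hn : 0 < n) (h : ∀ u ∈ expl n ω, u.1 ≠ n) :
    bdry n (expl n ω) ∈ V 0 n 0 n := by
  by_contra hV
  obtain ⟨x, y, h1, h2, h3, h4, h5⟩ := dual_H_of_not_V hn.le hn hV
  rw [show (0 : ℤ) - 1 = -1 by rfl] at *
  refine h y ?_ h2
  refine h5.closed (C := expl n ω) ⟨x, h3, h1, .refl⟩ ?_
  rintro a b ha ⟨e, he, hab⟩ haS hbS
  have hb : bdry n (expl n ω) (dualE e) = false := by simpa [dualC] using he
  have : ¬ (bdry n (expl n ω) (dualE e) = true) := by simp [hb]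
  rw [bdry_dualE, not_and, not_not] at this
  rcases hab with ⟨h1, h2⟩ | ⟨h1, h2⟩
  · have := this ⟨h1 ▸ haS, h2 ▸ hbS⟩
    rw [h1, h2] at this
    exact this.1 ha
  · have := this ⟨h1 ▸ hbS, h2 ▸ haS⟩
    rw [h1, h2] at this
    exact this.2 ha

end Exploration

end FKArm

namespace FKArm

open Classical in
/-- Close all edges of `E`. -/
noncomputable def closeOn (E : Finset Edge) (ω : Config) : Config :=
  fun e => if e ∈ E then false else ω e

lemma closeOn_le {E : Finset Edge} {ω : Config} {e : Edge} (h : closeOn E ω e = true) :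
    ω e = true := by
  unfold closeOn at h
  split_ifs at h
  exact h

lemma refD_mid {ω : Config} {w : Set Vertex} {e : Edge} (h : mid (dualE e) ∈ refD ω w) :
    e ∈ inside w := by
  rcases h with ⟨v, -, hv⟩ | ⟨e', he', -, h⟩
  · generalize dualE e = f at hv
    rcases f with ⟨⟨x, y⟩, _ | _⟩ <;> simp [mid] at hv <;> omega
  · rwa [dualE.injective (mid_inj h)]

lemma refD_not_even {ω : Config} {w : Set Vertex} {v : Vertex}
    (h : ((2 * v.1, 2 * v.2) : Vertex) ∈ refD ω w) : False := by
  rcases h with ⟨v', -, hv⟩ | ⟨e', -, -, h⟩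
  · simp at hv; omega
  · generalize dualE e' = f at h
    rcases f with ⟨⟨x, y⟩, _ | _⟩ <;> simp [mid] at h <;> omega

lemma refP_mid {ω : Config} {S : Set Vertex} {e : Edge} (h : mid e ∈ refP ω S) :
    e ∈ inside S ∧ ω e = true := by
  rcases h with ⟨v, -, hv⟩ | ⟨e', he', ho, h⟩
  · rcases e with ⟨⟨x, y⟩, _ | _⟩ <;> simp [mid] at hv <;> omega
  · rw [mid_inj h]; exact ⟨he', ho⟩

lemma refP_mono {ω : Config} {S T : Set Vertex} (h : S ⊆ T) : refP ω S ⊆ refP ω T := by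
  rintro z (⟨v, hv, rfl⟩ | ⟨e, he, ho, rfl⟩)
  · exact .inl ⟨v, h hv, rfl⟩
  · exact .inr ⟨e, inside_mono h he, ho, rfl⟩

/-- The barrier: the part of the boundary configuration reachable from `u`. -/
def barrier (n : ℤ) (w : Set Vertex) (u : Vertex) : Set Vertex :=
  {z | Cn (bdry n w) (rect 0 n 0 n) u z}

section
variable {n : ℤ} {w : Set Vertex} {u v : Vertex}

lemma barrier_subset (hu : u ∈ rect 0 n 0 n) : barrier n w u ⊆ rect 0 n 0 n :=
  fun _ h => connIn.mem h hu

/-- The barrier together with its reflection. -/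
def dblBarrier (n : ℤ) (w : Set Vertex) (u : Vertex) : Set Vertex :=
  barrier n w u ∪ {z | reflV (2 * n) z ∈ barrier n w u}

lemma refl_dblBarrier {z : Vertex} :
    reflV (2 * n) z ∈ dblBarrier n w u ↔ z ∈ dblBarrier n w u := by
  simp [dblBarrier, or_comm]

lemma dblBarrier_rect (hn : 0 ≤ n) (hu : u ∈ rect 0 n 0 n) {z : Vertex}
    (hz : z ∈ dblBarrier n w u) : z ∈ rect 0 n 0 (2 * n) := by
  rcases hz with h | h
  · exact rect_subset le_rfl le_rfl le_rfl (by omega) (barrier_subset hu h)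
  · have := barrier_subset hu h
    simp only [reflV, mem_rect] at *
    omega

/-- A path to the right of the barrier cannot use an explored edge. -/
lemma not_explored_of_right {ω₀ ω : Config} (hn : 0 < n) (hw : expl n ω₀ = w)
    (hu : u ∈ rect 0 n 0 n) (hu0 : u.2 = 0) (hv : v ∈ barrier n w u) (hvn : v.2 = n)
    {e : Edge} (he : e ∈ explE n w) {x y : Vertex} (hex : (ends e).1 = x ∨ (ends e).2 = x)
    (hx : x ∈ rect 0 (2 * n) 0 (2 * n) \ dblBarrier n w u)
    (h : Cn ω (rect 0 (2 * n) 0 (2 * n) \ dblBarrier n w u) x y) (hy : y.1 = 2 * n) : False := by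
  obtain ⟨f, rfl⟩ := dualE.surjective e
  rw [mem_explE] at he
  obtain ⟨hfi, hf⟩ := he
  obtain ⟨p, hp, hpf⟩ : ∃ p ∈ w, (ends f).1 = p ∨ (ends f).2 = p := by
    rcases hf with hf | hf
    · exact ⟨_, hf, .inl rfl⟩
    · exact ⟨_, hf, .inr rfl⟩
  obtain ⟨x₀, hx₀, hx₀1, hx₀p⟩ := expl_reach (hw ▸ hp)
  have hyS := h.mem hx
  rw [hw] at hx₀ hx₀p
  set RC := rect 0 (2 * n) 0 (2 * n) \ dblBarrier n w u with hRC
  set B := barrier n w u with hB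
  let B' : Set Vertex := {z | reflV (2 * n) z ∈ B}
  let C : Set Vertex := refD ω₀ w ∪ {mid (dualE f)} ∪ refP ω RC
  let D : Set Vertex := refP (bdry n w) B ∪ refP (reflC (2 * n) (bdry n w)) B'
  have hwr : w ⊆ rect (-1) n 0 (n - 1) := hw ▸ expl_subset
  have hwD : ∀ z ∈ refD ω₀ w, 1 ≤ z.2 ∧ z.2 ≤ 2 * n - 1 := by
    intro z hz
    have : z ∈ refD ω₀ (rect (-1) n 0 (n - 1)) := by
      rcases hz with ⟨v, hv, rfl⟩ | ⟨e, he, ho, rfl⟩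
      · exact .inl ⟨v, hwr hv, rfl⟩
      · exact .inr ⟨e, inside_mono hwr he, ho, rfl⟩
    have := (refD_rect this).2
    omega
  have hmf : 0 ≤ (mid (dualE f)).2 ∧ (mid (dualE f)).2 ≤ 4 * n := by
    rcases f with ⟨⟨x, y⟩, _ | _⟩ <;> simp [inside, ends, mid, mem_rect, dualE] at * <;> omega
  have hC : ∀ z ∈ C, 0 ≤ z.2 ∧ z.2 ≤ 4 * n := by
    rintro z ((hz | rfl) | hz)
    · have := hwD z hz; omega
    · exact hmf
    · have := (refP_rect (refP_mono Set.sdiff_subset hz)).2; omega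
  have hB'r : B' ⊆ rect 0 n n (2 * n) := by
    intro z hz
    have := barrier_subset hu hz
    simp only [reflV, mem_rect] at *
    omega
  have hD : ∀ z ∈ D, 0 ≤ z.1 ∧ z.1 ≤ 2 * n := by
    rintro z (hz | hz)
    · have := (refP_rect (refP_mono (barrier_subset hu) hz)).1; omega
    · have := (refP_rect (refP_mono hB'r hz)).1; omega
  have huB : u ∈ B := .refl
  have hBp : Cn (bdry n w) B u v := connIn.reach hv
  have hBp' : Cn (reflC (2 * n) (bdry n w)) B' v (reflV (2 * n) u) := by
    have := (hBp.refl_map (m := 2 * n) (S' := B') fun z hz => by simpa [B'] using hz).symm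
    have e : reflV (2 * n) v = v := by
      rcases v with ⟨v1, v2⟩
      simp only at hvn
      subst hvn
      simp only [reflV, Prod.mk.injEq, true_and]
      ring
    rwa [e] at this
  have hDp : connIn nn D (2 * u.1, 2 * u.2)
      (2 * (reflV (2 * n) u).1, 2 * (reflV (2 * n) u).2) :=
    (hBp.refP.mono_set Set.subset_union_left).trans
      (hBp'.refP.mono_set Set.subset_union_right)
  have hCp : connIn nn C (2 * x₀.1 + 1, 2 * x₀.2 + 1) (2 * y.1, 2 * y.2) := by
    refine (hx₀p.refD.mono_set ?_).trans (Relation.ReflTransGen.head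
      (b := mid (dualE f)) ⟨?_, ?_, ?_⟩
      (Relation.ReflTransGen.head (b := (2 * x.1, 2 * x.2)) ⟨?_, ?_, ?_⟩ (h.refP.mono_set ?_)))
    · exact fun z hz => .inl (.inl hz)
    · clear * - hpf
      rcases f with ⟨⟨x, y⟩, _ | _⟩ <;> rcases hpf with rfl | rfl <;>
        simp [nn, mid, dualE, ends] <;> omega
    · exact .inl (.inl (.inl ⟨p, hp, rfl⟩))
    · exact .inl (.inr rfl)
    · clear * - hex
      generalize dualE f = f at *
      rcases f with ⟨⟨x, y⟩, _ | _⟩ <;> rcases hex with rfl | rfl <;>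
        simp [nn, mid, ends] <;> omega
    · exact .inl (.inr rfl)
    · exact .inr (.inl ⟨x, hx, rfl⟩)
    · exact fun z hz => .inr hz
  obtain ⟨z, hzC, hzD⟩ := paths_cross hC hD hCp (.inl (.inl (.inl ⟨x₀, hx₀, rfl⟩)))
    (by dsimp only; omega) (by dsimp only; omega) hDp (.inl (.inl ⟨u, huB, rfl⟩))
    (by dsimp only; omega) (by simp only [reflV]; omega)
  have hBC : ∀ z ∈ RC, z ∉ B := fun z hz hz' => hz.2 (.inl hz')
  have hBC' : ∀ z ∈ RC, z ∉ B' := fun z hz hz' => hz.2 (.inr hz')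
  rcases hzC with (hz | rfl) | hz <;> rcases hzD with hz' | hz'
  · rcases hz' with ⟨v, hv, rfl⟩ | ⟨e, he, ho, rfl⟩
    · exact refD_not_even hz
    · obtain ⟨e, rfl⟩ := dualE.surjective e
      have h1 := refD_mid hz
      rw [bdry_dualE] at ho
      exact ho.2 ⟨fun _ => h1.2, fun _ => h1.1⟩
  · have h1 := hwD z hz
    have h2 := (refP_rect (refP_mono hB'r hz')).2
    omega
  · have h1 := (refP_mid hz').1
    rcases hex with rfl | rfl
    · exact hBC _ hx h1.1
    · exact hBC _ hx h1.2
  · have h1 := (refP_mid hz').1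
    rcases hex with rfl | rfl
    · exact hBC' _ hx h1.1
    · exact hBC' _ hx h1.2
  · exact refP_disjoint hBC hz hz'
  · exact refP_disjoint hBC' hz hz'

/-- The barrier is connected to the right side by unexplored edges. -/
def rightOf (n : ℤ) (w : Set Vertex) (u : Vertex) : Set Config :=
  {ω | ∃ z ∈ barrier n w u, ∃ y : Vertex, y.1 = 2 * n ∧
    Cn (closeOn (explE n w) ω) (rect 0 (2 * n) 0 (2 * n)) z y}

lemma rightOf_of_path {ω₀ ω : Config} (hn : 0 < n) (hw : expl n ω₀ = w)
    (hu : u ∈ rect 0 n 0 n) (hu0 : u.2 = 0) (hv : v ∈ barrier n w u) (hvn : v.2 = n)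
    {z y : Vertex} (hz : z ∈ barrier n w u) (hy : y.1 = 2 * n)
    (h : z = y ∨ ∃ z', openAdj ω z z' ∧ z ∈ rect 0 (2 * n) 0 (2 * n) ∧
      z' ∈ rect 0 (2 * n) 0 (2 * n) \ dblBarrier n w u ∧
      connIn (openAdj ω) (rect 0 (2 * n) 0 (2 * n) \ dblBarrier n w u) z' y) :
    ω ∈ rightOf n w u := by
  refine ⟨z, hz, y, hy, ?_⟩
  rcases h with rfl | ⟨z', h1, h2, h3, h4⟩
  · exact .refl
  have key : ∀ a b, openAdj ω a b → b ∈ rect 0 (2 * n) 0 (2 * n) \ dblBarrier n w u →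
      Cn ω (rect 0 (2 * n) 0 (2 * n) \ dblBarrier n w u) b y →
      openAdj (closeOn (explE n w) ω) a b := by
    rintro a b ⟨e, he, hab⟩ hb hby
    refine ⟨e, ?_, hab⟩
    have : e ∉ explE n w := fun hh =>
      not_explored_of_right hn hw hu hu0 hv hvn hh (x := b) (by tauto) hb hby hy
    simp [closeOn, this, he]
  refine Relation.ReflTransGen.head ⟨key _ _ h1 h3 h4, h2, h3.1⟩ ?_
  clear h1 h2 hz
  induction h4 using Relation.ReflTransGen.head_induction_on with
  | refl => exact .refl
  | head h5 h6 ih =>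
    exact Relation.ReflTransGen.head ⟨key _ _ h5.1 h5.2.2 h6, h5.2.1.1, h5.2.2.1⟩ (ih h5.2.2)

lemma rightOf_or_refl {ω₀ ω : Config} (hn : 0 < n) (hw : expl n ω₀ = w)
    (hu : u ∈ rect 0 n 0 n) (hu0 : u.2 = 0) (hv : v ∈ barrier n w u) (hvn : v.2 = n)
    (hω : ω ∈ H 0 (2 * n) 0 (2 * n)) :
    ω ∈ rightOf n w u ∨ reflC (2 * n) ω ∈ rightOf n w u := by
  obtain ⟨x, y, hx, hy, hxm, hym, hp⟩ := hω
  have huB : u ∈ barrier n w u := .refl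
  have hBp : connIn nn (dblBarrier n w u) u v :=
    (connIn.reach hv).mono (fun _ _ h => openAdj.nn h) Set.subset_union_left
  have hBp' : connIn nn (dblBarrier n w u) v (reflV (2 * n) u) := by
    have := connIn.map (φ := reflV (2 * n)) (adj' := nn) (S' := dblBarrier n w u)
      (fun a b h => ?_) (fun z hz => ?_) (connIn.symm (fun _ _ h => nn.symm h) hBp)
    · have e : reflV (2 * n) v = v := by
        rcases v with ⟨v1, v2⟩
        simp only at hvn
        subst hvn
        simp only [reflV, Prod.mk.injEq, true_and]
        ring
      rwa [e] at this
    · unfold nn reflV at *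
      dsimp only
      omega
    · exact refl_dblBarrier.2 hz
  obtain ⟨z₀, h1, h2⟩ := paths_cross (C := {z | Cn ω (rect 0 (2 * n) 0 (2 * n)) x z})
    (a := 0) (b := n) (c := 0) (d := 2 * n)
    (fun z hz => (connIn.mem hz hxm).2) (fun z hz => (dblBarrier_rect hn.le hu hz).1)
    (hp.reach.mono (fun _ _ h => openAdj.nn h) subset_rfl) .refl hx.le (by omega)
    (hBp.trans hBp') (.inl huB) hu0.le (by simp [reflV, hu0])
  have hp2 : Cn ω (rect 0 (2 * n) 0 (2 * n)) z₀ y := (Cn.symm h1).trans hp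
  obtain ⟨z, hz, hh⟩ := hp2.last_visit h2
  rcases hz with hz | hz
  · exact .inl (rightOf_of_path hn hw hu hu0 hv hvn hz hy hh)
  · refine .inr (rightOf_of_path hn hw hu hu0 hv hvn (y := reflV (2 * n) y) hz hy ?_)
    have hr : ∀ z ∈ rect 0 (2 * n) 0 (2 * n), reflV (2 * n) z ∈ rect 0 (2 * n) 0 (2 * n) := by
      intro z hz
      simp only [reflV, mem_rect] at *
      omega
    rcases hh with rfl | ⟨z', h3, h4, h5, h6⟩
    · exact .inl rfl
    · refine .inr ⟨reflV (2 * n) z', reflC_adj _ _ ?_, hr _ h4,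
        ⟨hr _ h5.1, fun h => h5.2 (refl_dblBarrier.1 h)⟩, Cn.refl_map ?_ h6⟩
      · simpa [reflC_reflC] using h3
      · exact fun z hz => ⟨hr _ hz.1, fun h => hz.2 (refl_dblBarrier.1 h)⟩

open Classical in
lemma rightOf_dep : Dep (rightOf n w u)
    (rectE 0 (2 * n) 0 (2 * n) \ explE n w : Finset Edge) := by
  rintro ω ω' hh ⟨z, hz, y, hy, h⟩
  refine ⟨z, hz, y, hy, h.congr fun e he ho => ?_⟩
  unfold closeOn at ho ⊢
  split_ifs at ho ⊢ with h1
  rw [← hh, ho]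
  simp [mem_rectE, h1, he]

lemma pr_rightOf {ω₀ : Config} (hn : 0 < n) (hw : expl n ω₀ = w)
    (hu : u ∈ rect 0 n 0 n) (hu0 : u.2 = 0) (hv : v ∈ barrier n w u) (hvn : v.2 = n) :
    pr (H 0 (2 * n) 0 (2 * n)) / 2 ≤ pr (rightOf n w u) := by
  have h1 : H 0 (2 * n) 0 (2 * n) ⊆
      rightOf n w u ∪ act (reflE (2 * n)) (fun _ => false) ⁻¹' rightOf n w u := by
    intro ω hω
    rcases rightOf_or_refl hn hw hu hu0 hv hvn hω with h | h
    · exact .inl h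
    · refine .inr ?_
      rw [Set.mem_preimage, act_false]
      exact h
  have h2 := (pr_mono h1).trans (pr_union_le _ _)
  rw [pr_act _ _ rightOf_dep.measurableSet] at h2
  linarith

end

/-- A bottom-top crossing of the lower left quarter of a square that is connected to the
right side of the square. -/
def crossRight (n : ℤ) : Set Config :=
  {ω | ∃ u v y : Vertex, u ∈ rect 0 n 0 n ∧ u.2 = 0 ∧ v.2 = n ∧ y.1 = 2 * n ∧
    Cn ω (rect 0 n 0 n) u v ∧ Cn ω (rect 0 (2 * n) 0 (2 * n)) u y}

lemma crossRight_dep (n : ℤ) : Dep (crossRight n) (rectE (-n) (2 * n) (-n) (2 * n)) := by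
  rw [coe_rectE]
  rintro ω ω' hh ⟨u, v, y, h1, h2, h3, h4, h5, h6⟩
  have : 0 ≤ n := by have := h1.1; omega
  exact ⟨u, v, y, h1, h2, h3, h4,
    h5.congr fun e he => hh e (inside_mono (rect_subset (by omega) (by omega) (by omega)
      (by omega)) he) ▸ id,
    h6.congr fun e he => hh e (inside_mono (rect_subset (by omega) (by omega) (by omega)
      (by omega)) he) ▸ id⟩

lemma crossRight_mono (n : ℤ) : Mono true (crossRight n) := by
  rintro ω ω' hh ⟨u, v, y, h1, h2, h3, h4, h5, h6⟩
  exact ⟨u, v, y, h1, h2, h3, h4, h5.congr fun e _ => hh e, h6.congr fun e _ => hh e⟩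

lemma crossRight_of_expl {n : ℤ} {ω : Config} {u v : Vertex} (hn : 0 < n)
    (hu : u ∈ rect 0 n 0 n) (hu0 : u.2 = 0) (hv : v ∈ barrier n (expl n ω) u) (hvn : v.2 = n)
    (h : ω ∈ rightOf n (expl n ω) u) : ω ∈ crossRight n := by
  obtain ⟨z, hz, y, hy, hzy⟩ := h
  have h1 : ∀ z ∈ barrier n (expl n ω) u, Cn ω (rect 0 n 0 n) u z := by
    intro z hz
    exact Cn.congr hz fun e _ => bdry_le
  refine ⟨u, v, y, hu, hu0, hvn, hy, h1 v hv, ((h1 z hz).mono_set ?_).trans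
    (hzy.congr fun e _ => closeOn_le)⟩
  exact rect_subset le_rfl (by omega) le_rfl (by omega)

open Classical in
lemma pr_crossRight {n : ℤ} (hn : 0 < n) :
    pr (V 0 n 0 n) * (pr (H 0 (2 * n) 0 (2 * n)) / 2) ≤ pr (crossRight n) := by
  let DS : Finset Vertex := Finset.Icc (-1) n ×ˢ Finset.Icc 0 (n - 1)
  let G : Finset (Finset Vertex) := DS.powerset.filter fun w => ∀ u ∈ w, u.1 ≠ n
  have hfin : ∀ ω, ∃ w : Finset Vertex, (w : Set Vertex) = expl n ω ∧ w ⊆ DS := by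
    intro ω
    have h1 : expl n ω ⊆ DS := by
      intro z hz
      have := expl_subset hz
      simp only [mem_rect] at this
      exact Finset.mem_coe.2 (Finset.mem_product.2 ⟨Finset.mem_Icc.2 this.1,
        Finset.mem_Icc.2 this.2⟩)
    have h2 : (expl n ω).Finite := DS.finite_toSet.subset h1
    refine ⟨h2.toFinset, by simp, ?_⟩
    rw [← Finset.coe_subset]
    simpa using h1
  have hV : V 0 n 0 n ⊆ ⋃ w ∈ G, {ω | expl n ω = (w : Set Vertex)} := by
    intro ω hω
    obtain ⟨w, hw, hwD⟩ := hfin ω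
    refine Set.mem_iUnion₂.2 ⟨w, ?_, hw.symm⟩
    simp only [G, Finset.mem_filter, Finset.mem_powerset]
    refine ⟨hwD, fun u huw hun => ?_⟩
    rw [← Finset.mem_coe, hw] at huw
    obtain ⟨x, h1, h2, h3⟩ := huw
    refine not_V_of_dual_H ?_ hω
    exact ⟨x, u, h2, hun, h1, h3.mem h1, h3⟩
  have key : ∀ w ∈ G, ∃ Y : Set Config, MeasurableSet ({ω | expl n ω = (w : Set Vertex)} ∩ Y) ∧
      {ω | expl n ω = (w : Set Vertex)} ∩ Y ⊆ crossRight n ∧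
      pr {ω | expl n ω = (w : Set Vertex)} * (pr (H 0 (2 * n) 0 (2 * n)) / 2) ≤
        pr ({ω | expl n ω = (w : Set Vertex)} ∩ Y) := by
    intro w hw
    by_cases hne : ∃ ω₀, expl n ω₀ = (w : Set Vertex)
    · obtain ⟨ω₀, hω₀⟩ := hne
      have hg : ∀ u ∈ expl n ω₀, u.1 ≠ n := by
        rw [hω₀]
        exact fun u hu => (Finset.mem_filter.1 hw).2 u hu
      obtain ⟨u, v, hu0, hvn, hu, -, huv⟩ := bdry_crossing hn hg
      rw [hω₀] at huv
      have hdep := (expl_dep (n := n) (w : Set Vertex))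
      refine ⟨rightOf n w u, hdep.measurableSet.inter rightOf_dep.measurableSet, ?_, ?_⟩
      · rintro ω ⟨h1, h2⟩
        rw [Set.mem_ofPred_eq] at h1
        rw [← h1] at h2 huv
        exact crossRight_of_expl hn hu hu0 huv hvn h2
      · rw [pr_inter_of_disjoint hdep rightOf_dep Finset.disjoint_sdiff]
        exact mul_le_mul_of_nonneg_left (pr_rightOf hn hω₀ hu hu0 huv hvn) (pr_nonneg _)
    · have : {ω | expl n ω = (w : Set Vertex)} = ∅ := by
        ext ω
        simpa using fun h => hne ⟨ω, h⟩
      exact ⟨∅, by simp, by simp, by simp [this, pr]⟩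
  choose! Y hY1 hY2 hY3 using key
  have h1 : (⋃ w ∈ G, {ω | expl n ω = (w : Set Vertex)} ∩ Y w) ⊆ crossRight n :=
    Set.iUnion₂_subset hY2
  have h2 : pr (⋃ w ∈ G, {ω | expl n ω = (w : Set Vertex)} ∩ Y w) =
      ∑ w ∈ G, pr ({ω | expl n ω = (w : Set Vertex)} ∩ Y w) := by
    refine measureReal_biUnion_finset ?_ hY1
    intro w _ w' _ hne
    refine Set.disjoint_left.2 ?_
    rintro ω ⟨h1, -⟩ ⟨h2, -⟩
    rw [Set.mem_ofPred_eq] at h1 h2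
    exact hne (Finset.coe_injective (h1.symm.trans h2))
  have h3 : pr (V 0 n 0 n) ≤ ∑ w ∈ G, pr {ω | expl n ω = (w : Set Vertex)} :=
    (pr_mono hV).trans (measureReal_biUnion_finset_le _ _)
  calc pr (V 0 n 0 n) * (pr (H 0 (2 * n) 0 (2 * n)) / 2)
      ≤ (∑ w ∈ G, pr {ω | expl n ω = (w : Set Vertex)}) * (pr (H 0 (2 * n) 0 (2 * n)) / 2) :=
        mul_le_mul_of_nonneg_right h3 (by linarith [pr_nonneg (H 0 (2 * n) 0 (2 * n))])
    _ ≤ ∑ w ∈ G, pr ({ω | expl n ω = (w : Set Vertex)} ∩ Y w) := by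
        rw [Finset.sum_mul]
        exact Finset.sum_le_sum hY3
    _ ≤ pr (crossRight n) := h2 ▸ pr_mono h1

lemma pr_crossRight_ge {n : ℤ} (hn : 0 < n) : 1 / 8 ≤ pr (crossRight n) := by
  have h1 := pr_crossRight hn
  have h2 : 1 / 2 ≤ pr (V 0 n 0 n) := by rw [pr_V]; exact pr_H_square hn.le
  have h3 : 1 / 2 ≤ pr (H 0 (2 * n) 0 (2 * n)) := pr_H_square (by omega)
  nlinarith

end FKArm

namespace FKArm

lemma shift_adj {ω : Config} {k l : ℤ} (u v : Vertex)
    (h : openAdj (act (shiftE k l) (fun _ => false) ω) u v) :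
    openAdj ω (u.1 + k, u.2 + l) (v.1 + k, v.2 + l) := by
  rw [act_false] at h
  refine openAdj_map (φ := fun v => (v.1 + k, v.2 + l)) (fun x y h => ?_) (fun x y h => ?_) u v h
  · have := openAdj_h (ω := ω) (x := x + k) (y := y + l) h
    rwa [show x + k + 1 = x + 1 + k by ring] at this
  · have := openAdj_v (ω := ω) (x := x + k) (y := y + l) h
    rwa [show y + l + 1 = y + 1 + l by ring] at this

lemma mirror_adj {ω : Config} {m : ℤ} (u v : Vertex)
    (h : openAdj (swapC (reflC m (swapC ω))) u v) :
    openAdj ω (m - u.1, u.2) (m - v.1, v.2) := by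
  have := swapC_adj _ _ _ (reflC_adj _ _ (swapC_adj _ _ _ h))
  simpa [reflV] using this

lemma pr_H_three_two {n : ℤ} (hn : 0 < n) : 1 / 128 ≤ pr (H 0 (3 * n) 0 (2 * n)) := by
  let f : Edge → Bool := fun _ => false
  let X₁ : Set Config := act (shiftE n 0) f ⁻¹' crossRight n
  let X₂ : Set Config := act swapE f ⁻¹' (act (reflE (2 * n)) f ⁻¹' (act swapE f ⁻¹' crossRight n))
  have d0 := crossRight_dep n
  have d1 : Dep X₁ _ := d0.act (shiftE n 0) f
  have d2' := (d0.act swapE f).act (reflE (2 * n)) f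
  have d2 : Dep X₂ _ := d2'.act swapE f
  have m0 := crossRight_mono n
  have m1 : Mono true X₁ := m0.act (shiftE n 0)
  have m2 : Mono true X₂ := ((m0.act swapE).act (reflE (2 * n))).act swapE
  have p1 : pr X₁ = pr (crossRight n) := pr_act _ _ d0.measurableSet
  have p2 : pr X₂ = pr (crossRight n) := by
    rw [show pr X₂ = _ from pr_act _ _ d2'.measurableSet, pr_act _ _ (d0.act swapE f).measurableSet,
      pr_act _ _ d0.measurableSet]
  have d12 := d1.inter d2
  have h12 := pr_harris_up d1 d2 m1 m2
  have dh := H_depE n (2 * n) 0 n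
  classical
  rw [← Finset.coe_union] at d12
  have h3 := pr_harris_up dh d12 (H_mono n (2 * n) 0 n) (m1.inter m2)
  have h4 : H n (2 * n) 0 n ∩ (X₁ ∩ X₂) ⊆ H 0 (3 * n) 0 (2 * n) := by
    rintro ω ⟨⟨p, q, hp, hq, hpm, -, hpq⟩, h1, h2⟩
    obtain ⟨u, v, y, hu, hu0, hvn, hy, huv, huy⟩ := h1
    have h2 : swapC (reflC (2 * n) (swapC ω)) ∈ crossRight n := by
      have := h2
      simp only [X₂, f, Set.mem_preimage, act_false] at this
      exact this
    obtain ⟨u', v', y', hu', hu0', hvn', hy', huv', huy'⟩ := h2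
    have huv := huv.map (S' := rect n (2 * n) 0 n) shift_adj
      (by intro a ha; simp only [mem_rect] at *; omega)
    have huym := huy.mem (S := rect 0 (2 * n) 0 (2 * n)) (by simp only [mem_rect] at *; omega)
    have huym' := huy'.mem (S := rect 0 (2 * n) 0 (2 * n)) (by simp only [mem_rect] at *; omega)
    have huy := huy.map (S' := rect 0 (3 * n) 0 (2 * n)) shift_adj
      (by intro a ha; simp only [mem_rect] at *; omega)
    have huv' := huv'.map (S' := rect n (2 * n) 0 n) mirror_adj
      (by intro a ha; simp only [mem_rect] at *; omega)
    have huy' := huy'.map (S' := rect 0 (3 * n) 0 (2 * n)) mirror_adj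
      (by intro a ha; simp only [mem_rect] at *; omega)
    obtain ⟨z, -, -, hz1, hz2⟩ := Cn.cross (a := n) (b := 2 * n) (c := 0) (d := n)
      (fun z hz => hz.2) (fun z hz => hz.1) hpq hpm (by omega) (by omega) huv
      (by simp only [mem_rect] at *; omega) (by simp; omega) (by simp; omega)
    obtain ⟨z', -, -, hz1', hz2'⟩ := Cn.cross (a := n) (b := 2 * n) (c := 0) (d := n)
      (fun z hz => hz.2) (fun z hz => hz.1) hpq hpm (by omega) (by omega) huv'
      (by simp only [mem_rect] at *; omega) (by simp; omega) (by simp; omega)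
    have hs : rect n (2 * n) 0 n ⊆ rect 0 (3 * n) 0 (2 * n) :=
      rect_subset (by omega) (by omega) (by omega) (by omega)
    refine ⟨_, _, ?_, ?_, ?_, ?_, ((Cn.symm huy').trans
      ((connIn.mono_set hs hz2').trans ((Cn.symm (connIn.mono_set hs hz1')).trans
      (connIn.mono_set hs hz1)))).trans ((Cn.symm (connIn.mono_set hs hz2)).trans huy)⟩
    · simp; omega
    · simp; omega
    · simp only [mem_rect] at *; omega
    · simp only [mem_rect] at *; omega
  have h5 := pr_mono h4
  have h6 := pr_crossRight_ge hn
  have h7 : 1 / 2 ≤ pr (H n (2 * n) 0 n) := by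
    have := pr_H_shift n 0 0 n 0 n
    have h8 := pr_H_square hn.le
    have e : H (0 + n) (n + n) (0 + 0) (n + 0) = H n (2 * n) 0 n := by congr 1 <;> ring
    rw [e] at this
    linarith
  have h9 : (1 / 8 : ℝ) * (1 / 8) ≤ pr X₁ * pr X₂ := by
    rw [p1, p2]; exact mul_le_mul h6 h6 (by norm_num) (pr_nonneg _)
  have h10 : (1 / 2 : ℝ) * ((1 / 8 : ℝ) * (1 / 8)) ≤ pr (H n (2 * n) 0 n) * pr (X₁ ∩ X₂) :=
    mul_le_mul h7 (h9.trans h12) (by norm_num) (pr_nonneg _)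
  linarith

/-- Two overlapping horizontal crossings joined by a vertical one. -/
lemma H_glue {a b c d a' b' p q : ℤ} (h1 : a ≤ a') (h2 : a' ≤ p) (h4 : q ≤ b)
    (h5 : b ≤ b') : H a b c d ∩ (V p q c d ∩ H a' b' c d) ⊆ H a b' c d := by
  rintro ω ⟨⟨x, y, hx, hy, hxm, hym, hxy⟩, ⟨u, v, hu, hv, hum, hvm, huv⟩,
    ⟨x', y', hx', hy', hxm', hym', hxy'⟩⟩
  obtain ⟨z, -, -, hz1, hz2⟩ := Cn.cross (a := p) (b := q) (c := c) (d := d)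
      (fun z hz => hz.2) (fun z hz => hz.1) hxy hxm (by omega) (by omega) huv
      hum hu.le hv.ge
  obtain ⟨z', -, -, hz1', hz2'⟩ := Cn.cross (a := p) (b := q) (c := c) (d := d)
      (fun z hz => hz.2) (fun z hz => hz.1) hxy' hxm' (by omega) (by omega) huv
      hum hu.le hv.ge
  have s1 : rect a b c d ⊆ rect a b' c d := rect_subset (by omega) (by omega) (by omega) (by omega)
  have s2 : rect p q c d ⊆ rect a b' c d := rect_subset (by omega) (by omega) (by omega) (by omega)
  have s3 : rect a' b' c d ⊆ rect a b' c d :=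
    rect_subset (by omega) (by omega) (by omega) (by omega)
  refine ⟨x, y', hx, hy', s1 hxm, s3 hym',
    ((hz1.mono_set s1).trans (Cn.symm (hz2.mono_set s2))).trans
    ((hz2'.mono_set s2).trans ((Cn.symm (hz1'.mono_set s3)).trans ?_))⟩
  exact hxy'.mono_set s3

lemma pr_H_shift_eq {a b c d a' b' c' d' : ℤ} (h1 : a' - a = b' - b) (h2 : c' - c = d' - d) :
    pr (H a' b' c' d') = pr (H a b c d) := by
  rw [← pr_H_shift (a' - a) (c' - c) a b c d]
  congr 2 <;> omega

lemma pr_H_long {n : ℤ} (hn : 0 < n) (j : ℕ) :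
    (1 / 256 : ℝ) ^ (j + 1) ≤ pr (H 0 ((j + 2) * n) 0 (2 * n)) := by
  induction j with
  | zero =>
    have := pr_H_square (n := 2 * n) (by omega)
    simp only [Nat.cast_zero, zero_add]
    linarith
  | succ j ih =>
    have hj : (0 : ℤ) ≤ j * n := by positivity
    have hs := H_glue (a := 0) (b := (j + 2) * n) (c := 0) (d := 2 * n) (a' := j * n)
      (b' := (j + 3) * n) (p := j * n) (q := (j + 2) * n) hj le_rfl le_rfl
      (by linarith)
    have k1 := pr_harris_up (V_depE (j * n) ((j + 2) * n) 0 (2 * n))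
      (H_depE (j * n) ((j + 3) * n) 0 (2 * n)) (V_mono _ _ _ _) (H_mono _ _ _ _)
    have k2' := (V_depE (j * n) ((j + 2) * n) 0 (2 * n)).inter
      (H_depE (j * n) ((j + 3) * n) 0 (2 * n))
    classical
    rw [← Finset.coe_union] at k2'
    have k2 := pr_harris_up (H_depE 0 ((j + 2) * n) 0 (2 * n)) k2' (H_mono _ _ _ _)
      ((V_mono _ _ _ _).inter (H_mono _ _ _ _))
    have e1 : pr (V (j * n) ((j + 2) * n) 0 (2 * n)) = pr (H 0 (2 * n) 0 (2 * n)) := by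
      rw [pr_V]
      rw [← pr_H_shift 0 (j * n) 0 (2 * n) 0 (2 * n)]
      congr 2 <;> ring
    have e2 : pr (H (j * n) ((j + 3) * n) 0 (2 * n)) = pr (H 0 (3 * n) 0 (2 * n)) :=
      pr_H_shift_eq (by ring) (by ring)
    have h1 := pr_H_square (n := 2 * n) (by omega)
    have h2 := pr_H_three_two hn
    rw [e1, e2] at k1
    have h3 : (1 / 256 : ℝ) ≤ pr (H 0 (2 * n) 0 (2 * n)) * pr (H 0 (3 * n) 0 (2 * n)) := by
      nlinarith
    have h4 := pr_mono hs
    have h5 : (1 / 256 : ℝ) ^ (j + 1) * (1 / 256) ≤ _ * _ :=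
      mul_le_mul ih (h3.trans k1) (by norm_num) (pr_nonneg _)
    rw [pow_succ]
    refine (h5.trans (k2.trans h4)).trans (le_of_eq ?_)
    push_cast
    congr 2

/-- A lower bound for crossing probabilities of rectangles of aspect ratio `k`. -/
noncomputable def rho (k : ℕ) : ℝ := (1 / 256 : ℝ) ^ (3 * k + 1)

lemma rho_pos (k : ℕ) : 0 < rho k := by unfold rho; positivity

lemma rho_le_one (k : ℕ) : rho k ≤ 1 := pow_le_one₀ (by norm_num) (by norm_num)

lemma rho_le_pr_H (k : ℕ) {a b c d : ℤ} (hab : a ≤ b) (hk : b - a ≤ k * (d - c)) (hcd : 2 ≤ d - c) :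
    rho k ≤ pr (H a b c d) := by
  set n := (d - c) / 2
  have hn : 0 < n := by omega
  have h1 : d - c ≤ 2 * n + 1 := by omega
  have h2 := pr_H_long hn (3 * k)
  refine h2.trans ?_
  have e : pr (H a (a + (3 * k + 2) * n) c (c + 2 * n)) =
      pr (H 0 (((3 * k : ℕ) + 2) * n) 0 (2 * n)) :=
    pr_H_shift_eq (by push_cast; ring) (by ring)
  rw [← e]
  refine pr_mono (H_subset le_rfl ?_ le_rfl (by omega) hab)
  have : (k : ℤ) * (d - c) ≤ k * (3 * n) := by
    apply mul_le_mul_of_nonneg_left _ (by positivity); omega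
  nlinarith

lemma rho_le_pr_V (k : ℕ) {a b c d : ℤ} (hcd : c ≤ d) (hk : d - c ≤ k * (b - a)) (hab : 2 ≤ b - a) :
    rho k ≤ pr (V a b c d) := by
  rw [pr_V]; exact rho_le_pr_H k hcd hk hab

end FKArm

namespace FKArm

lemma avg_mul_of_disjoint (T : Finset Edge) {f g : Config → ℝ} {E F : Set Edge} (hf : DepF f E)
    (hg : DepF g F) (hEF : Disjoint E F) (ω : Config) :
    avg T (fun ω => f ω * g ω) ω = avg T f ω * avg T g ω := by
  classical
  have hT : T = (T.filter fun e => ¬ e ∈ E) ∪ T.filter fun e => e ∈ E := by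
    rw [Finset.union_comm, Finset.filter_union_filter_not_eq]
  have hd : Disjoint (T.filter fun e => ¬ e ∈ E) (T.filter fun e => e ∈ E) :=
    (Finset.disjoint_filter_filter_not T T _).symm
  set T₁ := T.filter fun e => e ∈ E
  set T₂ := T.filter fun e => ¬ e ∈ E
  have g1 : Indep T₁ g := hg.indep fun e he h =>
    Set.disjoint_left.1 hEF (Finset.mem_filter.1 he).2 h
  have f2 : Indep T₂ f := hf.indep fun e he h => (Finset.mem_filter.1 he).2 h
  have f2' : Indep T₂ (avg T₁ f) := (hf.avg T₁).indep fun e he h =>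
    (Finset.mem_filter.1 he).2 h.1
  rw [hT, avg_union hd, avg_union hd, avg_union hd, avg_of_indep T₁ g1, avg_of_indep T₂ f2',
    ← avg_mul_left T₂ f2' g]
  congr 1
  funext ω
  rw [mul_comm, ← avg_mul_left T₁ g1 f]
  simp only [mul_comm]

lemma avg_sdiff {S T : Finset Edge} (hST : S ⊆ T) [DecidableEq Edge] (f : Config → ℝ) :
    avg T f = avg S (avg (T \ S) f) := by
  have : T = S ∪ T \ S := by
    ext e; simp only [Finset.mem_union, Finset.mem_sdiff]; have := @hST e; tauto
  conv_lhs => rw [this]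
  convert avg_union Finset.disjoint_sdiff f

lemma avg_sdiff' {S T : Finset Edge} (hST : S ⊆ T) [DecidableEq Edge] (f : Config → ℝ) :
    avg T f = avg (T \ S) (avg S f) := by
  have : T = T \ S ∪ S := by
    ext e; simp only [Finset.mem_union, Finset.mem_sdiff]; have := @hST e; tauto
  conv_lhs => rw [this]
  convert avg_union Finset.sdiff_disjoint f

lemma avg_nonneg (T : Finset Edge) {f : Config → ℝ} (h : ∀ ω, 0 ≤ f ω) (ω : Config) :
    0 ≤ avg T f ω := by
  have := avg_mono T (f := fun _ => 0) h ω
  rwa [avg_const] at this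

lemma avg_le_one (T : Finset Edge) {f : Config → ℝ} (h : ∀ ω, f ω ≤ 1) (ω : Config) :
    avg T f ω ≤ 1 := by
  have := avg_mono T (g := fun _ => 1) h ω
  rwa [avg_const] at this

/-- The configurations of the arm event `A` in which the passage of the arm through a box is
forced, together with the event `Vp` and `Vm` controlling that passage: given the blocking event
`W`, an arm forces `Vp`; given the linking event `L`, the passage `Vm` creates an arm. -/
structure Gadget (b : Bool) (S T : Finset Edge) (A Vp Vm W L L' : Set Config)
    (Ep Em EW EL : Set Edge) : Prop where
  subset : S ⊆ T
  mono_A : Mono b A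
  mono_Vp : Mono b Vp
  mono_Vm : Mono b Vm
  mono_W : Mono (!b) W
  mono_L : Mono b L
  mono_L' : Mono b L'
  dep_Vp : Dep Vp Ep
  dep_Vm : Dep Vm Em
  dep_W : Dep W EW
  dep_L : Dep L EL
  dep_L' : Dep L' T
  W_subset : EW ⊆ T
  Vm_subset : Em ⊆ T
  W_disj_S : Disjoint EW S
  L_disj_S : Disjoint EL S
  W_disj_Vm : Disjoint EW Em
  W_disj_L : Disjoint EW EL
  Vp_disj_L : Disjoint Ep EL
  Vp_of_W : A ∩ W ⊆ Vp
  A_of_L : Vm ∩ L ⊆ A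
  L_of_A : A ∩ L' ⊆ L

open Classical in
lemma Gadget.half_step {b : Bool} {S T : Finset Edge} {A Vp Vm W L L' : Set Config}
    {Ep Em EW EL : Set Edge} (G : Gadget b S T A Vp Vm W L L' Ep Em EW EL) :
    ∃ f₁ κ : Config → ℝ, Indep S κ ∧ (∀ ω, 0 ≤ κ ω) ∧ (∀ ω, 0 ≤ f₁ ω) ∧
      (∀ ω, pr W * pr L' * avg T (ind A) ω ≤ κ ω) ∧
      (∀ ω, f₁ ω ≤ κ ω * avg (T \ S) (ind Vp) ω) ∧
      (∀ ω, κ ω * pr Vm ≤ avg S f₁ ω) ∧ MonoF b S f₁ ∧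
      MonoF b S (fun ω => avg (T \ S) (ind A) ω - f₁ ω) := by
  have hWT : Dep W T := G.dep_W.mono G.W_subset
  have hVT : Dep Vm T := G.dep_Vm.mono G.Vm_subset
  have hiW : Indep S (ind W) := G.dep_W.depF.indep fun e he h =>
    Set.disjoint_left.1 G.W_disj_S h he
  have hiL : Indep S (ind L) := G.dep_L.depF.indep fun e he h =>
    Set.disjoint_left.1 G.L_disj_S h he
  have hRW : ∀ ω, avg (T \ S) (ind W) ω = pr W := fun ω => by
    rw [pr_eq_avg hWT ω, avg_sdiff' G.subset, avg_of_indep S hiW]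
  have hRL : avg (T \ S) (ind L) = avg T (ind L) := by
    rw [avg_sdiff' G.subset, avg_of_indep S hiL]
  have hWL : ∀ ω ω', (∀ e, e ∉ S → ω e = ω' e) → (ω ∈ W ∩ L ↔ ω' ∈ W ∩ L) := by
    intro ω ω' h
    have key : ∀ ω ω', (∀ e, e ∉ S → ω e = ω' e) → ω ∈ W ∩ L → ω' ∈ W ∩ L := fun ω ω' h h' =>
      ⟨G.dep_W ω ω' (fun e he => h e fun h' => Set.disjoint_left.1 G.W_disj_S he h') h'.1,
        G.dep_L ω ω' (fun e he => h e fun h' => Set.disjoint_left.1 G.L_disj_S he h') h'.2⟩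
    exact ⟨key ω ω' h, key ω' ω fun e he => (h e he).symm⟩
  refine ⟨avg (T \ S) (ind (A ∩ (W ∩ L))), fun ω => pr W * avg T (ind L) ω,
    fun ω ω' h => ?_, fun ω => mul_nonneg (pr_nonneg _) (avg_nonneg _ (ind_nonneg _) _),
    avg_nonneg _ (ind_nonneg _), fun ω => ?_, fun ω => ?_, fun ω => ?_, ?_, ?_⟩
  · dsimp only
    rw [((avg_indep T (ind L)).subset G.subset) ω ω' h]
  · rw [mul_assoc]
    refine mul_le_mul_of_nonneg_left ?_ (pr_nonneg _)
    have h1 := avg_harris T (G.mono_L'.monoF T) (G.mono_A.monoF T) ω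
    rw [← pr_eq_avg G.dep_L' ω, ← ind_inter] at h1
    refine h1.trans (avg_mono T (fun ω => ind_mono fun h => G.L_of_A h.symm) ω)
  · have h1 : avg (T \ S) (ind (A ∩ (W ∩ L))) ω ≤
        avg (T \ S) (fun ω => ind (Vp ∩ W) ω * ind L ω) ω := by
      refine avg_mono _ (fun ω => ?_) ω
      rw [← congrFun (ind_inter (Vp ∩ W) L) ω]
      exact ind_mono fun h => ⟨⟨G.Vp_of_W ⟨h.1, h.2.1⟩, h.2.1⟩, h.2.2⟩
    rw [avg_mul_of_disjoint _ (G.dep_Vp.inter G.dep_W).depF G.dep_L.depF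
      (Set.disjoint_union_left.2 ⟨G.Vp_disj_L, G.W_disj_L⟩), hRL] at h1
    have h2 := avg_harris' (T \ S) (G.mono_Vp.monoF _) (G.mono_W.monoF _) ω
    rw [hRW, ← ind_inter] at h2
    have h3 := avg_nonneg T (ind_nonneg L) ω
    nlinarith
  · rw [← avg_sdiff G.subset]
    have h1 : avg T (fun ω => ind W ω * ind (Vm ∩ L) ω) ω ≤ avg T (ind (A ∩ (W ∩ L))) ω := by
      refine avg_mono _ (fun ω => ?_) ω
      rw [← congrFun (ind_inter W (Vm ∩ L)) ω]
      exact ind_mono fun h => ⟨G.A_of_L h.2, h.1, h.2.2⟩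
    rw [avg_mul_of_disjoint _ G.dep_W.depF (G.dep_Vm.inter G.dep_L).depF
      (Set.disjoint_union_right.2 ⟨G.W_disj_Vm, G.W_disj_L⟩), ← pr_eq_avg hWT] at h1
    have h2 := avg_harris T (G.mono_Vm.monoF _) (G.mono_L.monoF _) ω
    rw [← pr_eq_avg hVT, ← ind_inter] at h2
    have h3 := mul_le_mul_of_nonneg_left h2 (pr_nonneg W)
    linarith
  · refine MonoF.avg ?_ _
    intro ω ω' h1 h2
    exact ind_mono fun h => ⟨G.mono_A ω ω' h2 h.1, (hWL ω ω' h1).1 h.2⟩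
  · have h : MonoF b S (avg (T \ S) (ind (A ∩ (W ∩ L)ᶜ))) := by
      refine MonoF.avg ?_ _
      intro ω ω' h1 h2
      exact ind_mono fun h => ⟨G.mono_A ω ω' h2 h.1, fun h' => h.2 ((hWL ω ω' h1).2 h')⟩
    convert h using 1
    funext ω
    rw [← avg_sub]
    congr 1
    funext ω
    by_cases h1 : ω ∈ A <;> by_cases h2 : ω ∈ W ∩ L <;>
      simp [ind, h1, h2]

open Classical in
lemma Gadget.step {b : Bool} {S T : Finset Edge} {A Vp Vm W L L' : Set Config}
    {Ep Em EW EL : Set Edge} (G : Gadget b S T A Vp Vm W L L' Ep Em EW EL)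
    {B Up Um X M M' : Set Config} {Fp Fm FX FM : Set Edge}
    (G' : Gadget (!b) S T B Up Um X M M' Fp Fm FX FM) {VS : Set Config} (hVS : Dep VS S)
    (h1 : Vm ⊆ VS) (h2 : VS ⊆ Vp) (h3 : Up ⊆ Vmᶜ) (h4 : Vpᶜ ⊆ Um) {p q η : ℝ}
    (hVpT : Ep ⊆ T) (hq0 : 0 ≤ q)
    (hp : p ≤ pr W * pr L') (hq : q ≤ pr X * pr M')
    (hη0 : 0 ≤ η) (hη : η ≤ pr Vm * (1 - pr Vp) - (pr Vp - pr Vm)) (ω : Config) :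
    avg S (fun ω => avg (T \ S) (ind A) ω * avg (T \ S) (ind B) ω) ω ≤
      (1 - p * q * η) * (avg T (ind A) ω * avg T (ind B) ω) := by
  obtain ⟨f, κ, k1, k2, f0, k3, k4, k5, k6, k7⟩ := G.half_step
  obtain ⟨g, l, l1, l2, g0, l3, l4, l5, l6, l7⟩ := G'.half_step
  set F := avg (T \ S) (ind A)
  set F' := avg (T \ S) (ind B)
  have eF : avg T (ind A) = avg S F := avg_sdiff G.subset _
  have eF' : avg T (ind B) = avg S F' := avg_sdiff G.subset _
  have a1 := avg_harris' S k6 l7 ω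
  have a2 := avg_harris' S k7 l6 ω
  have a3 := avg_harris' S k7 l7 ω
  have e0 : avg S (fun ω => F ω * F' ω) ω = avg S (fun ω => f ω * g ω) ω +
      avg S (fun ω => f ω * (F' ω - g ω)) ω + avg S (fun ω => (F ω - f ω) * g ω) ω +
      avg S (fun ω => (F ω - f ω) * (F' ω - g ω)) ω := by
    rw [← avg_add, ← avg_add, ← avg_add]
    congr 1
    funext ω
    ring
  rw [avg_sub] at a1 a2 a3
  rw [avg_sub] at a3
  have hVp : pr Vp = avg S (avg (T \ S) (ind Vp)) ω := by
    rw [← avg_sdiff G.subset, pr_eq_avg (G.dep_Vp.mono hVpT)]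
  have hVm : pr Vm = avg S (avg (T \ S) (ind Vm)) ω := by
    rw [← avg_sdiff G.subset, pr_eq_avg (G.dep_Vm.mono G.Vm_subset)]
  have hUm : 1 - pr Vp ≤ pr Um := by
    rw [← pr_compl (G.dep_Vp.mono hVpT)]; exact pr_mono h4
  have b1 : avg S (fun ω => f ω * g ω) ω ≤ κ ω * l ω * (pr Vp - pr Vm) := by
    rw [hVp, hVm, ← avg_sub, ← avg_mul_left (g := fun ω => κ ω * l ω) S (fun ω ω' h => by
      dsimp only; rw [k1 ω ω' h, l1 ω ω' h])]
    refine avg_mono S (fun ω => ?_) ω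
    have c1 : avg (T \ S) (ind Up) ω ≤ 1 - avg (T \ S) (ind Vm) ω := by
      have := avg_mono (T \ S) (f := ind Up) (g := ind Vmᶜ) (fun ω => ind_mono fun h => h3 h) ω
      rw [ind_compl, avg_sub, avg_const] at this
      exact this
    have c2 : avg (T \ S) (ind Vp) ω * (1 - avg (T \ S) (ind Vm) ω) =
        avg (T \ S) (ind Vp) ω - avg (T \ S) (ind Vm) ω := by
      have hi : Indep (T \ S) (ind VS) := hVS.depF.indep fun e he h => (Finset.mem_sdiff.1 he).2 h
      have d1 := avg_mono (T \ S) (f := ind Vm) (g := ind VS) (fun ω => ind_mono fun h => h1 h) ω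
      have d2 := avg_mono (T \ S) (f := ind VS) (g := ind Vp) (fun ω => ind_mono fun h => h2 h) ω
      have d3 := avg_le_one (T \ S) (ind_le_one Vp) ω
      have d4 := avg_nonneg (T \ S) (ind_nonneg Vm) ω
      rw [avg_of_indep _ hi] at d1 d2
      by_cases h : ω ∈ VS
      · rw [ind_of_mem h] at d2
        rw [le_antisymm d3 d2]; ring
      · rw [ind_of_notMem h] at d1
        rw [le_antisymm d1 d4]; ring
    have c3 := avg_nonneg (T \ S) (ind_nonneg Vp) ω
    calc f ω * g ω ≤ (κ ω * avg (T \ S) (ind Vp) ω) * (l ω * avg (T \ S) (ind Up) ω) :=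
          mul_le_mul (k4 ω) (l4 ω) (g0 ω) (mul_nonneg (k2 ω) c3)
      _ = κ ω * l ω * (avg (T \ S) (ind Vp) ω * avg (T \ S) (ind Up) ω) := by ring
      _ ≤ _ := by
        refine mul_le_mul_of_nonneg_left ?_ (mul_nonneg (k2 ω) (l2 ω))
        rw [← c2]
        exact mul_le_mul_of_nonneg_left c1 c3
  have b2 : κ ω * l ω * (pr Vm * (1 - pr Vp)) ≤ avg S f ω * avg S g ω := by
    have : l ω * (1 - pr Vp) ≤ avg S g ω :=
      (mul_le_mul_of_nonneg_left hUm (l2 ω)).trans (l5 ω)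
    calc _ = (κ ω * pr Vm) * (l ω * (1 - pr Vp)) := by ring
      _ ≤ _ := mul_le_mul (k5 ω) this (mul_nonneg (l2 ω) (by linarith [pr_le_one Vp]))
          (avg_nonneg _ f0 _)
  have hA := avg_nonneg T (ind_nonneg A) ω
  have hB := avg_nonneg T (ind_nonneg B) ω
  have b3 : p * q * (avg T (ind A) ω * avg T (ind B) ω) ≤ κ ω * l ω := by
    calc _ = (p * avg T (ind A) ω) * (q * avg T (ind B) ω) := by ring
      _ ≤ _ := mul_le_mul ((mul_le_mul_of_nonneg_right hp hA).trans (k3 ω))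
          ((mul_le_mul_of_nonneg_right hq hB).trans (l3 ω)) (mul_nonneg hq0 hB) (k2 ω)
  have b4 : p * q * (avg T (ind A) ω * avg T (ind B) ω) * η ≤
      κ ω * l ω * (pr Vm * (1 - pr Vp) - (pr Vp - pr Vm)) :=
    mul_le_mul b3 hη hη0 (mul_nonneg (k2 ω) (l2 ω))
  rw [e0, eF, eF']
  rw [eF, eF'] at b4
  nlinarith

end FKArm

namespace FKArm

lemma vnorm_le {v : Vertex} {n : ℤ} :
    vnorm v ≤ n ↔ (-n ≤ v.1 ∧ v.1 ≤ n) ∧ -n ≤ v.2 ∧ v.2 ≤ n := by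
  simp only [vnorm, max_le_iff, abs_le]

lemma le_vnorm {v : Vertex} {n : ℤ} :
    n ≤ vnorm v ↔ (n ≤ v.1 ∨ n ≤ -v.1) ∨ n ≤ v.2 ∨ n ≤ -v.2 := by
  simp only [vnorm, le_max_iff, le_abs]

lemma openAdj.vnorm_le {ω : Config} (u v : Vertex) (h : openAdj ω u v) :
    vnorm v ≤ vnorm u + 1 := by
  have h := h.nn
  have h1 := (FKArm.vnorm_le (v := u)).1 le_rfl
  rw [FKArm.vnorm_le]
  unfold FKArm.nn at h
  omega

lemma inside_disjoint {S T : Set Vertex} (h : ∀ v ∈ S, v ∉ T) : Disjoint (inside S) (inside T) :=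
  Set.disjoint_left.2 fun _ h1 h2 => h _ h1.1 h2.1

lemma Cn.join {ω : Config} {S T : Set Vertex} {a b c d : ℤ} {x y u v : Vertex} (h : Cn ω S x y)
    (h' : Cn ω T u v) (hxS : x ∈ S) (huT : u ∈ T) (hS : ∀ z ∈ S, c ≤ z.2 ∧ z.2 ≤ d)
    (hT : ∀ z ∈ T, a ≤ z.1 ∧ z.1 ≤ b)
    (hx : x.1 ≤ a) (hy : b ≤ y.1)  (hu : u.2 ≤ c) (hv : d ≤ v.2) : Cn ω Set.univ x u := by
  obtain ⟨z, -, -, h1, h2⟩ := Cn.cross hS hT h hxS hx hy h' huT hu hv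
  exact (h1.mono_set (Set.subset_univ _)).trans (Cn.symm (h2.mono_set (Set.subset_univ _)))

/-- The four crossings around the annulus of radii `p` and `q`. -/
def circ (p q : ℤ) : Set Config :=
  (H (-q) q p q ∩ H (-q) q (-q) (-p)) ∩ (V (-q) (-p) (-q) q ∩ V p q (-q) q)

lemma circ_mono (p q : ℤ) : Mono true (circ p q) :=
  ((H_mono _ _ _ _).inter (H_mono _ _ _ _)).inter ((V_mono _ _ _ _).inter (V_mono _ _ _ _))

lemma circ_dep {p q : ℤ} (hp : 0 ≤ p) :
    Dep (circ p q) (inside {v | p ≤ vnorm v ∧ vnorm v ≤ q}) := by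
  have key : ∀ {a b c d}, (∀ v ∈ rect a b c d, p ≤ vnorm v ∧ vnorm v ≤ q) →
    inside (rect a b c d) ⊆ inside {v | p ≤ vnorm v ∧ vnorm v ≤ q} := fun h => inside_mono h
  refine (((H_dep _ _ _ _).mono (key ?_)).inter_same ((H_dep _ _ _ _).mono (key ?_))).inter_same
    (((V_dep _ _ _ _).mono (key ?_)).inter_same ((V_dep _ _ _ _).mono (key ?_))) <;>
  · intro v hv
    simp only [mem_rect, le_vnorm, vnorm_le] at *
    omega

lemma circ_join {p q : ℤ} (hp : 0 ≤ p) (hpq : p ≤ q) {ω : Config} (hω : ω ∈ circ p q) :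
    ∃ z, ∀ x y, vnorm x ≤ p → q ≤ vnorm y → Cn ω Set.univ x y → Cn ω Set.univ x z := by
  obtain ⟨⟨⟨u1, v1, a1, b1, c1, d1, h1⟩, ⟨u2, v2, a2, b2, c2, d2, h2⟩⟩,
    ⟨u3, v3, a3, b3, c3, d3, h3⟩, ⟨u4, v4, a4, b4, c4, d4, h4⟩⟩ := hω
  have k1 : Cn ω Set.univ u1 u4 := Cn.join h1 h4 c1 c4 (fun z hz => hz.2) (fun z hz => hz.1)
    (by omega) (by omega) (by omega) (by omega)
  have k2 : Cn ω Set.univ u2 u4 := Cn.join h2 h4 c2 c4 (fun z hz => hz.2) (fun z hz => hz.1)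
    (by omega) (by omega) (by omega) (by omega)
  have k3 : Cn ω Set.univ u1 u3 := Cn.join h1 h3 c1 c3 (fun z hz => hz.2) (fun z hz => hz.1)
    (by omega) (by omega) (by omega) (by omega)
  refine ⟨u1, fun x y hx hy hxy => ?_⟩
  obtain ⟨x', y', -, -, hx', hy', hc, hxx, -⟩ :=
    hxy.extract vnorm openAdj.vnorm_le hpq trivial hx hy
  refine Relation.ReflTransGen.trans hxx ?_
  set S : Set Vertex := {v | v ∈ Set.univ ∧ p ≤ vnorm v ∧ vnorm v ≤ q}
  have hS : ∀ z ∈ S, (-q ≤ z.1 ∧ z.1 ≤ q) ∧ -q ≤ z.2 ∧ z.2 ≤ q := fun z hz => vnorm_le.1 hz.2.2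
  have hxS : x' ∈ S := ⟨trivial, hx'.ge, by omega⟩
  have hyS : y' ∈ S := ⟨trivial, by omega, hy'.le⟩
  have ex := vnorm_le.1 hx'.le
  have hc' := hc.mono_set (Set.subset_univ _)
  rcases le_vnorm.1 hy'.ge with (h | h) | (h | h)
  · exact (Cn.join hc h4 hxS c4 (fun z hz => (hS z hz).2) (fun z hz => hz.1)
      (by omega) (by omega) (by omega) (by omega)).trans (Cn.symm k1)
  · exact hc'.trans <| (Cn.join (Cn.symm hc) h3 hyS c3 (fun z hz => (hS z hz).2)
      (fun z hz => hz.1) (by omega) (by omega) (by omega) (by omega)).trans (Cn.symm k3)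
  · exact Cn.symm (Cn.join h1 hc c1 hxS (fun z hz => hz.2) (fun z hz => (hS z hz).1)
      (by omega) (by omega) (by omega) (by omega))
  · exact (hc'.trans (Cn.symm (Cn.join h2 (Cn.symm hc) c2 hyS (fun z hz => hz.2)
      (fun z hz => (hS z hz).1) (by omega) (by omega) (by omega) (by omega)))).trans
      (k2.trans (Cn.symm k1))

/-- Some vertex of `D` is joined to some vertex of `D'`. -/
def arm (D D' : Set Vertex) : Set Config := {ω | ∃ x ∈ D, ∃ y ∈ D', Cn ω Set.univ x y}

lemma arm_mono (D D' : Set Vertex) : Mono true (arm D D') :=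
  fun _ _ h ⟨x, hx, y, hy, hc⟩ => ⟨x, hx, y, hy, hc.congr fun e _ => h e⟩

/-- `D` is joined to distance `n` inside the ball of radius `n`. -/
def armIn (D : Set Vertex) (n : ℤ) : Set Config :=
  {ω | ∃ x ∈ D, ∃ y, vnorm y = n ∧ x ∈ {v | vnorm v ≤ n} ∧ Cn ω {v | vnorm v ≤ n} x y}

/-- Distance `n` is joined to `D'` outside the ball of radius `n`. -/
def armOut (D' : Set Vertex) (n : ℤ) : Set Config :=
  {ω | ∃ y ∈ D', ∃ x, vnorm x = n ∧ Cn ω {v | n ≤ vnorm v} x y}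

lemma armIn_mono (D : Set Vertex) (n : ℤ) : Mono true (armIn D n) :=
  fun _ _ h ⟨x, hx, y, hy, hxn, hc⟩ => ⟨x, hx, y, hy, hxn, hc.congr fun e _ => h e⟩

lemma armOut_mono (D : Set Vertex) (n : ℤ) : Mono true (armOut D n) :=
  fun _ _ h ⟨x, hx, y, hy, hc⟩ => ⟨x, hx, y, hy, hc.congr fun e _ => h e⟩

lemma armIn_dep (D : Set Vertex) (n : ℤ) : Dep (armIn D n) (inside {v | vnorm v ≤ n}) :=
  fun _ _ h ⟨x, hx, y, hy, hxn, hc⟩ => ⟨x, hx, y, hy, hxn, hc.congr fun e he => h e he ▸ id⟩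

lemma armOut_dep (D : Set Vertex) (n : ℤ) : Dep (armOut D n) (inside {v | n ≤ vnorm v}) :=
  fun _ _ h ⟨x, hx, y, hy, hc⟩ => ⟨x, hx, y, hy, hc.congr fun e he => h e he ▸ id⟩

lemma arm_subset_armIn {D D' : Set Vertex} {n : ℤ} (hD : ∀ v ∈ D, vnorm v ≤ n)
    (hD' : ∀ v ∈ D', n ≤ vnorm v) : arm D D' ⊆ armIn D n := by
  rintro ω ⟨x, hx, y, hy, h⟩
  obtain ⟨z, -, hz, h1, -⟩ := h.first_hit vnorm openAdj.vnorm_le trivial (hD x hx) (hD' y hy)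
  refine ⟨x, hx, z, hz, hD x hx, ?_⟩
  refine h1.mono_set ?_
  intro v hv
  exact hv.2

lemma arm_subset_armOut {D D' : Set Vertex} {n : ℤ} (hD : ∀ v ∈ D, vnorm v ≤ n)
    (hD' : ∀ v ∈ D', n ≤ vnorm v) : arm D D' ⊆ armOut D' n := by
  rintro ω ⟨x, hx, y, hy, h⟩
  obtain ⟨z, -, hz, h1, -⟩ := h.last_exit vnorm openAdj.vnorm_le trivial (hD x hx) (hD' y hy)
  refine ⟨y, hy, z, hz, ?_⟩
  refine h1.mono_set ?_
  intro v hv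
  exact hv.2

/-- The box `[a, b] × [c, d]` sits off centre at scale `t`, and `s` is a smaller scale. -/
structure Box (s t a b c d : ℤ) : Prop where
  hs : 4 ≤ s
  hst : s ≤ t
  ha : 16 * t ≤ a
  ha' : a ≤ 19 * t
  hb : 21 * t ≤ b
  hb' : b ≤ 24 * t
  hc : 16 * t ≤ c
  hc' : c ≤ 19 * t
  hd : 21 * t ≤ d
  hd' : d ≤ 24 * t

/-- The blocking event: an arm can only pass through the box. -/
def block (s t a b c d : ℤ) : Set Config :=
  (((V (-(30 * t)) (a - 1) c d)ᶜ ∩ (H (a - s) (a - 1) c d)ᶜ) ∩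
    ((V (b + 1) (30 * t) c d)ᶜ ∩ (H (b + 1) (b + s) c d)ᶜ)) ∩
  ((H (-(30 * t)) (-(28 * t)) (-(30 * t)) d)ᶜ ∩ ((H (28 * t) (30 * t) (-(30 * t)) d)ᶜ ∩
    (V (-(30 * t)) (30 * t) (-(30 * t)) (-(28 * t)))ᶜ))

/-- The linking event: the bottom and top of the box are joined to circuits. -/
def link (s t a b c d : ℤ) : Set Config :=
  (circ (12 * t) (14 * t) ∩ circ (40 * t) (44 * t)) ∩
  ((H (5 * t) b (c - s) (c - 1) ∩ V (5 * t) (6 * t) (12 * t) (c - 1)) ∩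
    (H a b (d + 1) (d + s) ∩ V (20 * t) (21 * t) (d + 1) (44 * t)))

variable {s t a b c d : ℤ}

lemma block_mono : Mono false (block s t a b c d) :=
  (((V_mono _ _ _ _).compl.inter (H_mono _ _ _ _).compl).inter
    ((V_mono _ _ _ _).compl.inter (H_mono _ _ _ _).compl)).inter
  ((H_mono _ _ _ _).compl.inter ((H_mono _ _ _ _).compl.inter (V_mono _ _ _ _).compl))

lemma link_mono : Mono true (link s t a b c d) :=
  ((circ_mono _ _).inter (circ_mono _ _)).inter
  (((H_mono _ _ _ _).inter (V_mono _ _ _ _)).inter ((H_mono _ _ _ _).inter (V_mono _ _ _ _)))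

/-- Vertices explored by the blocking event. -/
def blockR (t a b c d : ℤ) : Set Vertex :=
  {v | (12 * t ≤ vnorm v ∧ vnorm v ≤ 30 * t) ∧ ((c ≤ v.2 ∧ v.2 ≤ d ∧ (v.1 ≤ a - 1 ∨ b + 1 ≤ v.1)) ∨
    v.1 ≤ -(28 * t) ∨ 28 * t ≤ v.1 ∨ v.2 ≤ -(28 * t))}

/-- Vertices explored by the linking event. -/
def linkR (t b c d : ℤ) : Set Vertex :=
  {v | (12 * t ≤ vnorm v ∧ vnorm v ≤ 44 * t) ∧ (vnorm v ≤ 14 * t ∨ 40 * t ≤ vnorm v ∨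
    ((v.2 ≤ c - 1 ∨ d + 1 ≤ v.2) ∧ 12 * t ≤ v.2 ∧ 5 * t ≤ v.1 ∧ v.1 ≤ b))}

lemma block_dep (B : Box s t a b c d) : Dep (block s t a b c d) (inside (blockR t a b c d)) := by
  obtain ⟨h1, h2, h3, h4, h5, h6, h7, h8, h9, h10⟩ := B
  have key : ∀ {p q r u}, (∀ v ∈ rect p q r u, v ∈ blockR t a b c d) →
    inside (rect p q r u) ⊆ inside (blockR t a b c d) := fun h => inside_mono h
  refine ((((V_dep _ _ _ _).mono (key ?_)).compl.inter_same
    ((H_dep _ _ _ _).mono (key ?_)).compl).inter_same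
    (((V_dep _ _ _ _).mono (key ?_)).compl.inter_same
    ((H_dep _ _ _ _).mono (key ?_)).compl)).inter_same
    (((H_dep _ _ _ _).mono (key ?_)).compl.inter_same
    (((H_dep _ _ _ _).mono (key ?_)).compl.inter_same
    ((V_dep _ _ _ _).mono (key ?_)).compl)) <;>
  · intro v hv
    simp only [blockR, Set.mem_ofPred_eq, mem_rect, le_vnorm, vnorm_le] at *
    omega

lemma link_dep (B : Box s t a b c d) : Dep (link s t a b c d) (inside (linkR t b c d)) := by
  obtain ⟨h1, h2, h3, h4, h5, h6, h7, h8, h9, h10⟩ := B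
  have key : ∀ {p q r u}, (∀ v ∈ rect p q r u, v ∈ linkR t b c d) →
    inside (rect p q r u) ⊆ inside (linkR t b c d) := fun h => inside_mono h
  refine (((circ_dep (by omega)).mono (inside_mono ?_)).inter_same
    ((circ_dep (by omega)).mono (inside_mono ?_))).inter_same
    ((((H_dep _ _ _ _).mono (key ?_)).inter_same ((V_dep _ _ _ _).mono (key ?_))).inter_same
    (((H_dep _ _ _ _).mono (key ?_)).inter_same ((V_dep _ _ _ _).mono (key ?_)))) <;>
  · intro v hv
    simp only [linkR, Set.mem_ofPred_eq, mem_rect, le_vnorm, vnorm_le] at *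
    omega

lemma arm_block (B : Box s t a b c d) {D D' : Set Vertex} (hD : ∀ v ∈ D, vnorm v ≤ 12 * t)
    (hD' : ∀ v ∈ D', 44 * t ≤ vnorm v) :
    arm D D' ∩ block s t a b c d ⊆ V (a - s) (b + s) c d := by
  rintro ω ⟨⟨x, hx, y, hy, h⟩, ⟨⟨b1, b2⟩, b3, b4⟩, b5, b6, b7⟩
  have hx := vnorm_le.1 (hD x hx)
  have hy := le_vnorm.1 (hD' y hy)
  obtain ⟨h1, h2, h3, h4, h5, h6, h7, h8, h9, h10⟩ := B
  let φ : Vertex → ℤ := fun v => max (max (v.1 - 30 * t) (-v.1 - 30 * t))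
    (max (-v.2 - 30 * t) (v.2 - d))
  have hφ : ∀ v, φ v = max (max (v.1 - 30 * t) (-v.1 - 30 * t))
    (max (-v.2 - 30 * t) (v.2 - d)) := fun _ => rfl
  obtain ⟨z, -, hz, hc, -⟩ := h.first_hit (b := 0) φ (fun u v h => by
    have := h.nn; unfold FKArm.nn at this; rw [hφ, hφ]; omega) trivial
    (by rw [hφ]; omega) (by rw [hφ]; omega)
  set Q : Set Vertex := {v | v ∈ Set.univ ∧ φ v ≤ 0}
  have hQ : ∀ v ∈ Q, (-(30 * t) ≤ v.1 ∧ v.1 ≤ 30 * t) ∧ -(30 * t) ≤ v.2 ∧ v.2 ≤ d := by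
    intro v hv
    have := hv.2
    rw [hφ] at this
    omega
  have hxQ : x ∈ Q := ⟨trivial, by rw [hφ]; omega⟩
  have hzQ : z ∈ Q := ⟨trivial, hz.le⟩
  have hzd : d ≤ z.2 := by
    by_contra hzd
    rw [hφ] at hz
    have : z.1 = 30 * t ∨ z.1 = -(30 * t) ∨ z.2 = -(30 * t) := by omega
    rcases this with h | h | h
    · exact b6 (H_of_conn (by omega) (fun v hv _ _ => (hQ v hv).2) hxQ hc (by omega) (by omega))
    · exact b5 (H_of_conn (by omega) (fun v hv _ _ => (hQ v hv).2) hzQ (Cn.symm hc) (by omega)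
        (by omega))
    · exact b7 (V_of_conn (by omega) (fun v hv _ _ => (hQ v hv).1) hzQ (Cn.symm hc) (by omega)
        (by omega))
  obtain ⟨x', z', hx'Q, -, hx', hz', hc', -, -⟩ := hc.extract (fun v => v.2) openAdj.snd_le
    (a := c) (b := d) (by omega) hxQ (by omega) hzd
  set S : Set Vertex := {v | v ∈ Q ∧ c ≤ v.2 ∧ v.2 ≤ d}
  have hxS : x' ∈ S := ⟨hx'Q, by omega, by omega⟩
  have hS : ∀ v, Cn ω S x' v → v ∈ S := fun v hv => hv.mem hxS
  have left : ∀ u v, Cn ω S x' u → Cn ω S x' v → u.1 ≤ a - s → a - 1 ≤ v.1 → False := by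
    intro u v hu hv h1 h2
    exact b2 (H_of_conn (S := S) (by omega) (fun v hv _ _ => hv.2) (hS u hu)
      ((Cn.symm hu).trans hv) h1 h2)
  have right : ∀ u v, Cn ω S x' u → Cn ω S x' v → u.1 ≤ b + 1 → b + s ≤ v.1 → False := by
    intro u v hu hv h1 h2
    exact b4 (H_of_conn (S := S) (by omega) (fun v hv _ _ => hv.2) (hS u hu)
      ((Cn.symm hu).trans hv) h1 h2)
  have hr := hc'.reach
  by_cases hl : ∃ u, Cn ω S x' u ∧ u.1 ≤ a - s
  · obtain ⟨u, hu, hua⟩ := hl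
    refine (b1 (V_of_conn (by omega) (fun v hv _ _ => ?_) .refl hr hx'.le hz'.ge)).elim
    have : v.1 ≤ a - 1 := by
      by_contra h'
      exact left u v hu hv hua (by omega)
    have := hQ v (hS v hv).1
    omega
  by_cases hl' : ∃ v, Cn ω S x' v ∧ b + s ≤ v.1
  · obtain ⟨u, hu, hub⟩ := hl'
    refine (b3 (V_of_conn (by omega) (fun v hv _ _ => ?_) .refl hr hx'.le hz'.ge)).elim
    have : b + 1 ≤ v.1 := by
      by_contra h'
      exact right v u hv hu (by omega) hub
    have := hQ v (hS v hv).1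
    omega
  push Not at hl hl'
  refine V_of_conn (by omega) (fun v hv _ _ => ?_) .refl hr hx'.le hz'.ge
  have := hl v hv
  have := hl' v hv
  omega

lemma link_arm (B : Box s t a b c d) {D D' : Set Vertex} (hD : ∀ v ∈ D, vnorm v ≤ 12 * t)
    (hD' : ∀ v ∈ D', 44 * t ≤ vnorm v) :
    V a b (c - s) (d + s) ∩ ((armIn D (14 * t) ∩ armOut D' (40 * t)) ∩ link s t a b c d) ⊆
      arm D D' := by
  rintro ω ⟨⟨u, v, hu, hv, hum, hvm, huv⟩, ⟨⟨x, hx, x', hx', hxx, hI⟩, ⟨y, hy, y', hy', hO⟩⟩,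
    ⟨ci, co⟩, ⟨⟨u1, v1, a1, b1, c1, d1, h1⟩, ⟨u2, v2, a2, b2, c2, d2, h2⟩⟩,
    ⟨u3, v3, a3, b3, c3, d3, h3⟩, ⟨u4, v4, a4, b4, c4, d4, h4⟩⟩
  obtain ⟨i1, i2, i3, i4, i5, i6, i7, i8, i9, i10⟩ := B
  obtain ⟨z, hz⟩ := circ_join (by omega) (by omega) ci
  obtain ⟨w, hw⟩ := circ_join (by omega) (by omega) co
  have sub : ∀ S : Set Vertex, S ⊆ Set.univ := Set.subset_univ
  have k1 := hz x x' (hD x hx) hx'.ge (hI.mono_set (sub _))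
  have k2 := hz u2 v2 (by rw [vnorm_le]; simp only [mem_rect] at c2; omega)
    (by rw [le_vnorm]; omega) (h2.mono_set (sub _))
  have k3 := hw y' y hy'.le (hD' y hy) (hO.mono_set (sub _))
  have k4 := hw u4 v4 (by rw [vnorm_le]; simp only [mem_rect] at c4; omega)
    (by rw [le_vnorm]; omega) (h4.mono_set (sub _))
  have k5 : Cn ω Set.univ u1 u := Cn.join h1 huv c1 hum (fun z hz => hz.2) (fun z hz => hz.1)
    (by omega) (by omega) (by omega) (by omega)
  have k6 : Cn ω Set.univ u1 u2 := Cn.join h1 h2 c1 c2 (fun z hz => hz.2) (fun z hz => hz.1)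
    (by omega) (by omega) (by omega) (by omega)
  have k7 : Cn ω Set.univ u3 u := Cn.join h3 huv c3 hum (fun z hz => hz.2) (fun z hz => hz.1)
    (by omega) (by omega) (by omega) (by omega)
  have k8 : Cn ω Set.univ u3 u4 := Cn.join h3 h4 c3 c4 (fun z hz => hz.2) (fun z hz => hz.1)
    (by omega) (by omega) (by omega) (by omega)
  refine ⟨x, hx, y, hy, ?_⟩
  exact k1.trans <| (Cn.symm k2).trans <| (Cn.symm k6).trans <| k5.trans <| (Cn.symm k7).trans <|
    k8.trans <| k4.trans <| (Cn.symm k3).trans <| hO.mono_set (sub _)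

end FKArm

namespace FKArm

variable {s t a b c d : ℤ}

/-- Vertices explored by the linking event together with the two parts of the arm. -/
def linkX (t b c d : ℤ) : Set Vertex := {v | vnorm v ≤ 14 * t ∨ 40 * t ≤ vnorm v} ∪ linkR t b c d

lemma blockR_norm : inside (blockR t a b c d) ⊆ inside {v | 12 * t ≤ vnorm v ∧ vnorm v ≤ 44 * t} :=
  inside_mono fun v hv => by
    have := hv.1
    exact ⟨this.1, by have := vnorm_le (v := v) (n := vnorm v); omega⟩

lemma linkR_norm : inside (linkR t b c d) ⊆ inside {v | 12 * t ≤ vnorm v ∧ vnorm v ≤ 44 * t} :=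
  inside_mono fun _ hv => hv.1

lemma rect_norm {s' t' : ℤ} (B : Box s t a b c d) (hs : 0 ≤ s' ∧ s' ≤ s) (ht : 0 ≤ t' ∧ t' ≤ s) :
    inside (rect (a - s') (b + s') (c - t') (d + t')) ⊆
      inside {v | 12 * t ≤ vnorm v ∧ vnorm v ≤ 44 * t} := by
  obtain ⟨i1, i2, i3, i4, i5, i6, i7, i8, i9, i10⟩ := B
  refine inside_mono fun v hv => ?_
  rw [mem_rect] at hv
  rw [Set.mem_ofPred_eq, le_vnorm, vnorm_le]
  omega

lemma blockR_rect (B : Box s t a b c d) (v : Vertex) (hv : v ∈ blockR t a b c d) :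
    v ∉ rect a b (c - s) (d + s) := by
  obtain ⟨i1, i2, i3, i4, i5, i6, i7, i8, i9, i10⟩ := B
  simp only [blockR, Set.mem_ofPred_eq, mem_rect] at *
  omega

lemma linkX_rect (B : Box s t a b c d) (v : Vertex) (hv : v ∈ linkX t b c d) :
    v ∉ rect (a - s) (b + s) c d := by
  obtain ⟨i1, i2, i3, i4, i5, i6, i7, i8, i9, i10⟩ := B
  simp only [linkX, linkR, Set.mem_union, Set.mem_ofPred_eq, mem_rect, le_vnorm, vnorm_le] at *
  omega

lemma blockR_linkX (B : Box s t a b c d) (v : Vertex) (hv : v ∈ blockR t a b c d) :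
    v ∉ linkX t b c d := by
  obtain ⟨i1, i2, i3, i4, i5, i6, i7, i8, i9, i10⟩ := B
  simp only [blockR, linkX, linkR, Set.mem_union, Set.mem_ofPred_eq, le_vnorm, vnorm_le] at *
  omega

/-- The gadget for an open arm between `D` and `D'`. -/
lemma arm_gadget (B : Box s t a b c d) {D D' : Set Vertex} (hD : ∀ v ∈ D, vnorm v ≤ 12 * t)
    (hD' : ∀ v ∈ D', 44 * t ≤ vnorm v) {T : Finset Edge}
    (hT : inside {v | 12 * t ≤ vnorm v ∧ vnorm v ≤ 44 * t} ⊆ T) :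
    Gadget true (rectE a b c d) T (arm D D') (V (a - s) (b + s) c d) (V a b (c - s) (d + s))
      (block s t a b c d) ((armIn D (14 * t) ∩ armOut D' (40 * t)) ∩ link s t a b c d)
      (link s t a b c d) (inside (rect (a - s) (b + s) c d)) (inside (rect a b (c - s) (d + s)))
      (inside (blockR t a b c d)) (inside (linkX t b c d)) := by
  have hs : 4 ≤ s := B.hs
  have hst : s ≤ t := B.hst
  have r0 := (rect_norm B (s' := 0) (t' := 0) (by omega) (by omega)).trans hT
  have r2 := (rect_norm B (s' := 0) (t' := s) (by omega) (by omega)).trans hT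
  simp only [sub_zero, add_zero] at r0 r2
  have sub1 : rect a b c d ⊆ rect (a - s) (b + s) c d :=
    rect_subset (by omega) (by omega) (by omega) (by omega)
  have sub2 : rect a b c d ⊆ rect a b (c - s) (d + s) :=
    rect_subset (by omega) (by omega) (by omega) (by omega)
  exact {
    subset := fun e he => r0 (mem_rectE.1 he)
    mono_A := arm_mono _ _
    mono_Vp := V_mono _ _ _ _
    mono_Vm := V_mono _ _ _ _
    mono_W := block_mono
    mono_L := ((armIn_mono _ _).inter (armOut_mono _ _)).inter link_mono
    mono_L' := link_mono
    dep_Vp := V_dep _ _ _ _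
    dep_Vm := V_dep _ _ _ _
    dep_W := block_dep B
    dep_L := (((armIn_dep _ _).mono (inside_mono fun v hv => .inl (.inl hv))).inter_same
      ((armOut_dep _ _).mono (inside_mono fun v hv => .inl (.inr hv)))).inter_same
      ((link_dep B).mono (inside_mono fun v hv => .inr hv))
    dep_L' := (link_dep B).mono (linkR_norm.trans hT)
    W_subset := blockR_norm.trans hT
    Vm_subset := r2
    W_disj_S := by
      rw [coe_rectE]
      exact inside_disjoint fun v hv h => blockR_rect B v hv (sub2 h)
    L_disj_S := by
      rw [coe_rectE]
      exact inside_disjoint fun v hv h => linkX_rect B v hv (sub1 h)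
    W_disj_Vm := inside_disjoint (blockR_rect B)
    W_disj_L := inside_disjoint (blockR_linkX B)
    Vp_disj_L := (inside_disjoint (linkX_rect B)).symm
    Vp_of_W := arm_block B hD hD'
    A_of_L := link_arm B hD hD'
    L_of_A := fun ω h => ⟨⟨arm_subset_armIn (fun v hv => (hD v hv).trans (by omega))
      (fun v hv => le_trans (by omega) (hD' v hv)) h.1,
      arm_subset_armOut (fun v hv => (hD v hv).trans (by omega))
      (fun v hv => le_trans (by omega) (hD' v hv)) h.1⟩, h.2⟩ }

/-- Duality composed with the reflection in the diagonal. -/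
def thetaE : Edge ≃ Edge := swapE.trans dualE

/-- The dual configuration reflected in the diagonal. -/
def theta (ω : Config) : Config := swapC (dualC ω)

lemma act_thetaE (ω : Config) : act thetaE (fun _ => true) ω = theta ω := by
  funext e; simp [act, theta, swapC, dualC, thetaE]

lemma theta_mono {A : Set Config} {b : Bool} (h : Mono b A) : Mono (!b) (theta ⁻¹' A) := by
  intro ω ω' hh hA
  refine h _ _ (fun e he => ?_) hA
  have := bool_imp_not (hh (thetaE e))
  simp only [theta, swapC, dualC, thetaE, Equiv.trans_apply, Bool.not_not] at *
  revert this he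
  cases ω (dualE (swapE e)) <;> cases ω' (dualE (swapE e)) <;> cases b <;> simp

lemma theta_dep {A : Set Config} {E : Set Edge} (h : Dep A E) :
    Dep (theta ⁻¹' A) (thetaE '' E) := by
  intro ω ω' hh hA
  refine h _ _ (fun e he => ?_) hA
  exact congrArg (fun x => !x) (hh _ ⟨e, he, rfl⟩)

lemma pr_theta {A : Set Config} {T : Finset Edge} (hA : Dep A T) : pr (theta ⁻¹' A) = pr A := by
  rw [← pr_act thetaE (fun _ => true) hA.measurableSet]
  congr 1
  ext ω
  rw [Set.mem_preimage, Set.mem_preimage, act_thetaE]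

lemma Gadget.theta {b : Bool} {S₀ T₀ S T : Finset Edge} {A Vp Vm W L L' : Set Config}
    {Ep Em EW EL : Set Edge} (G : Gadget b S₀ T₀ A Vp Vm W L L' Ep Em EW EL) (hST : S ⊆ T)
    (hT : thetaE '' T₀ ⊆ T) (h1 : Disjoint (thetaE '' EW) S) (h2 : Disjoint (thetaE '' EL) S) :
    Gadget (!b) S T (theta ⁻¹' A) (theta ⁻¹' Vp) (theta ⁻¹' Vm) (theta ⁻¹' W) (theta ⁻¹' L)
      (theta ⁻¹' L') (thetaE '' Ep) (thetaE '' Em) (thetaE '' EW) (thetaE '' EL) where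
  subset := hST
  mono_A := theta_mono G.mono_A
  mono_Vp := theta_mono G.mono_Vp
  mono_Vm := theta_mono G.mono_Vm
  mono_W := theta_mono G.mono_W
  mono_L := theta_mono G.mono_L
  mono_L' := theta_mono G.mono_L'
  dep_Vp := theta_dep G.dep_Vp
  dep_Vm := theta_dep G.dep_Vm
  dep_W := theta_dep G.dep_W
  dep_L := theta_dep G.dep_L
  dep_L' := (theta_dep G.dep_L').mono hT
  W_subset := (Set.image_mono G.W_subset).trans hT
  Vm_subset := (Set.image_mono G.Vm_subset).trans hT
  W_disj_S := h1
  L_disj_S := h2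
  W_disj_Vm := (Set.disjoint_image_iff thetaE.injective).2 G.W_disj_Vm
  W_disj_L := (Set.disjoint_image_iff thetaE.injective).2 G.W_disj_L
  Vp_disj_L := (Set.disjoint_image_iff thetaE.injective).2 G.Vp_disj_L
  Vp_of_W := fun _ h => G.Vp_of_W h
  A_of_L := fun _ h => G.A_of_L h
  L_of_A := fun _ h => G.L_of_A h

lemma thetaE_disjoint {R : Set Vertex} (hcd : c < d) (h : ∀ v ∈ R, v ∉ rect c (d - 1) (a - 1) b) :
    Disjoint (thetaE '' inside R) (rectE a b c d) := by
  rw [coe_rectE, Set.disjoint_left]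
  rintro _ ⟨⟨⟨x, y⟩, o⟩, he, rfl⟩ h'
  have h1 := h _ he.1
  have h2 := h _ he.2
  rw [inside] at h'
  cases o <;> simp [thetaE, swapE, dualE, ends, rect] at h1 h2 h' <;> omega

lemma thetaE_norm {p q p' q' : ℤ} (hp : p' < p) (hq : q < q') :
    thetaE '' inside {v | p ≤ vnorm v ∧ vnorm v ≤ q} ⊆
      inside {v | p' ≤ vnorm v ∧ vnorm v ≤ q'} := by
  rintro _ ⟨⟨⟨x, y⟩, o⟩, he, rfl⟩
  rw [inside] at *
  cases o <;> simp [thetaE, swapE, dualE, ends, le_vnorm, vnorm_le] at he ⊢ <;> omega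

/-- The increasing or decreasing local event `A` has probability at least `x`. -/
structure Lower (b : Bool) (x : ℝ) (A : Set Config) : Prop where
  fin : ∃ T : Finset Edge, Dep A T
  mono : Mono b A
  nonneg : 0 ≤ x
  le : x ≤ pr A

lemma Lower.inter {b : Bool} {x y : ℝ} {A B : Set Config} (hA : Lower b x A) (hB : Lower b y B) :
    Lower b (x * y) (A ∩ B) := by
  classical
  obtain ⟨S, hS⟩ := hA.fin
  obtain ⟨T, hT⟩ := hB.fin
  exact ⟨⟨S ∪ T, by simpa using hS.inter hT⟩, hA.mono.inter hB.mono,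
    mul_nonneg hA.nonneg hB.nonneg,
    (mul_le_mul hA.le hB.le hB.nonneg (pr_nonneg _)).trans (pr_harris_up hS hT hA.mono hB.mono)⟩

lemma lower_H (k : ℕ) {a b c d : ℤ} (hab : a ≤ b) (hk : b - a ≤ k * (d - c)) (hcd : 2 ≤ d - c) :
    Lower true (rho k) (H a b c d) :=
  ⟨⟨_, H_depE _ _ _ _⟩, H_mono _ _ _ _, (rho_pos k).le, rho_le_pr_H k hab hk hcd⟩

lemma lower_V (k : ℕ) {a b c d : ℤ} (hcd : c ≤ d) (hk : d - c ≤ k * (b - a)) (hab : 2 ≤ b - a) :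
    Lower true (rho k) (V a b c d) :=
  ⟨⟨_, V_depE _ _ _ _⟩, V_mono _ _ _ _, (rho_pos k).le, rho_le_pr_V k hcd hk hab⟩

lemma lower_not_H (k : ℕ) {a b c d : ℤ} (hcd : c ≤ d + 1) (hk : d - c + 1 ≤ k * (b - 1 - a))
    (hab : 2 ≤ b - 1 - a) : Lower false (rho k) (H a b c d)ᶜ := by
  refine ⟨⟨_, (H_depE _ _ _ _).compl⟩, (H_mono _ _ _ _).compl, (rho_pos k).le, ?_⟩
  refine (rho_le_pr_V k (c := c - 1) (d := d) (by omega) (by linarith) hab).trans ?_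
  rw [← pr_dual (V_depE _ _ _ _)]
  exact pr_mono fun ω h => not_H_of_dual_V h

lemma lower_not_V (k : ℕ) {a b c d : ℤ} (hab : a ≤ b + 1) (hk : b - a + 1 ≤ k * (d - 1 - c))
    (hcd : 2 ≤ d - 1 - c) : Lower false (rho k) (V a b c d)ᶜ := by
  refine ⟨⟨_, (V_depE _ _ _ _).compl⟩, (V_mono _ _ _ _).compl, (rho_pos k).le, ?_⟩
  refine (rho_le_pr_H k (a := a - 1) (b := b) (by omega) (by linarith) hcd).trans ?_
  rw [← pr_dual (H_depE _ _ _ _)]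
  exact pr_mono fun ω h => not_V_of_dual_H h

lemma lower_circ (k : ℕ) {p q : ℤ} (hp : 0 ≤ p) (hq : 2 ≤ q - p) (hk : 2 * q ≤ k * (q - p)) :
    Lower true ((rho k * rho k) * (rho k * rho k)) (circ p q) :=
  ((lower_H k (by omega) (by linarith) (by omega)).inter
    (lower_H k (by omega) (by linarith) (by omega))).inter
  ((lower_V k (by omega) (by linarith) (by omega)).inter
    (lower_V k (by omega) (by linarith) (by omega)))

lemma lower_block {J : ℕ} (hJ : 1 ≤ J) (B : Box s t a b c d) (ht : t = J * s) :
    rho (100 * J) ^ 7 ≤ pr (block s t a b c d) := by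
  obtain ⟨i1, i2, i3, i4, i5, i6, i7, i8, i9, i10⟩ := B
  have hJ' : (1 : ℤ) ≤ J := by exact_mod_cast hJ
  have big : ∀ x y : ℤ, x ≤ 70 * t → t ≤ y → x ≤ ((100 * J : ℕ) : ℤ) * y := fun x y h1 h2 => by
    push_cast; nlinarith
  have small : ∀ x y : ℤ, x ≤ 40 * t → s ≤ 2 * y → x ≤ ((100 * J : ℕ) : ℤ) * y :=
    fun x y h1 h2 => by push_cast; nlinarith
  have := ((((lower_not_V (100 * J) (a := -(30 * t)) (b := a - 1) (c := c) (d := d) (by omega)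
      (big _ _ (by omega) (by omega)) (by omega)).inter
    (lower_not_H (100 * J) (a := a - s) (b := a - 1) (c := c) (d := d) (by omega)
      (small _ _ (by omega) (by omega)) (by omega))).inter
    ((lower_not_V (100 * J) (a := b + 1) (b := 30 * t) (c := c) (d := d) (by omega)
      (big _ _ (by omega) (by omega)) (by omega)).inter
    (lower_not_H (100 * J) (a := b + 1) (b := b + s) (c := c) (d := d) (by omega)
      (small _ _ (by omega) (by omega)) (by omega)))).inter
    ((lower_not_H (100 * J) (a := -(30 * t)) (b := -(28 * t)) (c := -(30 * t)) (d := d) (by omega)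
      (big _ _ (by omega) (by omega)) (by omega)).inter
    ((lower_not_H (100 * J) (a := 28 * t) (b := 30 * t) (c := -(30 * t)) (d := d) (by omega)
      (big _ _ (by omega) (by omega)) (by omega)).inter
    (lower_not_V (100 * J) (a := -(30 * t)) (b := 30 * t) (c := -(30 * t)) (d := -(28 * t))
      (by omega) (big _ _ (by omega) (by omega)) (by omega))))).le
  refine le_trans (le_of_eq ?_) this
  ring

lemma lower_link {J : ℕ} (hJ : 1 ≤ J) (B : Box s t a b c d) (ht : t = J * s) :
    rho (100 * J) ^ 12 ≤ pr (link s t a b c d) := by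
  obtain ⟨i1, i2, i3, i4, i5, i6, i7, i8, i9, i10⟩ := B
  have hJ' : (1 : ℤ) ≤ J := by exact_mod_cast hJ
  have big : ∀ x y : ℤ, x ≤ 100 * t → t ≤ y → x ≤ ((100 * J : ℕ) : ℤ) * y := fun x y h1 h2 => by
    push_cast; nlinarith
  have small : ∀ x y : ℤ, x ≤ 40 * t → s ≤ 2 * y → x ≤ ((100 * J : ℕ) : ℤ) * y :=
    fun x y h1 h2 => by push_cast; nlinarith
  have := (((lower_circ (100 * J) (p := 12 * t) (q := 14 * t) (by omega) (by omega)
      (big _ _ (by omega) (by omega))).inter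
    (lower_circ (100 * J) (p := 40 * t) (q := 44 * t) (by omega) (by omega)
      (big _ _ (by omega) (by omega)))).inter
    (((lower_H (100 * J) (a := 5 * t) (b := b) (c := c - s) (d := c - 1) (by omega)
      (small _ _ (by omega) (by omega)) (by omega)).inter
    (lower_V (100 * J) (a := 5 * t) (b := 6 * t) (c := 12 * t) (d := c - 1) (by omega)
      (big _ _ (by omega) (by omega)) (by omega))).inter
    ((lower_H (100 * J) (a := a) (b := b) (c := d + 1) (d := d + s) (by omega)
      (small _ _ (by omega) (by omega)) (by omega)).inter
    (lower_V (100 * J) (a := 20 * t) (b := 21 * t) (c := d + 1) (d := 44 * t) (by omega)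
      (big _ _ (by omega) (by omega)) (by omega))))).le
  refine le_trans (le_of_eq ?_) this
  ring

open Classical in
/-- Conditioning on the edges of a box gains a constant factor over the product. -/
lemma box_step {J : ℕ} (hJ : 1 ≤ J) (B : Box s t a b c d) (B' : Box s t c (d - 1) (a - 1) b)
    (ht : t = J * s) {D D' E E' : Set Vertex} (hD : ∀ v ∈ D, vnorm v ≤ 12 * t)
    (hD' : ∀ v ∈ D', 44 * t ≤ vnorm v) (hE : ∀ v ∈ E, vnorm v ≤ 12 * t)
    (hE' : ∀ v ∈ E', 44 * t ≤ vnorm v) {T : Finset Edge}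
    (hT : inside {v | 12 * t - 1 ≤ vnorm v ∧ vnorm v ≤ 44 * t + 1} ⊆ T) {η : ℝ} (hη0 : 0 ≤ η)
    (hη : η ≤ pr (V a b (c - s) (d + s)) * (1 - pr (V (a - s) (b + s) c d)) -
      (pr (V (a - s) (b + s) c d) - pr (V a b (c - s) (d + s)))) (ω : Config) :
    avg (rectE a b c d) (fun ω => avg (T \ rectE a b c d) (ind (arm D D')) ω *
      avg (T \ rectE a b c d) (ind (theta ⁻¹' arm E E')) ω) ω ≤
      (1 - rho (100 * J) ^ 38 * η) *
        (avg T (ind (arm D D')) ω * avg T (ind (theta ⁻¹' arm E E')) ω) := by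
  have hs : 4 ≤ s := B.hs
  have hst : s ≤ t := B.hst
  have hT' : inside {v | 12 * t ≤ vnorm v ∧ vnorm v ≤ 44 * t} ⊆ (T : Set Edge) :=
    (inside_mono (by
      intro v hv
      exact ⟨by linarith [hv.1], by linarith [hv.2]⟩)).trans hT
  have G := arm_gadget B hD hD' hT'
  obtain ⟨T₀, hT₀⟩ : ∃ T₀ : Finset Edge, (T₀ : Set Edge) =
      inside {v | 12 * t ≤ vnorm v ∧ vnorm v ≤ 44 * t} :=
    ⟨T.filter fun e => e ∈ inside {v | 12 * t ≤ vnorm v ∧ vnorm v ≤ 44 * t}, by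
      ext e
      rw [Finset.mem_coe, Finset.mem_filter]
      exact ⟨fun h => h.2, fun h => ⟨hT' h, h⟩⟩⟩
  have hcd : c < d := by have := B.hc'; have := B.hd; omega
  have hab : a < b := by have := B.ha'; have := B.hb; omega
  have G' := (arm_gadget B' hE hE' hT₀.ge).theta (S := rectE a b c d) (T := T) G.subset
    (by rw [hT₀]; exact (thetaE_norm (by omega) (by omega)).trans hT)
    (thetaE_disjoint hcd fun v hv h => blockR_rect B' v hv
      (rect_subset (by omega) (by omega) (by omega) (by omega) h))
    (thetaE_disjoint hcd fun v hv h => linkX_rect B' v hv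
      (rect_subset (by omega) (by omega) (by omega) (by omega) h))
  have hρ := rho_pos (100 * J)
  have hlow : ∀ {a b c d : ℤ}, Box s t a b c d →
      rho (100 * J) ^ 19 ≤ pr (block s t a b c d) * pr (link s t a b c d) := fun B => by
    calc rho (100 * J) ^ 19 = rho (100 * J) ^ 7 * rho (100 * J) ^ 12 := by ring
      _ ≤ _ := mul_le_mul (lower_block hJ B ht) (lower_link hJ B ht) (by positivity) (pr_nonneg _)
  have key := Gadget.step G G' (VS := V a b c d) (p := rho (100 * J) ^ 19)
    (q := rho (100 * J) ^ 19) (V_depE _ _ _ _)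
    (V_subset le_rfl le_rfl (by omega) (by omega) hcd.le)
    (V_subset (by omega) (by omega) le_rfl le_rfl hcd.le)
    (fun ω h => ?_) (fun ω h => ?_)
    ?_ (by positivity) (hlow B) ?_ hη0 hη ω
  · refine key.trans (le_of_eq ?_)
    ring
  · apply not_V_of_dual_H
    rw [← swapC_mem_V, show d + s - 1 = d - 1 + s by ring]
    exact h
  · have := dual_H_of_not_V (by omega) hcd h
    rw [← swapC_mem_V, show a - s - 1 = a - 1 - s by ring] at this
    exact this
  · have := rect_norm B (s' := s) (t' := 0) (by omega) (by omega)
    rw [sub_zero, add_zero] at this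
    exact this.trans hT'
  · rw [pr_theta ((block_dep B').mono (blockR_norm.trans hT₀.ge)),
      pr_theta ((link_dep B').mono (linkR_norm.trans hT₀.ge))]
    exact hlow B'

end FKArm

namespace FKArm

lemma A1_eq_arm {r R : ℤ} (h : r ≤ R) : A1 r R = arm {v | vnorm v ≤ r} {v | R ≤ vnorm v} := by
  ext ω
  constructor
  · rintro ⟨x, y, hx, hy, hc⟩
    exact ⟨x, hx.le, y, hy.ge, hc.mono_set (Set.subset_univ _)⟩
  · rintro ⟨x, hx, y, hy, hc⟩
    obtain ⟨x', y', -, -, hx', hy', h', -, -⟩ :=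
      hc.extract vnorm openAdj.vnorm_le h trivial hx hy
    refine ⟨x', y', hx', hy', h'.mono_set ?_⟩
    intro v hv
    exact hv.2

lemma dnorm2_swap (v : Vertex) : dnorm2 v.swap = dnorm2 v := by simp [dnorm2, max_comm]

lemma dnorm2_le {v : Vertex} {n : ℤ} :
    dnorm2 v ≤ 2 * n + 1 ↔ (-n - 1 ≤ v.1 ∧ v.1 ≤ n) ∧ -n - 1 ≤ v.2 ∧ v.2 ≤ n := by
  simp only [dnorm2, max_le_iff, abs_le]
  omega

/-- The index of the square layer of a dual vertex. -/
def layer (v : Vertex) : ℤ := (dnorm2 v - 1) / 2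

lemma dnorm2_eq (v : Vertex) : dnorm2 v = 2 * layer v + 1 := by
  have h1 : ∀ x : ℤ, |x| = x ∨ |x| = -x := abs_choice
  have := h1 (2 * v.1 + 1)
  have := h1 (2 * v.2 + 1)
  unfold layer dnorm2
  omega

lemma layer_le {v : Vertex} {n : ℤ} :
    layer v ≤ n ↔ (-n - 1 ≤ v.1 ∧ v.1 ≤ n) ∧ -n - 1 ≤ v.2 ∧ v.2 ≤ n := by
  rw [← dnorm2_le, dnorm2_eq]
  omega

lemma openAdj.layer_le {ω : Config} (u v : Vertex) (h : openAdj ω u v) :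
    layer v ≤ layer u + 1 := by
  have h := h.nn
  have h1 := (FKArm.layer_le (v := u)).1 le_rfl
  rw [FKArm.layer_le]
  unfold FKArm.nn at h
  omega

lemma A0_eq_arm {r R : ℤ} (h : r < R) : A0 r R =
    theta ⁻¹' arm {v | layer v ≤ r} {v | R - 1 ≤ layer v} := by
  have hs : ∀ v : Vertex, layer v.swap = layer v := fun v => by simp only [layer, dnorm2_swap]
  ext ω
  constructor
  · rintro ⟨x, y, hx, hy, hc⟩
    rw [dnorm2_eq] at hx hy
    refine ⟨x.swap, ?_, y.swap, ?_, ?_⟩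
    · rw [Set.mem_ofPred_eq, hs]; omega
    · rw [Set.mem_ofPred_eq, hs]; omega
    · refine hc.map (fun u v huv => swapC_adj _ _ _ ?_) fun _ _ => trivial
      rw [theta, swapC_swapC]
      exact (dualAdj_iff ω u v).1 huv
  · rintro ⟨x, hx, y, hy, hc⟩
    obtain ⟨x', y', -, -, hx', hy', h', -, -⟩ :=
      hc.extract layer openAdj.layer_le (a := r) (b := R - 1) (by omega) trivial hx hy
    refine ⟨x'.swap, y'.swap, ?_, ?_, h'.map (φ := Prod.swap) (fun u v huv => ?_) ?_⟩
    · rw [dnorm2_eq, hs]; omega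
    · rw [dnorm2_eq, hs]; omega
    · exact (dualAdj_iff ω _ _).2 (swapC_adj _ _ _ huv)
    · intro v hv
      rw [Set.mem_ofPred_eq, dnorm2_eq, hs]
      have := hv.2
      omega

lemma A1_dep {r R N : ℤ} (hN : R ≤ N) : Dep (A1 r R) (rectE (-N) N (-N) N) := by
  rw [coe_rectE]
  rintro ω ω' h ⟨x, y, hx, hy, hc⟩
  refine ⟨x, y, hx, hy, Cn.congr hc fun e he => ?_⟩
  rw [h e]
  · exact id
  · refine inside_mono ?_ he
    intro v hv
    exact vnorm_le.1 (hv.2.trans hN)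

lemma A0_dep {r R N : ℤ} (hN : R < N) : Dep (A0 r R) (rectE (-N) N (-N) N) := by
  rw [coe_rectE]
  rintro ω ω' h ⟨x, y, hx, hy, hc⟩
  refine ⟨x, y, hx, hy, Relation.ReflTransGen.mono ?_ _ _ hc⟩
  rintro u v ⟨⟨e, he, huv⟩, hu, hv⟩
  refine ⟨⟨e, ?_, huv⟩, hu, hv⟩
  rw [← h e ?_, he]
  have hu := dnorm2_le.1 hu.2
  have hv := dnorm2_le.1 hv.2
  rcases e with ⟨⟨p, q⟩, o⟩
  simp only [inside, rect, Set.mem_ofPred_eq]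
  cases o <;> rcases huv with ⟨rfl, rfl⟩ | ⟨rfl, rfl⟩ <;> simp [dualEnds, ends] at * <;> omega

/-- Among boxes of intermediate shapes, one has crossing probabilities that barely change under
a perturbation of the box. -/
lemma exists_good_box {J : ℕ} (hJ : 4 / rho 11 ^ 2 ≤ J) (hJ1 : 1 ≤ J) {s t : ℤ} (hs : 4 ≤ s)
    (ht : t = J * s) : ∃ a b c d : ℤ, Box s t a b c d ∧ Box s t c (d - 1) (a - 1) b ∧
      rho 11 ^ 2 / 2 ≤ pr (V a b (c - s) (d + s)) * (1 - pr (V (a - s) (b + s) c d)) -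
        (pr (V (a - s) (b + s) c d) - pr (V a b (c - s) (d + s))) := by
  let q : ℕ → ℝ := fun j => pr (V (19 * t - j * s) (21 * t + j * s) (17 * t + j * s)
    (23 * t - j * s))
  have hsum : ∀ n, ∑ j ∈ Finset.range n, (q (j + 2) - q j) = q (n + 1) + q n - q 1 - q 0 := by
    intro n
    induction n with
    | zero => simp
    | succ n ih => rw [Finset.sum_range_succ, ih]; ring
  have hρ := rho_pos 11
  have hJ0 : (0 : ℝ) < J := by exact_mod_cast hJ1
  obtain ⟨j, hj, hq⟩ : ∃ j ∈ Finset.range J, q (j + 2) - q j ≤ 2 / J := by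
    by_contra! hcon
    have h1 := Finset.sum_lt_sum_of_nonempty (Finset.nonempty_range_iff.2 (by omega)) hcon
    rw [hsum, Finset.sum_const, Finset.card_range, nsmul_eq_mul, mul_div_cancel₀ _ hJ0.ne'] at h1
    have h2 := pr_le_one (V (19 * t - (J + 1 : ℕ) * s) (21 * t + (J + 1 : ℕ) * s)
      (17 * t + (J + 1 : ℕ) * s) (23 * t - (J + 1 : ℕ) * s))
    have h3 : q (J + 1) ≤ 1 := h2
    have h4 : q J ≤ 1 := pr_le_one _
    have h5 : 0 ≤ q 1 := pr_nonneg _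
    have h6 : 0 ≤ q 0 := pr_nonneg _
    linarith
  rw [Finset.mem_range] at hj
  obtain ⟨m, hm⟩ : ∃ m : ℤ, m = (j + 1 : ℕ) * s := ⟨_, rfl⟩
  have hm1 : s ≤ m := by rw [hm]; push_cast; nlinarith
  have hm2 : m ≤ t := by
    rw [hm, ht]
    exact mul_le_mul_of_nonneg_right (by exact_mod_cast hj) (by omega)
  have ej : (j : ℤ) * s = m - s := by rw [hm]; push_cast; ring
  have ej2 : ((j + 2 : ℕ) : ℤ) * s = m + s := by rw [hm]; push_cast; ring
  have hst : s ≤ t := hm1.trans hm2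
  have k1 : pr (V (19 * t - m - s) (21 * t + m + s) (17 * t + m) (23 * t - m)) ≤ q (j + 2) := by
    refine pr_mono (V_subset ?_ ?_ ?_ ?_ ?_) <;> rw [ej2] <;> omega
  have k2 : q j ≤ pr (V (19 * t - m) (21 * t + m) (17 * t + m - s) (23 * t - m + s)) := by
    refine pr_mono (V_subset ?_ ?_ ?_ ?_ ?_) <;> (try rw [ej]) <;> omega
  have k3 : rho 11 ≤ pr (V (19 * t - m) (21 * t + m) (17 * t + m - s) (23 * t - m + s)) :=
    rho_le_pr_V 11 (by omega) (by push_cast; omega) (by omega)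
  have k4 := (lower_not_V 11 (a := 19 * t - m - s) (b := 21 * t + m + s) (c := 17 * t + m)
    (d := 23 * t - m) (by omega) (by push_cast; omega) (by omega)).le
  rw [pr_compl (V_depE _ _ _ _)] at k4
  refine ⟨19 * t - m, 21 * t + m, 17 * t + m, 23 * t - m, by constructor <;> omega,
    by constructor <;> omega, ?_⟩
  have h1 : 2 / (J : ℝ) ≤ rho 11 ^ 2 / 2 := by
    rw [div_le_iff₀ (by positivity)] at hJ
    rw [div_le_iff₀ hJ0]
    linarith
  have h2 := mul_le_mul k3 k4 hρ.le (pr_nonneg _)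
  nlinarith

/-- The gain obtained at each scale. -/
noncomputable def gain (J : ℕ) : ℝ := rho (100 * J) ^ 38 * (rho 11 ^ 2 / 2)

lemma gain_pos (J : ℕ) : 0 < gain J := by
  have := rho_pos (100 * J)
  have := rho_pos 11
  unfold gain
  positivity

lemma gain_lt_one (J : ℕ) : gain J < 1 := by
  have h1 := pow_le_one₀ (n := 38) (rho_pos (100 * J)).le (rho_le_one _)
  have h2 := pow_le_one₀ (n := 2) (rho_pos 11).le (rho_le_one _)
  have h3 := rho_pos 11
  unfold gain
  have : rho (100 * J) ^ 38 * (rho 11 ^ 2 / 2) ≤ 1 * (rho 11 ^ 2 / 2) :=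
    mul_le_mul_of_nonneg_right h1 (by positivity)
  linarith

open Classical in
/-- Iterating the gain over well-separated scales. -/
lemma exists_conditioning {J : ℕ} (hJ : 4 / rho 11 ^ 2 ≤ J) (hJ1 : 1 ≤ J) {s : ℤ} (hs : 4 ≤ s)
    {D D' E E' : Set Vertex} (hD : ∀ v ∈ D, vnorm v ≤ 12 * (J * s))
    (hE : ∀ v ∈ E, vnorm v ≤ 12 * (J * s)) {T : Finset Edge} (ω : Config) (n : ℕ)
    (hD' : ∀ v ∈ D', 44 * (J * s * 100 ^ n) ≤ vnorm v)
    (hE' : ∀ v ∈ E', 44 * (J * s * 100 ^ n) ≤ vnorm v)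
    (hT : inside {v | vnorm v ≤ 44 * (J * s * 100 ^ n)} ⊆ T) :
    ∃ U ⊆ T, (U : Set Edge) ⊆ inside {v | vnorm v ≤ 12 * (J * s * 100 ^ n) - 2} ∧
      avg U (fun ω => avg (T \ U) (ind (arm D D')) ω *
        avg (T \ U) (ind (theta ⁻¹' arm E E')) ω) ω ≤
      (1 - gain J) ^ n * (avg T (ind (arm D D')) ω * avg T (ind (theta ⁻¹' arm E E')) ω) := by
  have hJs : 4 ≤ J * s := by
    have : (1 : ℤ) ≤ J := by exact_mod_cast hJ1
    nlinarith
  induction n with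
  | zero => exact ⟨∅, by simp, by simp, by simp⟩
  | succ n ih =>
    obtain ⟨t, ht⟩ : ∃ t : ℤ, t = J * s * 100 ^ n := ⟨_, rfl⟩
    have ht' : (J * s * 100 ^ (n + 1) : ℤ) = 100 * t := by rw [ht]; ring
    have hn : (1 : ℤ) ≤ 100 ^ n := one_le_pow₀ (by norm_num)
    have htJ : J * s ≤ t := by rw [ht]; nlinarith
    rw [ht'] at hD' hE' hT ⊢
    rw [← ht] at ih
    obtain ⟨U, hU, hUn, hUle⟩ := ih (fun v hv => (by omega : 44 * t ≤ 44 * (100 * t)).trans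
      (hD' v hv)) (fun v hv => (by omega : 44 * t ≤ 44 * (100 * t)).trans (hE' v hv))
      ((inside_mono (by intro v hv; rw [Set.mem_ofPred_eq] at *; omega)).trans hT)
    obtain ⟨a, b, c, d, B, B', hη⟩ := exists_good_box hJ hJ1 (s := s * 100 ^ n) (t := t)
      (by nlinarith) (by rw [ht]; ring)
    have hTU : inside {v | 12 * t - 1 ≤ vnorm v ∧ vnorm v ≤ 44 * t + 1} ⊆
        ((T \ U : Finset Edge) : Set Edge) := by
      intro e he
      rw [Finset.mem_coe, Finset.mem_sdiff]
      refine ⟨hT (inside_mono (fun v hv => ?_) he), fun h => ?_⟩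
      · have := hv.2
        rw [Set.mem_ofPred_eq]
        omega
      · have h1 := (hUn h).1
        have h2 := he.1.1
        rw [Set.mem_ofPred_eq] at h1
        omega
    have hS : ∀ e ∈ rectE a b c d, e ∈ inside {v | 12 * t ≤ vnorm v ∧ vnorm v ≤ 24 * t} := by
      intro e he
      refine inside_mono (fun v hv => ?_) (mem_rectE.1 he)
      obtain ⟨i1, i2, i3, i4, i5, i6, i7, i8, i9, i10⟩ := B
      rw [mem_rect] at hv
      rw [Set.mem_ofPred_eq, le_vnorm, vnorm_le]
      omega
    have hST : rectE a b c d ⊆ T \ U := fun e he => Finset.mem_coe.1 <| hTU <| by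
      refine inside_mono ?_ (hS e he)
      intro v hv
      exact ⟨by linarith [hv.1], by linarith [hv.2]⟩
    have hdis : Disjoint U (rectE a b c d) := Finset.disjoint_right.2 fun e he =>
      (Finset.mem_sdiff.1 (hST he)).2
    refine ⟨U ∪ rectE a b c d, Finset.union_subset hU fun e he => (Finset.mem_sdiff.1 (hST he)).1,
      ?_, ?_⟩
    · intro e he
      rcases Finset.mem_union.1 (Finset.mem_coe.1 he) with h | h
      · refine inside_mono ?_ (hUn h)
        intro v hv
        rw [Set.mem_ofPred_eq] at *
        omega
      · refine inside_mono ?_ (hS e h)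
        intro v hv
        have := hv.2
        rw [Set.mem_ofPred_eq]
        omega
    · have hsd : T \ (U ∪ rectE a b c d) = (T \ U) \ rectE a b c d := sdiff_sdiff_left.symm
      rw [avg_union hdis, hsd]
      have hstep := box_step hJ1 B B' (by rw [ht]; ring) (D := D) (D' := D') (E := E) (E' := E')
        (by intro v hv; have := hD v hv; omega) (by intro v hv; have := hD' v hv; omega)
        (by intro v hv; have := hE v hv; omega) (by intro v hv; have := hE' v hv; omega)
        hTU (by positivity) hη
      rw [← gain] at hstep
      refine (avg_mono U hstep ω).trans ?_
      rw [avg_mul_const, pow_succ', mul_assoc]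
      exact mul_le_mul_of_nonneg_left hUle (by linarith [gain_lt_one J])

/-- A gain over the Harris–FKG bound which is exponential in the number of scales. -/
lemma pr_A01_le {J : ℕ} (hJ : 4 / rho 11 ^ 2 ≤ J) (hJ1 : 1 ≤ J) {r R : ℤ} (hr : 1 ≤ r) {n : ℕ}
    (hR : 177 * J * r * 100 ^ n ≤ R) :
    pr (A01 r R) ≤ (1 - gain J) ^ n * (pr (A1 r R) * pr (A0 r R)) := by
  classical
  have hn : (1 : ℤ) ≤ 100 ^ n := one_le_pow₀ (by norm_num)
  have hJz : (1 : ℤ) ≤ J := by exact_mod_cast hJ1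
  obtain ⟨x, hx⟩ : ∃ x : ℤ, x = J * r := ⟨_, rfl⟩
  obtain ⟨y, hy⟩ : ∃ y : ℤ, y = x * 100 ^ n := ⟨_, rfl⟩
  have hrx : r ≤ x := by rw [hx]; nlinarith
  have hxy : x ≤ y := by rw [hy]; nlinarith
  have e1 : 177 * J * r * 100 ^ n = 177 * y := by rw [hy, hx]; ring
  have e2 : (J * (4 * r) * 100 ^ n : ℤ) = 4 * y := by rw [hy, hx]; ring
  have e3 : (J * (4 * r) : ℤ) = 4 * x := by rw [hx]; ring
  rw [e1] at hR
  have hlay : ∀ v : Vertex, vnorm v ≤ layer v + 1 ∧ layer v ≤ vnorm v := by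
    intro v
    have h1 := (layer_le (v := v)).1 le_rfl
    have h2 := (vnorm_le (v := v)).1 le_rfl
    refine ⟨vnorm_le.2 ?_, layer_le.2 ?_⟩ <;> omega
  obtain ⟨T, hT⟩ : ∃ T, T = rectE (-(R + 1)) (R + 1) (-(R + 1)) (R + 1) := ⟨_, rfl⟩
  have d1 : Dep (A1 r R) T := hT ▸ A1_dep (by omega)
  have d0 : Dep (A0 r R) T := hT ▸ A0_dep (by omega)
  let ω : Config := fun _ => false
  obtain ⟨U, hU, -, hle⟩ := exists_conditioning hJ hJ1 (s := 4 * r) (by omega)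
    (D := {v | vnorm v ≤ r}) (D' := {v | R ≤ vnorm v})
    (E := {v | layer v ≤ r}) (E' := {v | R - 1 ≤ layer v}) (T := T)
    (by intro v hv; rw [Set.mem_ofPred_eq] at hv; omega)
    (by intro v hv; rw [Set.mem_ofPred_eq] at hv; have := hlay v; omega) ω n
    (by intro v hv; rw [Set.mem_ofPred_eq] at hv; omega)
    (by intro v hv; rw [Set.mem_ofPred_eq] at hv; have := hlay v; omega)
    (by
      rw [hT, coe_rectE]
      refine inside_mono ?_
      intro v hv
      rw [Set.mem_ofPred_eq, vnorm_le] at hv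
      rw [mem_rect]
      omega)
  rw [← A1_eq_arm (by omega), ← A0_eq_arm (by omega)] at hle
  have m1 : Mono true (A1 r R) := by rw [A1_eq_arm (by omega)]; exact arm_mono _ _
  have m0 : Mono (!true) (A0 r R) := by
    rw [A0_eq_arm (by omega)]; exact theta_mono (arm_mono _ _)
  have e : A01 r R = A1 r R ∩ A0 r R := Set.inter_comm _ _
  rw [e, pr_eq_avg (d1.inter_same d0) ω, pr_eq_avg d1 ω, pr_eq_avg d0 ω]
  refine le_trans ?_ hle
  rw [avg_sdiff hU, ind_inter]
  exact avg_mono U (fun ω => avg_harris' _ (m1.monoF _) (m0.monoF _) ω) ω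

/-- The number of scales between `r` and `R` is of order `log (R / r)`. -/
lemma exists_scales {K r R : ℕ} (hK : 1 ≤ K) (hr : 1 ≤ r) (h : (100 * K) ^ 2 * r ≤ R) :
    ∃ n, K * r * 100 ^ n ≤ R ∧ R ≤ r * 10000 ^ n := by
  have hp : 0 < K * r := by positivity
  have hKr : K * r ≤ R := by nlinarith
  refine ⟨Nat.log 100 (R / (K * r)), ?_, ?_⟩
  · have := Nat.pow_log_le_self 100 (Nat.div_pos hKr hp).ne'
    rwa [Nat.le_div_iff_mul_le hp, mul_comm] at this
  · have h1 := Nat.lt_pow_succ_log_self (b := 100) (by norm_num) (R / (K * r))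
    rw [Nat.div_lt_iff_lt_mul hp] at h1
    set n := Nat.log 100 (R / (K * r))
    have e : (10000 : ℕ) ^ n = (100 ^ n) ^ 2 := by rw [← pow_mul, mul_comm, pow_mul]; norm_num
    rw [e]
    rw [Nat.succ_eq_add_one, pow_succ] at h1
    by_contra! hc
    have h2 := Nat.mul_lt_mul_of_lt_of_le hc h (by omega)
    have h3 := Nat.mul_lt_mul_of_lt_of_lt h1 h1
    nlinarith

/-- A bound decaying exponentially in the number of scales is polynomial in the ratio. -/
lemma exists_rpow_bound {x : ℝ} (h0 : 0 < x) (h1 : x < 1) : ∃ c : ℝ, 0 < c ∧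
    ∀ r R n : ℕ, 1 ≤ r → 1 ≤ R → R ≤ r * 10000 ^ n → x ^ n ≤ ((r : ℝ) / R) ^ c := by
  have hl : (0 : ℝ) < Real.log 10000 := Real.log_pos (by norm_num)
  refine ⟨-Real.log x / Real.log 10000, div_pos (neg_pos.2 (Real.log_neg h0 h1)) hl, ?_⟩
  intro r R n hr hR h
  have hr' : (0 : ℝ) < r := by exact_mod_cast hr
  have hR' : (0 : ℝ) < R := by exact_mod_cast hR
  have h2 : (R : ℝ) ≤ r * 10000 ^ n := by exact_mod_cast h
  rw [← Real.log_le_log_iff (by positivity) (by positivity), Real.log_pow,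
    Real.log_rpow (by positivity), div_mul_eq_mul_div, le_div_iff₀ hl,
    Real.log_div hr'.ne' hR'.ne']
  have h3 := Real.log_le_log hR' h2
  rw [Real.log_mul hr'.ne' (by positivity), Real.log_pow] at h3
  have := Real.log_neg h0 h1
  nlinarith

end FKArm

open FKArm in
/-- Improved FKG inequality for critical Bernoulli bond percolation on `ℤ²`:
a polynomial gain over the FKG bound for the alternating two-arm event. -/
theorem arm_exponent_strict_inequality_Bernoulli :
    ∃ c : ℝ, 0 < c ∧ ∃ M : ℕ, 1 ≤ M ∧
      ∀ μ : MeasureTheory.Measure Config, IsBernoulliHalf μ →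
        ∀ r R : ℕ, 1 ≤ r → M * r ≤ R →
          μ (A01 r R) ≤ ((r : ℝ≥0∞) / (R : ℝ≥0∞)) ^ c * μ (A1 r R) * μ (A0 r R) := by
  obtain ⟨J, hJ⟩ := exists_nat_ge (4 / rho 11 ^ 2)
  have hJ0 : (0 : ℝ) < 4 / rho 11 ^ 2 := by have := rho_pos 11; positivity
  have hJ1 : 1 ≤ J := by
    have : (0 : ℝ) < J := hJ0.trans_le hJ
    exact_mod_cast this
  have g0 := gain_pos J
  have g1 := gain_lt_one J
  obtain ⟨c, hc, hb⟩ := exists_rpow_bound (x := 1 - gain J) (by linarith) (by linarith)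
  refine ⟨c, hc, (100 * (177 * J)) ^ 2, Nat.one_le_pow _ _ (by omega), ?_⟩
  intro μ hμ r R hr hR
  obtain ⟨n, hn1, hn2⟩ := exists_scales (K := 177 * J) (by omega) hr hR
  have hR1 : 1 ≤ R := le_trans (Nat.mul_pos (by positivity) hr) hR
  have h1 := pr_A01_le hJ hJ1 (r := r) (R := R) (by exact_mod_cast hr) (n := n)
    (by exact_mod_cast hn1)
  have h2 : pr (A01 r R) ≤ ((r : ℝ) / R) ^ c * (pr (A1 r R) * pr (A0 r R)) :=
    h1.trans (mul_le_mul_of_nonneg_right (hb r R n hr hR1 hn2)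
      (mul_nonneg (pr_nonneg _) (pr_nonneg _)))
  have hr' : (0 : ℝ) < r := by exact_mod_cast hr
  have hR' : (0 : ℝ) < R := by exact_mod_cast hR1
  have key : ∀ A, μ A = ENNReal.ofReal (pr A) := by
    intro A
    rw [hμ.unique P_isBernoulliHalf, pr, MeasureTheory.ofReal_measureReal]
  rw [key, key, key, mul_assoc, ← ENNReal.ofReal_mul (pr_nonneg _)]
  refine (ENNReal.ofReal_le_ofReal h2).trans (le_of_eq ?_)
  rw [ENNReal.ofReal_mul (by positivity), ← ENNReal.ofReal_rpow_of_pos (by positivity),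
    ENNReal.ofReal_div_of_pos hR', ENNReal.ofReal_natCast, ENNReal.ofReal_natCast]
end

section
/- Let ε ∈ (0, 1/4] and let (Y¹, Y²) be a random pair with values in {0,1}² such that each of the four outcomes (0,0), (0,1), (1,0), (1,1) has probability at least ε. Then P[Y¹ + Y² ≥ 1 | Y¹ + Y² ≤ 1] ≤ (1 + ε²)^{−1} · P[Y¹ + Y² ≥ 1]. -/
open MeasureTheory ProbabilityTheory

/-- If two events `A`, `B` cover the space and each complement has probability at least `ε > 0`,
then conditioning on `B` makes `A` cheaper by a factor `(1 + ε²)⁻¹`. -/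
theorem cond_real_le_of_union_eq_univ {Ω : Type*} [MeasurableSpace Ω]
    {P : Measure Ω} [IsProbabilityMeasure P] {ε : ℝ} (hε : 0 < ε) {A B : Set Ω}
    (hA : MeasurableSet A) (hB : MeasurableSet B) (hAB : A ∪ B = Set.univ)
    (hεA : ε ≤ P.real Aᶜ) (hεB : ε ≤ P.real Bᶜ) :
    (P[|B]).real A ≤ (1 + ε ^ 2)⁻¹ * P.real A := by
  have hunion := measureReal_union_add_inter (μ := P) (s := A) hB
  rw [hAB, probReal_univ] at hunion
  rw [probReal_compl_eq_one_sub hA] at hεA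
  rw [probReal_compl_eq_one_sub hB] at hεB
  have hinter : 0 ≤ P.real (A ∩ B) := measureReal_nonneg
  have hBpos : 0 < P.real B := by linarith
  rw [measureReal_def, cond_apply hB, ENNReal.toReal_mul, ENNReal.toReal_inv, ← measureReal_def,
    ← measureReal_def, Set.inter_comm, inv_mul_le_iff₀ hBpos, mul_left_comm,
    le_inv_mul_iff₀ (by positivity)]
  have hprod : ε * ε ≤ (1 - P.real A) * (1 - P.real B) :=
    mul_le_mul hεA hεB hε.le (hε.le.trans hεA)
  have hle : P.real (A ∩ B) ≤ 1 := measureReal_le_one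
  nlinarith [mul_nonneg (sq_nonneg ε) (sub_nonneg.2 hle)]

/-- Single-scale estimate: if a pair `(Y¹, Y²)` of `{0,1}`-valued random
variables gives each of the four outcomes probability at least `ε`, then
conditioning on `Y¹ + Y² ≤ 1` makes the event `Y¹ + Y² ≥ 1` cheaper by a
factor `(1 + ε²)⁻¹`. -/
theorem single_scale_conditional_estimate {Ω : Type*} [MeasurableSpace Ω]
    (P : Measure Ω) [IsProbabilityMeasure P]
    (ε : ℝ) (hε : ε ∈ Set.Ioc (0 : ℝ) (1 / 4))
    (Y1 Y2 : Ω → ℕ) (hY1 : Measurable Y1) (hY2 : Measurable Y2)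
    (hv1 : ∀ ω, Y1 ω ≤ 1) (hv2 : ∀ ω, Y2 ω ≤ 1)
    (hlb : ∀ a b : ℕ, a ≤ 1 → b ≤ 1 →
      ENNReal.ofReal ε ≤ P {ω | Y1 ω = a ∧ Y2 ω = b}) :
    P[{ω | 1 ≤ Y1 ω + Y2 ω} | {ω | Y1 ω + Y2 ω ≤ 1}]
      ≤ ENNReal.ofReal (1 + ε ^ 2)⁻¹ * P {ω | 1 ≤ Y1 ω + Y2 ω} := by
  have hA : MeasurableSet {ω | 1 ≤ Y1 ω + Y2 ω} :=
    measurableSet_le measurable_const (hY1.add hY2)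
  have hB : MeasurableSet {ω | Y1 ω + Y2 ω ≤ 1} :=
    measurableSet_le (hY1.add hY2) measurable_const
  have hAB : {ω | 1 ≤ Y1 ω + Y2 ω} ∪ {ω | Y1 ω + Y2 ω ≤ 1} = Set.univ :=
    Set.eq_univ_of_forall fun ω => le_total 1 (Y1 ω + Y2 ω)
  have hεA : ε ≤ P.real {ω | 1 ≤ Y1 ω + Y2 ω}ᶜ := by
    refine (ENNReal.ofReal_le_iff_le_toReal (measure_ne_top _ _)).1
      ((hlb 0 0 (by simp) (by simp)).trans (measure_mono fun ω hω => ?_))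
    simp only [Set.mem_compl_iff, Set.mem_ofPred_eq] at hω ⊢
    lia
  have hεB : ε ≤ P.real {ω | Y1 ω + Y2 ω ≤ 1}ᶜ := by
    refine (ENNReal.ofReal_le_iff_le_toReal (measure_ne_top _ _)).1
      ((hlb 1 1 le_rfl le_rfl).trans (measure_mono fun ω hω => ?_))
    simp only [Set.mem_compl_iff, Set.mem_ofPred_eq] at hω ⊢
    lia
  rw [← ofReal_measureReal (μ := P), ← ofReal_measureReal (μ := P[|_]),
    ← ENNReal.ofReal_mul (by positivity)]
  exact ENNReal.ofReal_le_ofReal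
    (cond_real_le_of_union_eq_univ hε.1 hA hB hAB hεA hεB)
end
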